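/- arXiv:2206.00860 — 2 statements merged into one kernel-verified Lean document; each statement's English description precedes it below -/
import Mathlib

section
/- Under assumptions (A1)-(A3), let ρ¹_t = X(t,·;f)♯α₀ and ρ²_t = X(t,·;A[f])♯α₀, and define ξ_t = ∫_𝒳 ‖∇log ρ¹_t(x) - ∇log ρ²_t(x)‖² ρ²_t(x) dx. Then there exists a constant C₂, depending only on T and the regularity constants L₀, L_f, L_v, such that ∫₀ᵗ ξ_s ds ≤ C₂ R(f) for every t ∈ [0,T]. -/
open MeasureTheory Set
open scoped ENNReal

noncomputable section

abbrev E (d : ℕ) := EuclideanSpace ℝ (Fin d)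

def uvec (d : ℕ) (i : Fin d) : E d := EuclideanSpace.single i (1 : ℝ)

/-- The box `𝒳 = [-l/2, l/2]^d`. -/
def box (d : ℕ) (l : ℝ) : Set (E d) := {x | ∀ i, x i ∈ Icc (-(l / 2)) (l / 2)}

def IsPeriodic {d : ℕ} {β : Type*} (l : ℝ) (g : E d → β) : Prop :=
  ∀ (x : E d) (i : Fin d), g (x + l • uvec d i) = g x

/-- Divergence of a vector field on `ℝ^d`. -/
def diverg {d : ℕ} (F : E d → E d) (x : E d) : ℝ :=
  ∑ i, fderiv ℝ F x (uvec d i) i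

/-- Laplacian of a scalar function on `ℝ^d`. -/
def lap {d : ℕ} (φ : E d → ℝ) (x : E d) : ℝ :=
  diverg (fun y => gradient φ y) x

/-- The score (gradient of the log-density) of a positive density. -/
def score {d : ℕ} (g : E d → ℝ) (x : E d) : E d :=
  gradient (fun y => Real.log (g y)) x

/-- The velocity-consistency transformation `A[f](t,x) = -∇V(t,x) - ∇log ρ¹(t,x;f)`,
expressed through the density trajectory `ρ1` of `f`. -/
def Avf {d : ℕ} (V : ℝ → E d → ℝ) (ρ1 : ℝ → E d → ℝ) (t : ℝ) : E d → E d :=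
  fun x => -gradient (V t) x - score (ρ1 t) x

/-- The self-consistency residual `δ(t,x;f) = f(t,x) - A[f](t,x)`. -/
def deltaF {d : ℕ} (f : ℝ → E d → E d) (V ρ1 : ℝ → E d → ℝ) (t : ℝ) : E d → E d :=
  fun x => f t x - Avf V ρ1 t x

/-- The self-consistency potential
`R(f) = ∫₀ᵀ ∫_𝒳 Σ_{i=0}^{2} ‖δ^{(i)}(t,x;f)‖² ρ¹(t,x;f) dx dt`. -/
def Rloss (d : ℕ) (l T : ℝ) (f : ℝ → E d → E d) (V ρ1 : ℝ → E d → ℝ) : ℝ :=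
  ∫ t in (0 : ℝ)..T, ∫ x in box d l,
    (‖deltaF f V ρ1 t x‖ ^ 2 + ‖fderiv ℝ (deltaF f V ρ1 t) x‖ ^ 2
      + ‖fderiv ℝ (fun y => fderiv ℝ (deltaF f V ρ1 t) y) x‖ ^ 2) * ρ1 t x

/-- The measure on `𝒳` with density `g` w.r.t. Lebesgue measure. -/
def densM {d : ℕ} (l : ℝ) (g : E d → ℝ) : Measure (E d) :=
  (volume.restrict (box d l)).withDensity (fun x => ENNReal.ofReal (g x))

/-- Squared Wasserstein-2 distance, as an infimum over couplings. -/
def W2sq {d : ℕ} (μ ν : Measure (E d)) : ℝ≥0∞ :=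
  ⨅ π ∈ {π : Measure (E d × E d) | π.map Prod.fst = μ ∧ π.map Prod.snd = ν},
    ∫⁻ q, ENNReal.ofReal (‖q.1 - q.2‖ ^ 2) ∂π

/-- (A1): regularity of the initial density `α₀`. -/
def RegInit (d : ℕ) (l L₀ : ℝ) (α₀ : E d → ℝ) : Prop :=
  ∀ x ∈ box d l,
    (∀ i ∈ Finset.Icc 1 3, ‖iteratedFDeriv ℝ i (fun y => Real.log (α₀ y)) x‖ ≤ L₀) ∧
    ‖iteratedFDeriv ℝ 2 (fun y => lap (fun z => Real.log (α₀ z)) y) x‖ ≤ L₀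

/-- (A2): regularity of a hypothesis velocity field. -/
def RegVel (d : ℕ) (l T Lf : ℝ) (f : ℝ → E d → E d) : Prop :=
  ∀ t ∈ Icc (0 : ℝ) T, IsPeriodic l (f t) ∧
    ∀ x ∈ box d l, ∀ i ∈ Finset.Icc 1 4,
      ‖iteratedFDeriv ℝ i (f t) x‖ ≤ Lf ∧
      ‖iteratedFDeriv ℝ i (fun y => diverg (f t) y) x‖ ≤ Lf

/-- (A3): regularity of the drift potential `V`. -/
def RegPot (d : ℕ) (l T Lv : ℝ) (V : ℝ → E d → ℝ) : Prop :=
  ∀ t ∈ Icc (0 : ℝ) T, IsPeriodic l (V t) ∧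
    ∀ x ∈ box d l,
      ‖iteratedFDeriv ℝ 2 (V t) x‖ ≤ Lv ∧ ‖iteratedFDeriv ℝ 3 (V t) x‖ ≤ Lv ∧
      ‖iteratedFDeriv ℝ 2 (fun y => lap (V t) y) x‖ ≤ Lv

/-- `α₀` is a smooth, positive, `l`-periodic probability density on `𝒳`. -/
def InitDensity (d : ℕ) (l : ℝ) (α₀ : E d → ℝ) : Prop :=
  ContDiff ℝ (⊤ : ℕ∞) α₀ ∧ (∀ x, 0 < α₀ x) ∧ IsPeriodic l α₀ ∧ (∫ x in box d l, α₀ x) = 1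

/-- `ρ` is the (smooth, positive, periodic) density trajectory transported by the
velocity field `v` from `α₀`, i.e. `ρ(t,·) = X(t,·;v)♯α₀`; equivalently `ρ` solves the
continuity equation `∂_t ρ + div(ρ v) = 0` with `ρ(0,·) = α₀`. -/
def TransportedBy (d : ℕ) (l : ℝ) (v : ℝ → E d → E d) (α₀ : E d → ℝ)
    (ρ : ℝ → E d → ℝ) : Prop :=
  (∀ t, ContDiff ℝ (⊤ : ℕ∞) (ρ t)) ∧ (∀ t x, 0 < ρ t x) ∧ (∀ t, IsPeriodic l (ρ t)) ∧
  ρ 0 = α₀ ∧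
  ∀ t x, HasDerivAt (fun τ => ρ τ x) (-(diverg (fun y => ρ t y • v t y) x)) t

/-- `αs` is the (smooth, positive, periodic) solution of the Fokker–Planck equation
`∂_t α + div(α(-∇V - ∇log α)) = 0`, i.e. `∂_t α = Δα + div(α ∇V)`, with `α(0,·) = α₀`. -/
def SolvesFPE (d : ℕ) (l : ℝ) (V : ℝ → E d → ℝ) (α₀ : E d → ℝ)
    (αs : ℝ → E d → ℝ) : Prop :=
  (∀ t, ContDiff ℝ (⊤ : ℕ∞) (αs t)) ∧ (∀ t x, 0 < αs t x) ∧ (∀ t, IsPeriodic l (αs t)) ∧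
  αs 0 = α₀ ∧
  ∀ t x, HasDerivAt (fun τ => αs τ x)
    (lap (αs t) x + diverg (fun y => αs t y • gradient (V t) y) x) t

/-! ### Iterated finite differences -/

section Differences

set_option linter.unusedSectionVars false

variable {d : ℕ} {F G : Type*} [NormedAddCommGroup F] [NormedSpace ℝ F]
  [NormedAddCommGroup G] [NormedSpace ℝ G]

/-- Iterated forward differences of `g` with the increments listed in `L`. -/
def iterDiff : List (E d) → (E d → F) → E d → F
  | [], g => g
  | h :: L, g => iterDiff L (fwdDiff h g)

/-- All `k`-th order finite differences of `g` are bounded by `B` times the product of the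
lengths of the increments. -/
def DiffBound (k : ℕ) (B : ℝ) (g : E d → F) : Prop :=
  ∀ L : List (E d), L.length = k → ∀ x, ‖iterDiff L g x‖ ≤ B * (L.map norm).prod

lemma prod_map_norm_nonneg (L : List (E d)) : 0 ≤ (L.map norm).prod :=
  List.prod_nonneg (by simp)

lemma fwdDiff_comm (h h' : E d) (g : E d → F) :
    fwdDiff h (fwdDiff h' g) = fwdDiff h' (fwdDiff h g) := by
  funext x
  simp only [fwdDiff, add_right_comm x h h']
  abel

lemma iterDiff_fwdDiff (L : List (E d)) (h : E d) (g : E d → F) :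
    iterDiff L (fwdDiff h g) = fwdDiff h (iterDiff L g) := by
  induction L generalizing g with
  | nil => rfl
  | cons h' L ih => rw [iterDiff, fwdDiff_comm, ih, iterDiff]

lemma iterDiff_add (L : List (E d)) (g g' : E d → F) :
    iterDiff L (fun x => g x + g' x) = fun x => iterDiff L g x + iterDiff L g' x := by
  induction L generalizing g g' with
  | nil => rfl
  | cons h L ih =>
    rw [iterDiff, iterDiff, iterDiff, ← ih]
    congr 1
    funext x
    simp only [fwdDiff]
    abel

lemma iterDiff_clm (L : List (E d)) (g : E d → F) (A : F →L[ℝ] G) :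
    iterDiff L (fun x => A (g x)) = fun x => A (iterDiff L g x) := by
  induction L generalizing g with
  | nil => rfl
  | cons h L ih =>
    rw [iterDiff, iterDiff, ← ih]
    congr 1
    funext x
    simp only [fwdDiff, map_sub]

lemma iterDiff_neg (L : List (E d)) (g : E d → F) :
    iterDiff L (fun x => -g x) = fun x => -iterDiff L g x :=
  iterDiff_clm L g (-ContinuousLinearMap.id ℝ F)

lemma iterDiff_shift (L : List (E d)) (g : E d → F) (a : E d) :
    iterDiff L (fun x => g (x + a)) = fun x => iterDiff L g (x + a) := by
  induction L generalizing g with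
  | nil => rfl
  | cons h L ih =>
    rw [iterDiff, iterDiff, ← ih]
    congr 1
    funext x
    simp only [fwdDiff, add_right_comm x h a]

lemma differentiable_iterDiff (L : List (E d)) {g : E d → F} (hg : Differentiable ℝ g) :
    Differentiable ℝ (iterDiff L g) := by
  induction L generalizing g with
  | nil => exact hg
  | cons h L ih => exact ih ((hg.comp (differentiable_id.add_const h)).sub hg)

lemma continuous_iterDiff (L : List (E d)) {g : E d → F} (hg : Continuous g) :
    Continuous (iterDiff L g) := by
  induction L generalizing g with
  | nil => exact hg
  | cons h L ih => exact ih ((hg.comp (continuous_id.add continuous_const)).sub hg)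

lemma fderiv_iterDiff (L : List (E d)) {g : E d → F} (hg : Differentiable ℝ g) :
    fderiv ℝ (iterDiff L g) = iterDiff L (fderiv ℝ g) := by
  induction L generalizing g with
  | nil => rfl
  | cons h L ih =>
    have hd' : Differentiable ℝ (fwdDiff h g) := (hg.comp (differentiable_id.add_const h)).sub hg
    rw [iterDiff, iterDiff, ih hd']
    congr 1
    funext x
    have h1 : HasFDerivAt (fun y => g (y + h)) (fderiv ℝ g (x + h)) x :=
      (hasFDerivAt_comp_add_right h).2 (hg (x + h)).hasFDerivAt
    exact (h1.sub (hg x).hasFDerivAt).fderiv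

lemma IsPeriodic.fwdDiff {l : ℝ} {g : E d → F} (hg : IsPeriodic l g) (h : E d) :
    IsPeriodic l (fwdDiff h g) := by
  intro x i
  simp only [_root_.fwdDiff, add_right_comm x _ h, hg _ i]

lemma IsPeriodic.iterDiff {l : ℝ} {g : E d → F} (hg : IsPeriodic l g) (L : List (E d)) :
    IsPeriodic l (iterDiff L g) := by
  induction L generalizing g with
  | nil => exact hg
  | cons h L ih => exact ih (hg.fwdDiff h)

lemma IsPeriodic.fderiv {l : ℝ} {g : E d → F} (hg : IsPeriodic l g) :
    IsPeriodic l (fderiv ℝ g) := by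
  intro x i
  rw [← fderiv_comp_add_right]
  congr 1
  funext y
  exact hg y i

lemma IsPeriodic.comp {l : ℝ} {β γ : Type*} {g : E d → β} (hg : IsPeriodic l g) (A : β → γ) :
    IsPeriodic l (fun x => A (g x)) := fun x i => congrArg A (hg x i)

lemma IsPeriodic.map₂ {l : ℝ} {β γ δ : Type*} {g : E d → β} {g' : E d → γ}
    (hg : IsPeriodic l g) (hg' : IsPeriodic l g') (A : β → γ → δ) :
    IsPeriodic l (fun x => A (g x) (g' x)) := fun x i => congrArg₂ A (hg x i) (hg' x i)

/-! ### Bounds on finite differences -/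

lemma DiffBound.mono {k : ℕ} {B B' : ℝ} {g : E d → F} (hg : DiffBound k B g) (h : B ≤ B') :
    DiffBound k B' g := fun L hL x =>
  (hg L hL x).trans (mul_le_mul_of_nonneg_right h (prod_map_norm_nonneg L))

lemma diffBound_zero {B : ℝ} {g : E d → F} : DiffBound 0 B g ↔ ∀ x, ‖g x‖ ≤ B := by
  constructor
  · intro h x
    simpa [iterDiff] using h [] rfl x
  · intro h L hL x
    obtain rfl := List.length_eq_zero_iff.1 hL
    simpa [iterDiff] using h x

lemma diffBound_succ {k : ℕ} {B : ℝ} {g : E d → F} :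
    DiffBound (k + 1) B g ↔ ∀ h, DiffBound k (B * ‖h‖) (fwdDiff h g) := by
  constructor
  · intro H h L hL x
    have := H (h :: L) (by simp [hL]) x
    simpa [iterDiff, mul_assoc] using this
  · intro H L hL x
    match L, hL with
    | h :: L, hL =>
      have := H h L (by simpa using hL) x
      simpa [iterDiff, mul_assoc] using this

lemma diffBound_one {B : ℝ} {g : E d → F} :
    DiffBound 1 B g ↔ ∀ x h, ‖g (x + h) - g x‖ ≤ B * ‖h‖ := by
  rw [diffBound_succ]
  simp only [diffBound_zero, fwdDiff]
  exact forall_comm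

lemma DiffBound.lipschitz {B : ℝ} {g : E d → F} (hg : DiffBound 1 B g) (x y : E d) :
    ‖g x - g y‖ ≤ B * ‖x - y‖ := by
  simpa using diffBound_one.1 hg y (x - y)

lemma DiffBound.add {k : ℕ} {B B' : ℝ} {g g' : E d → F} (hg : DiffBound k B g)
    (hg' : DiffBound k B' g') : DiffBound k (B + B') (fun x => g x + g' x) := by
  intro L hL x
  rw [iterDiff_add, add_mul]
  exact norm_add_le_of_le (hg L hL x) (hg' L hL x)

lemma DiffBound.neg {k : ℕ} {B : ℝ} {g : E d → F} (hg : DiffBound k B g) :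
    DiffBound k B (fun x => -g x) := by
  intro L hL x
  rw [iterDiff_neg, norm_neg]
  exact hg L hL x

lemma DiffBound.clm {k : ℕ} {B : ℝ} {g : E d → F} (hg : DiffBound k B g) (A : F →L[ℝ] G) :
    DiffBound k (‖A‖ * B) (fun x => A (g x)) := by
  intro L hL x
  rw [iterDiff_clm, mul_assoc]
  exact A.le_opNorm_of_le (hg L hL x)

lemma DiffBound.shift {k : ℕ} {B : ℝ} {g : E d → F} (hg : DiffBound k B g) (a : E d) :
    DiffBound k B (fun x => g (x + a)) := by
  intro L hL x
  rw [iterDiff_shift]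
  exact hg L hL _

lemma DiffBound.fderiv {k : ℕ} {B : ℝ} {g : E d → F} (hg : DiffBound (k + 1) B g) (hB : 0 ≤ B)
    (hd : Differentiable ℝ g) : DiffBound k B (fderiv ℝ g) := by
  intro L hL x
  rw [← fderiv_iterDiff L hd]
  refine norm_fderiv_le_of_lip' ℝ (mul_nonneg hB (prod_map_norm_nonneg L)) ?_
  refine Filter.Eventually.of_forall fun y => ?_
  have := diffBound_succ.1 hg (y - x) L hL x
  rw [iterDiff_fwdDiff] at this
  simp only [fwdDiff, add_sub_cancel] at this
  linarith [this]

lemma diffBound_of_fderiv {k : ℕ} {B : ℝ} {g : E d → F} (hd : Differentiable ℝ g)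
    (hg : DiffBound k B (fderiv ℝ g)) : DiffBound (k + 1) B g := by
  intro L hL x
  match L, hL with
  | h :: L, hL =>
    rw [iterDiff, iterDiff_fwdDiff]
    have key := Convex.norm_image_sub_le_of_norm_fderiv_le (𝕜 := ℝ) (f := iterDiff L g)
      (C := B * (L.map norm).prod) (s := univ) (x := x) (y := x + h)
      (fun y _ => (differentiable_iterDiff L hd) y)
      (fun y _ => by
        rw [fderiv_iterDiff L hd]
        exact hg L (by simpa using hL) y) convex_univ (mem_univ _) (mem_univ _)
    simp only [fwdDiff, List.map_cons, List.prod_cons]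
    simp only [add_sub_cancel_left] at key
    linarith

lemma diffBound_of_iteratedFDeriv {k : ℕ} {B : ℝ} {g : E d → F} (hg : ContDiff ℝ k g)
    (hb : ∀ x, ‖iteratedFDeriv ℝ k g x‖ ≤ B) : DiffBound k B g := by
  induction k generalizing F with
  | zero => exact diffBound_zero.2 fun x => by simpa using hb x
  | succ k ih =>
    refine diffBound_of_fderiv (hg.differentiable (by simp)) (ih ?_ ?_)
    · exact hg.fderiv_right (by norm_cast)
    · intro x
      rw [norm_iteratedFDeriv_fderiv]
      exact hb x

end Differences

/-! ### Periodic functions -/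

section Periodic

variable {d : ℕ} {l : ℝ}

/-- The vector of the lattice `l ℤ^d` with integer coordinates `k`. -/
def latticeVec (l : ℝ) (k : Fin d → ℤ) : E d := ∑ i, (k i : ℝ) • l • uvec d i

lemma latticeVec_apply (k : Fin d → ℤ) (j : Fin d) : latticeVec l k j = k j * l := by
  simp [latticeVec, uvec, Finset.sum_apply, Pi.single_apply]

lemma IsPeriodic.add_zsmul {β : Type*} {g : E d → β} (hg : IsPeriodic l g) (i : Fin d) (n : ℤ)
    (x : E d) : g (x + (n : ℝ) • l • uvec d i) = g x := by
  have hper : Function.Periodic g (l • uvec d i) := fun x => hg x i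
  have := hper.zsmul n x
  rwa [← Int.cast_smul_eq_zsmul ℝ] at this

lemma IsPeriodic.add_latticeVec {β : Type*} {g : E d → β} (hg : IsPeriodic l g) (k : Fin d → ℤ)
    (x : E d) : g (x + latticeVec l k) = g x := by
  classical
  unfold latticeVec
  generalize (Finset.univ : Finset (Fin d)) = s
  induction s using Finset.induction_on generalizing x with
  | empty => simp
  | insert i s hi ih => rw [Finset.sum_insert hi, ← add_assoc, ih, hg.add_zsmul]

lemma exists_add_latticeVec_mem_box (hl : 0 < l) (x : E d) :
    ∃ k : Fin d → ℤ, x + latticeVec l k ∈ box d l := by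
  refine ⟨fun i => -round (x i / l), fun i => ?_⟩
  have h := abs_sub_round (x i / l)
  rw [abs_le] at h
  have h1 : x i = x i / l * l := by field_simp
  rw [PiLp.add_apply, latticeVec_apply]
  push_cast
  constructor <;> nlinarith

lemma box_eq_preimage : box d l =
    (EuclideanSpace.equiv (Fin d) ℝ) ⁻¹' Icc (fun _ => -(l / 2)) (fun _ => l / 2) := by
  ext x
  simp [box, Pi.le_def, forall_and]

lemma isCompact_box : IsCompact (box d l) := by
  rw [box_eq_preimage]
  exact (EuclideanSpace.equiv (Fin d) ℝ).toHomeomorph.isCompact_preimage.2 isCompact_Icc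

lemma measurableSet_box : MeasurableSet (box d l) := isCompact_box.measurableSet

lemma zero_mem_box (hl : 0 < l) : (0 : E d) ∈ box d l := fun i => by
  constructor <;> simp <;> linarith

lemma exists_box_radius (d : ℕ) (l : ℝ) : ∃ R : ℝ, 1 ≤ R ∧ ∀ v ∈ box d l, ‖v‖ ≤ R := by
  obtain ⟨R, hR⟩ := (isCompact_box (d := d) (l := l)).isBounded.exists_norm_le
  exact ⟨max 1 R, le_max_left _ _, fun v hv => (hR v hv).trans (le_max_right _ _)⟩

lemma IsPeriodic.forall_of_box {β : Type*} {g : E d → β} (hl : 0 < l) (hg : IsPeriodic l g)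
    {P : β → Prop} (h : ∀ x ∈ box d l, P (g x)) (x : E d) : P (g x) := by
  obtain ⟨k, hk⟩ := exists_add_latticeVec_mem_box hl x
  rw [← hg.add_latticeVec k]
  exact h _ hk

variable {F : Type*} [NormedAddCommGroup F] [NormedSpace ℝ F]

set_option linter.unusedSectionVars false

lemma IsPeriodic.iteratedFDeriv {g : E d → F} (hg : IsPeriodic l g) (k : ℕ) :
    IsPeriodic l (iteratedFDeriv ℝ k g) := by
  intro x i
  rw [← iteratedFDeriv_comp_add_right]
  congr 1
  funext y
  exact hg y i

lemma IsPeriodic.exists_norm_le {g : E d → F} (hl : 0 < l) (hg : IsPeriodic l g)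
    (hc : Continuous g) : ∃ M, 0 ≤ M ∧ ∀ x, ‖g x‖ ≤ M := by
  obtain ⟨M, hM⟩ := (isCompact_box (d := d) (l := l)).exists_bound_of_continuousOn hc.continuousOn
  exact ⟨max 0 M, le_max_left _ _,
    hg.forall_of_box hl (P := fun y => ‖y‖ ≤ max 0 M) fun x hx =>
      (hM x hx).trans (le_max_right _ _)⟩

lemma IsPeriodic.exists_diffBound {g : E d → F} (hl : 0 < l) (hg : IsPeriodic l g) {k : ℕ}
    (hc : ContDiff ℝ k g) : ∃ B, 0 ≤ B ∧ DiffBound k B g := by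
  obtain ⟨M, hM, h⟩ := (hg.iteratedFDeriv k).exists_norm_le hl
    (hc.continuous_iteratedFDeriv (by norm_cast))
  exact ⟨M, hM, diffBound_of_iteratedFDeriv hc h⟩

lemma IsPeriodic.diffBound_of_box {g : E d → F} (hl : 0 < l) (hg : IsPeriodic l g) {k : ℕ} {B : ℝ}
    (hc : ContDiff ℝ k g) (h : ∀ x ∈ box d l, ‖_root_.iteratedFDeriv ℝ k g x‖ ≤ B) :
    DiffBound k B g :=
  diffBound_of_iteratedFDeriv hc
    ((hg.iteratedFDeriv k).forall_of_box hl (P := fun y => ‖y‖ ≤ B) h)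

lemma DiffBound.osc_le {g : E d → F} (hl : 0 < l) (hg : IsPeriodic l g) {R B : ℝ}
    (hR : ∀ v ∈ box d l, ‖v‖ ≤ R) (hB : 0 ≤ B) (h : DiffBound 1 B g) (x y : E d) :
    ‖g x - g y‖ ≤ B * R := by
  obtain ⟨k, hk⟩ := exists_add_latticeVec_mem_box hl (x - y)
  rw [← hg.add_latticeVec k x]
  refine (h.lipschitz _ _).trans (mul_le_mul_of_nonneg_left (hR _ ?_) hB)
  rwa [add_sub_right_comm]

/-- A forward difference of a bounded function has zero mean along its orbit, so it is bounded by
its own oscillation. -/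
lemma norm_fwdDiff_le_of_osc {g : E d → F} {M ε : ℝ} (hM : ∀ x, ‖g x‖ ≤ M) (h : E d)
    (hosc : ∀ x y, ‖fwdDiff h g x - fwdDiff h g y‖ ≤ ε) (x : E d) : ‖fwdDiff h g x‖ ≤ ε := by
  have key : ∀ N : ℕ, (N : ℝ) * ‖fwdDiff h g x‖ ≤ 2 * M + N * ε := by
    intro N
    have tel : ∑ n ∈ Finset.range N, fwdDiff h g (x + (n : ℝ) • h) = g (x + (N : ℝ) • h) - g x := by
      have := Finset.sum_range_sub (fun n : ℕ => g (x + (n : ℝ) • h)) N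
      simp only [Nat.cast_zero, zero_smul, add_zero] at this
      rw [← this]
      refine Finset.sum_congr rfl fun n _ => ?_
      simp only [fwdDiff]
      congr 2
      push_cast
      module
    have e : (N : ℝ) • fwdDiff h g x = (g (x + (N : ℝ) • h) - g x) +
        ∑ n ∈ Finset.range N, (fwdDiff h g x - fwdDiff h g (x + (n : ℝ) • h)) := by
      rw [Finset.sum_sub_distrib, tel]
      simp [Nat.cast_smul_eq_nsmul]
    calc (N : ℝ) * ‖fwdDiff h g x‖ = ‖(N : ℝ) • fwdDiff h g x‖ := by
          rw [norm_smul]; simp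
      _ ≤ (M + M) + N * ε := by
          rw [e]
          refine norm_add_le_of_le (norm_sub_le_of_le (hM _) (hM _)) ?_
          refine (norm_sum_le_of_le _ fun n _ => hosc _ _).trans ?_
          simp
      _ = _ := by ring
  by_contra hlt
  push Not at hlt
  obtain ⟨N, hN⟩ := exists_nat_gt (2 * M / (‖fwdDiff h g x‖ - ε))
  rw [div_lt_iff₀ (by linarith)] at hN
  have := key N
  nlinarith

lemma DiffBound.lower {g : E d → F} (hl : 0 < l) (hg : IsPeriodic l g) (hc : Continuous g)
    {R B : ℝ} {k : ℕ} (hR : ∀ v ∈ box d l, ‖v‖ ≤ R) (hB : 0 ≤ B) (h : DiffBound (k + 2) B g) :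
    DiffBound (k + 1) (B * R) g := by
  intro L hL x
  match L, hL with
  | v :: L, hL =>
    obtain ⟨M, -, hM⟩ := (hg.iterDiff L).exists_norm_le hl (continuous_iterDiff L hc)
    rw [_root_.iterDiff, iterDiff_fwdDiff]
    refine norm_fwdDiff_le_of_osc hM v (fun y z => ?_) x
    have h1 : DiffBound 1 (B * ((v :: L).map norm).prod) (fwdDiff v (_root_.iterDiff L g)) := by
      rw [diffBound_one]
      intro y w
      have := h (w :: v :: L) (by simpa using hL) y
      rw [_root_.iterDiff, iterDiff_fwdDiff, _root_.iterDiff, iterDiff_fwdDiff] at this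
      rw [List.map_cons, List.prod_cons] at this
      simp only [fwdDiff] at this ⊢
      linarith
    refine (h1.osc_le hl ((hg.iterDiff L).fwdDiff v) hR
      (mul_nonneg hB (prod_map_norm_nonneg _)) y z).trans (le_of_eq (by ring))

end Periodic

/-! ### Leibniz bounds for finite differences of inner products -/

section Leibniz

variable {d : ℕ}

lemma fwdDiff_inner (h : E d) (b p : E d → E d) :
    fwdDiff h (fun x => inner ℝ (b x) (p x)) =
      fun x => inner ℝ (fwdDiff h b x) (p x) + inner ℝ (b (x + h)) (fwdDiff h p x) := by
  funext x
  simp only [fwdDiff, inner_sub_left, inner_sub_right]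
  ring

lemma DiffBound.inner {k : ℕ} {b p : E d → E d} {β π : ℝ}
    (hb : ∀ j ≤ k, DiffBound j β b) (hp : ∀ j ≤ k, DiffBound j π p) :
    DiffBound k (2 ^ k * β * π) (fun x => inner ℝ (b x) (p x)) := by
  induction k generalizing b p β π with
  | zero =>
    refine diffBound_zero.2 fun x => ?_
    have h1 := diffBound_zero.1 (hb 0 le_rfl) x
    have h2 := diffBound_zero.1 (hp 0 le_rfl) x
    have h3 := norm_inner_le_norm (𝕜 := ℝ) (b x) (p x)
    have := mul_le_mul h1 h2 (norm_nonneg _) ((norm_nonneg _).trans h1)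
    simpa using h3.trans this
  | succ k ih =>
    refine diffBound_succ.2 fun h => ?_
    rw [fwdDiff_inner]
    have h1 := ih (fun j hj => diffBound_succ.1 (hb (j + 1) (by omega)) h)
      (fun j hj => hp j (by omega))
    have h2 := ih (fun j hj => (hb j (by omega)).shift h)
      (fun j hj => diffBound_succ.1 (hp (j + 1) (by omega)) h)
    refine (h1.add h2).mono (le_of_eq ?_)
    ring

lemma norm_iterDiff_inner_sub_le {L : List (E d)} {b p : E d → E d} {β π : ℝ} (hβ : 0 ≤ β)
    (hπ : 0 ≤ π)
    (hb : ∀ j, 1 ≤ j → j ≤ L.length → DiffBound j β b)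
    (hp : ∀ j < L.length, DiffBound j π p) (x : E d) :
    ‖iterDiff L (fun y => inner ℝ (b y) (p y)) x - inner ℝ (b (x + L.sum)) (iterDiff L p x)‖ ≤
      2 ^ L.length * β * π * (L.map norm).prod := by
  induction L generalizing b p β π with
  | nil =>
    simp only [iterDiff, List.sum_nil, add_zero, sub_self, norm_zero, List.length_nil, pow_zero,
      List.map_nil, List.prod_nil, mul_one, one_mul]
    positivity
  | cons h L ih =>
    simp only [List.length_cons] at hb hp
    rw [iterDiff, iterDiff, fwdDiff_inner, iterDiff_add]
    have h1 := DiffBound.inner (fun j hj => diffBound_succ.1 (hb (j + 1) (by omega) (by omega)) h)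
      (fun j hj => hp j (by omega)) L rfl x
    have h2 := ih hβ (mul_nonneg hπ (norm_nonneg h)) (fun j hj hj' => (hb j hj (by omega)).shift h)
      (fun j hj => diffBound_succ.1 (hp (j + 1) (by omega)) h)
    rw [List.sum_cons, show x + (h + L.sum) = x + L.sum + h by abel]
    simp only [List.length_cons, List.map_cons, List.prod_cons]
    rw [add_sub_assoc]
    refine (norm_add_le_of_le h1 h2).trans (le_of_eq ?_)
    ring

end Leibniz

/-! ### A space-time maximum principle -/

section MaximumPrinciple

variable {d : ℕ} {l : ℝ}

lemma le_of_periodic_evolution (hl : 0 < l) {g g' : ℝ → E d → ℝ} {s t κ m : ℝ}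
    (hc : ContinuousOn (Function.uncurry g) (uIcc s t ×ˢ univ))
    (hper : ∀ τ ∈ uIcc s t, IsPeriodic l (g τ))
    (ht : ∀ τ ∈ uIcc s t, ∀ x, HasDerivAt (fun τ => g τ x) (g' τ x) τ)
    (hκ : ∀ τ ∈ uIcc s t, ∀ x, fderiv ℝ (g τ) x = 0 → |g' τ x| ≤ κ)
    (hs : ∀ x, g s x ≤ m) (x : E d) : g t x ≤ m + κ * |t - s| := by
  refine le_of_forall_pos_le_add fun ε hε => ?_
  refine (hper t right_mem_uIcc).forall_of_box hl (P := fun y => y ≤ m + κ * |t - s| + ε)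
    (fun x hx => ?_) x
  have hmem : ∀ θ ∈ Icc (0 : ℝ) 1, s + θ * (t - s) ∈ uIcc s t := by
    intro θ hθ
    rw [← segment_eq_uIcc, segment_eq_image']
    exact ⟨θ, hθ, by simp⟩
  set Z : ℝ × E d → ℝ := fun q => g (s + q.1 * (t - s)) q.2 - (κ * |t - s| + ε) * q.1 with hZ
  have hZc : ContinuousOn Z (Icc (0 : ℝ) 1 ×ˢ box d l) := by
    refine ContinuousOn.sub ?_ (by fun_prop)
    exact hc.comp (f := fun q : ℝ × E d => (s + q.1 * (t - s), q.2)) (by fun_prop)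
      fun q hq => ⟨hmem _ hq.1, mem_univ _⟩
  obtain ⟨⟨θ, y⟩, hq, hmax⟩ := (isCompact_Icc.prod (isCompact_box (d := d) (l := l))).exists_isMaxOn
    ⟨(0, 0), ⟨by simp, zero_mem_box hl⟩⟩ hZc
  have hθ : θ ∈ Icc (0 : ℝ) 1 := hq.1
  have hy : y ∈ box d l := hq.2
  have hm : ∀ θ' ∈ Icc (0 : ℝ) 1, ∀ z ∈ box d l, Z (θ', z) ≤ Z (θ, y) := fun θ' h z hz =>
    hmax (a := (θ', z)) ⟨h, hz⟩
  rcases hθ.1.eq_or_lt with h0 | hpos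
  · subst h0
    have h1 := hm 1 (by simp) x hx
    have h2 := hs y
    simp only [hZ, one_mul, zero_mul, add_zero, mul_zero, sub_zero, mul_one, add_sub_cancel] at h1
    linarith
  · exfalso
    set τ := s + θ * (t - s)
    have hτ : τ ∈ uIcc s t := hmem θ hθ
    have hgrad : fderiv ℝ (g τ) y = 0 := by
      refine IsLocalMax.fderiv_eq_zero (Filter.Eventually.of_forall fun z => ?_)
      refine (hper τ hτ).forall_of_box hl (P := fun v => v ≤ g τ y) (fun z hz => ?_) z
      have := hm θ hθ z hz
      simpa only [hZ, sub_le_sub_iff_right] using this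
    have hb := hκ τ hτ y hgrad
    have hd1 : HasDerivAt (fun θ' : ℝ => s + θ' * (t - s)) (t - s) θ := by
      simpa using ((hasDerivAt_id θ).mul_const (t - s)).const_add s
    have hd2 : HasDerivAt (fun θ' : ℝ => Z (θ', y))
        (g' τ y * (t - s) - (κ * |t - s| + ε)) θ := by
      have := ((ht τ hτ y).comp θ hd1).sub ((hasDerivAt_id θ).const_mul (κ * |t - s| + ε))
      rw [mul_one] at this
      exact this
    have hloc : IsLocalMaxOn (fun θ' : ℝ => Z (θ', y)) (Icc 0 1) θ :=
      Filter.eventually_of_mem self_mem_nhdsWithin fun θ' h => hm θ' h y hy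
    have := hloc.hasFDerivWithinAt_nonpos hd2.hasFDerivAt.hasFDerivWithinAt
      (y := 0 - θ) (sub_mem_posTangentConeAt_of_segment_subset
        ((convex_Icc (0 : ℝ) 1).segment_subset hθ (by simp)))
    simp only [zero_sub, map_neg, ContinuousLinearMap.toSpanSingleton_apply, smul_eq_mul] at this
    have h3 : g' τ y * (t - s) ≤ κ * |t - s| := by
      refine (le_abs_self _).trans ?_
      rw [abs_mul]
      exact mul_le_mul_of_nonneg_right hb (abs_nonneg _)
    nlinarith

lemma abs_le_of_periodic_evolution (hl : 0 < l) {g g' : ℝ → E d → ℝ} {s t κ m : ℝ}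
    (hc : ContinuousOn (Function.uncurry g) (uIcc s t ×ˢ univ))
    (hper : ∀ τ ∈ uIcc s t, IsPeriodic l (g τ))
    (ht : ∀ τ ∈ uIcc s t, ∀ x, HasDerivAt (fun τ => g τ x) (g' τ x) τ)
    (hκ : ∀ τ ∈ uIcc s t, ∀ x, fderiv ℝ (g τ) x = 0 → |g' τ x| ≤ κ)
    (hs : ∀ x, |g s x| ≤ m) (x : E d) : |g t x| ≤ m + κ * |t - s| := by
  refine abs_le'.2 ⟨le_of_periodic_evolution hl hc hper ht hκ
    (fun y => (le_abs_self _).trans (hs y)) x, ?_⟩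
  refine le_of_periodic_evolution hl (g := fun τ y => -g τ y) (g' := fun τ y => -g' τ y) hc.neg
    (fun τ hτ => (hper τ hτ).comp _) (fun τ hτ y => (ht τ hτ y).neg) (fun τ hτ y h => ?_)
    (fun y => (neg_le_abs _).trans (hs y)) x
  rw [abs_neg]
  refine hκ τ hτ y ?_
  rwa [fderiv_fun_neg, neg_eq_zero] at h

end MaximumPrinciple

/-! ### Propagation of time-dependent bounds without a priori uniformity -/

section Propagation

variable {T C : ℝ} {Bd : ℝ → ℝ → Prop}

/-- `Bd t B` (read: the quantity at time `t` is bounded by `B`) grows at most affinely in time, with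
rate controlled by any uniform bound. -/
def GrowthStep (T C : ℝ) (Bd : ℝ → ℝ → Prop) : Prop :=
  ∀ s ∈ Icc (0 : ℝ) T, ∀ t ∈ Icc (0 : ℝ) T, ∀ B B₀ : ℝ, 0 ≤ B → 0 ≤ B₀ →
    (∀ τ ∈ uIcc s t, Bd τ B) → Bd s B₀ → Bd t (B₀ + C * (B + 1) * |t - s|)

lemma uIcc_subset_horizon {s t : ℝ} (hs : s ∈ Icc (0 : ℝ) T) (ht : t ∈ Icc (0 : ℝ) T) :
    uIcc s t ⊆ Icc 0 T := by
  have h := uIcc_of_le (hs.1.trans hs.2)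
  rw [← h] at hs ht ⊢
  exact uIcc_subset_uIcc hs ht

lemma GrowthStep.short (hmono : ∀ t B B', B ≤ B' → Bd t B → Bd t B') (hstep : GrowthStep T C Bd)
    {s t : ℝ} (hC : 0 ≤ C) (hs : s ∈ Icc (0 : ℝ) T) (ht : t ∈ Icc (0 : ℝ) T)
    (hst : C * |t - s| ≤ 1 / 2) {B : ℝ} (hB : 0 ≤ B) (hb : ∀ τ ∈ uIcc s t, Bd τ B)
    {B₀ : ℝ} (hB₀ : 0 ≤ B₀) (h0 : Bd s B₀) : Bd t (2 * B₀ + 2) := by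
  have key : ∀ n : ℕ, ∀ τ ∈ uIcc s t, Bd τ (2 * B₀ + 1 + B / 2 ^ n) := by
    intro n
    induction n with
    | zero => exact fun τ hτ => hmono _ _ _ (by simp; linarith) (hb τ hτ)
    | succ n ih =>
      intro τ hτ
      have hpos : 0 ≤ 2 * B₀ + 1 + B / 2 ^ n := by positivity
      refine hmono _ _ _ ?_ (hstep s hs τ (uIcc_subset_horizon hs ht hτ) _ B₀ hpos hB₀
        (fun σ hσ => ih σ (uIcc_subset_uIcc left_mem_uIcc hτ hσ)) h0)
      have h1 : C * |τ - s| ≤ 1 / 2 :=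
        (mul_le_mul_of_nonneg_left (abs_sub_left_of_mem_uIcc hτ) hC).trans hst
      have h2 : B / 2 ^ (n + 1) = B / 2 ^ n / 2 := by rw [pow_succ]; field_simp
      rw [h2]
      nlinarith
  obtain ⟨n, hn⟩ := pow_unbounded_of_one_lt B (one_lt_two : (1 : ℝ) < 2)
  refine hmono _ _ _ ?_ (key n t right_mem_uIcc)
  have : B / 2 ^ n ≤ 1 := by rw [div_le_one (by positivity)]; exact hn.le
  linarith

lemma GrowthStep.long (hmono : ∀ t B B', B ≤ B' → Bd t B → Bd t B') (hstep : GrowthStep T C Bd)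
    (hC : 0 ≤ C) (n : ℕ) {s t : ℝ} (hs : s ∈ Icc (0 : ℝ) T) (ht : t ∈ Icc (0 : ℝ) T)
    (hst : C * |t - s| ≤ n / 2) {B : ℝ} (hB : 0 ≤ B) (hb : ∀ τ ∈ uIcc s t, Bd τ B)
    {B₀ : ℝ} (hB₀ : 0 ≤ B₀) (h0 : Bd s B₀) : Bd t (2 ^ n * (B₀ + 2) - 2) := by
  induction n generalizing t with
  | zero =>
    refine hmono _ _ _ ?_ (hstep s hs t ht B B₀ hB hB₀ hb h0)
    have : C * |t - s| = 0 := le_antisymm (by simpa using hst) (by positivity)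
    simp only [pow_zero, one_mul]
    have : C * (B + 1) * |t - s| = 0 := by rw [mul_right_comm, this, zero_mul]
    linarith
  | succ n ih =>
    set m := s + (n / (n + 1) : ℝ) * (t - s) with hm
    have hn : (0 : ℝ) < n + 1 := by positivity
    have hmem : m ∈ uIcc s t := by
      rw [← segment_eq_uIcc, segment_eq_image']
      exact ⟨n / (n + 1), ⟨by positivity, by rw [div_le_one hn]; linarith⟩, by simp [hm]⟩
    have e1 : m - s = (n / (n + 1) : ℝ) * (t - s) := by rw [hm]; ring
    have e2 : t - m = (1 / (n + 1) : ℝ) * (t - s) := by rw [hm]; field_simp; ring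
    have hst' : C * |t - s| ≤ (n + 1) / 2 := by exact_mod_cast hst
    have h1 : C * |m - s| ≤ n / 2 := by
      rw [e1, abs_mul, abs_of_nonneg (by positivity)]
      calc C * (n / (n + 1) * |t - s|) = n / (n + 1) * (C * |t - s|) := by ring
        _ ≤ n / (n + 1) * ((n + 1) / 2) := by gcongr
        _ = n / 2 := by field_simp
    have h2 : C * |t - m| ≤ 1 / 2 := by
      rw [e2, abs_mul, abs_of_nonneg (by positivity)]
      calc C * (1 / (n + 1) * |t - s|) = 1 / (n + 1) * (C * |t - s|) := by ring
        _ ≤ 1 / (n + 1) * ((n + 1) / 2) := by gcongr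
        _ = 1 / 2 := by field_simp
    have hmT := uIcc_subset_horizon hs ht hmem
    have h3 := ih hmT h1 (fun τ hτ => hb τ (uIcc_subset_uIcc left_mem_uIcc hmem hτ))
    have hp : (1 : ℝ) ≤ 2 ^ n := one_le_pow₀ one_le_two
    refine hmono _ _ _ (le_of_eq ?_) (hstep.short hmono hC hmT ht h2 hB
      (fun τ hτ => hb τ (uIcc_subset_uIcc hmem right_mem_uIcc hτ)) (by nlinarith) h3)
    rw [pow_succ]; ring

lemma GrowthStep.exists_gronwall (T : ℝ) (hC : 0 ≤ C) :
    ∃ K : ℝ, 0 < K ∧ ∀ Bd : ℝ → ℝ → Prop, (∀ t B B', B ≤ B' → Bd t B → Bd t B') →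
      GrowthStep T C Bd → ∀ s ∈ Icc (0 : ℝ) T, ∀ t ∈ Icc (0 : ℝ) T,
        (∃ B, 0 ≤ B ∧ ∀ τ ∈ uIcc s t, Bd τ B) → ∀ B₀, 0 ≤ B₀ → Bd s B₀ → Bd t (K * (B₀ + 1)) := by
  set n := ⌈2 * C * T⌉₊
  refine ⟨2 ^ n * 2, by positivity, fun Bd hmono hstep s hs t ht ⟨B, hB, hb⟩ B₀ hB₀ h0 => ?_⟩
  refine hmono _ _ _ ?_ (hstep.long hmono hC n hs ht ?_ hB hb hB₀ h0)
  · have hp : (1 : ℝ) ≤ 2 ^ n := one_le_pow₀ one_le_two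
    nlinarith
  · have h1 : 2 * C * T ≤ n := Nat.le_ceil _
    have h2 : |t - s| ≤ T := abs_le.2 ⟨by linarith [ht.1, hs.2], by linarith [ht.2, hs.1]⟩
    nlinarith

lemma exists_uniform_of_locally (hmono : ∀ t B B', B ≤ B' → Bd t B → Bd t B') {S : Set ℝ}
    (hS : IsCompact S)
    (hloc : ∀ t ∈ S, ∃ r > 0, ∃ B, 0 ≤ B ∧ ∀ τ ∈ S, |τ - t| < r → Bd τ B) :
    ∃ B, 0 ≤ B ∧ ∀ τ ∈ S, Bd τ B := by
  refine hS.induction_on (p := fun U => ∃ B, 0 ≤ B ∧ ∀ τ ∈ U, Bd τ B) ⟨0, le_rfl, by simp⟩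
    (fun U U' hU ⟨B, hB, h⟩ => ⟨B, hB, fun τ hτ => h τ (hU hτ)⟩) ?_ ?_
  · rintro U U' ⟨B, hB, h⟩ ⟨B', hB', h'⟩
    refine ⟨max B B', le_max_of_le_left hB, fun τ hτ => hτ.elim (fun hτ => ?_) fun hτ => ?_⟩
    · exact hmono _ _ _ (le_max_left _ _) (h τ hτ)
    · exact hmono _ _ _ (le_max_right _ _) (h' τ hτ)
  · intro t ht
    obtain ⟨r, hr, B, hB, h⟩ := hloc t ht
    refine ⟨Metric.ball t r ∩ S, Filter.inter_mem (mem_nhdsWithin_of_mem_nhds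
      (Metric.ball_mem_nhds t hr)) self_mem_nhdsWithin, B, hB, fun τ hτ => h τ hτ.2 ?_⟩
    simpa [Real.dist_eq] using hτ.1

/-- By the Baire category theorem, pointwise bounds whose sublevel sets are closed in time are
automatically locally uniform near some bad time, and the growth step then spreads them. -/
lemma GrowthStep.exists_uniform (hmono : ∀ t B B', B ≤ B' → Bd t B → Bd t B') (hC : 0 ≤ C)
    (hstep : GrowthStep T C Bd) (hpt : ∀ t ∈ Icc (0 : ℝ) T, ∃ B, Bd t B)
    (hclosed : ∀ B, IsClosed {t | t ∈ Icc (0 : ℝ) T ∧ Bd t B}) :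
    ∃ B, 0 ≤ B ∧ ∀ t ∈ Icc (0 : ℝ) T, Bd t B := by
  obtain ⟨K, hK, gron⟩ := exists_gronwall (C := C) T hC
  replace gron := gron Bd hmono hstep
  refine exists_uniform_of_locally hmono isCompact_Icc ?_
  by_contra hne
  push Not at hne
  set Good : ℝ → Prop := fun t => ∃ r > 0, ∃ B, 0 ≤ B ∧ ∀ τ ∈ Icc (0 : ℝ) T, |τ - t| < r → Bd τ B
    with hGood
  set P : Set ℝ := {t | t ∈ Icc (0 : ℝ) T ∧ ¬ Good t} with hP
  have hPne : P.Nonempty := by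
    obtain ⟨t, ht, h⟩ := hne
    refine ⟨t, ht, fun ⟨r, hr, B, hB, h'⟩ => ?_⟩
    obtain ⟨τ, hτ, hτr, hb⟩ := h r hr B hB
    exact hb (h' τ hτ hτr)
  have hopen : IsOpen {t | Good t} := by
    refine Metric.isOpen_iff.2 fun t ⟨r, hr, B, hB, h⟩ => ⟨r / 2, by positivity, fun s hs => ?_⟩
    refine ⟨r / 2, by positivity, B, hB, fun τ hτ hτs => h τ hτ ?_⟩
    rw [Metric.mem_ball, Real.dist_eq] at hs
    calc |τ - t| ≤ |τ - s| + |s - t| := abs_sub_le _ _ _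
      _ < r := by linarith
  have hPc : IsClosed P := isClosed_Icc.inter hopen.isClosed_compl
  have hne' : Nonempty P := hPne.to_subtype
  have hcs : CompleteSpace P := hPc.completeSpace_coe
  obtain ⟨n, ⟨p, hpP⟩, hp⟩ := nonempty_interior_of_iUnion_of_closed
    (f := fun n : ℕ => {q : P | Bd q n})
    (fun n => by
      have : {q : P | Bd q n} = Subtype.val ⁻¹' {t | t ∈ Icc (0 : ℝ) T ∧ Bd t n} := by
        ext q
        exact ⟨fun h => ⟨q.2.1, h⟩, fun h => h.2⟩
      rw [this]
      exact (hclosed n).preimage continuous_subtype_val)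
    (by
      refine eq_univ_of_forall fun q => mem_iUnion.2 ?_
      obtain ⟨B, hB⟩ := hpt q q.2.1
      exact ⟨⌈B⌉₊, hmono _ _ _ (Nat.le_ceil B) hB⟩)
  obtain ⟨ε, hε, hball⟩ := Metric.isOpen_iff.1 isOpen_interior _ hp
  have hnear : ∀ q ∈ P, |q - p| < ε → Bd q n := fun q hq hqp =>
    interior_subset (s := {q : P | Bd q n})
      (hball (show (⟨q, hq⟩ : P) ∈ Metric.ball _ _ from hqp))
  refine hpP.2 ⟨ε, hε, max n (K * (n + 1)), le_max_of_le_left n.cast_nonneg, fun t ht htp => ?_⟩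
  by_cases htP : t ∈ P
  · exact hmono _ _ _ (le_max_left _ _) (hnear t htP htp)
  refine hmono _ _ _ (le_max_right _ _) ?_
  obtain ⟨a, ⟨haP, hapt⟩, hamin⟩ := (isCompact_uIcc.inter_left hPc).exists_isMinOn
    (⟨p, hpP, left_mem_uIcc⟩ : (P ∩ uIcc p t).Nonempty) (f := fun q => |t - q|) (by fun_prop)
  have hap : Bd a n := hnear a haP ((abs_sub_left_of_mem_uIcc hapt).trans_lt htp)
  refine gron a haP.1 t ht ?_ n n.cast_nonneg hap
  obtain ⟨Bt', hBt'⟩ := hpt t ht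
  obtain ⟨Bt, hBt0, hBt⟩ : ∃ B, 0 ≤ B ∧ Bd t B :=
    ⟨max 0 Bt', le_max_left _ _, hmono _ _ _ (le_max_right _ _) hBt'⟩
  refine ⟨max n (K * (Bt + 1)), le_max_of_le_left n.cast_nonneg, fun τ hτ => ?_⟩
  by_cases hτa : τ = a
  · exact hmono _ _ _ (le_max_left _ _) (hτa ▸ hap)
  refine hmono _ _ _ (le_max_right _ _)
    (gron t ht τ (uIcc_subset_horizon haP.1 ht hτ) ?_ Bt hBt0 hBt)
  have hlt : |t - τ| < |t - a| := by
    refine lt_of_le_of_ne (abs_sub_right_of_mem_uIcc hτ) fun h => hτa ?_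
    rcases mem_uIcc.1 hτ with h' | h'
    · rw [abs_of_nonneg (by linarith), abs_of_nonneg (by linarith)] at h
      linarith
    · rw [abs_of_nonpos (by linarith), abs_of_nonpos (by linarith)] at h
      linarith
  have hgood : ∀ σ ∈ uIcc t τ, Good σ := by
    intro σ hσ
    by_contra hbad
    have hσa : σ ∈ uIcc a t := uIcc_subset_uIcc right_mem_uIcc hτ hσ
    have hσp : σ ∈ uIcc p t := uIcc_subset_uIcc hapt right_mem_uIcc hσa
    have h1 : |t - a| ≤ |t - σ| :=
      hamin ⟨⟨uIcc_subset_horizon haP.1 ht hσa, hbad⟩, hσp⟩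
    rw [uIcc_comm] at hσ
    linarith [abs_sub_right_of_mem_uIcc hσ]
  refine exists_uniform_of_locally hmono isCompact_uIcc fun σ hσ => ?_
  obtain ⟨r, hr, B, hB, h⟩ := hgood σ hσ
  exact ⟨r, hr, B, hB, fun τ' hτ' => h τ'
    (uIcc_subset_horizon ht (uIcc_subset_horizon haP.1 ht hτ) hτ')⟩

lemma GrowthStep.exists_bound (T : ℝ) (hC : 0 ≤ C) :
    ∃ K : ℝ, 0 < K ∧ ∀ Bd : ℝ → ℝ → Prop, (∀ t B B', B ≤ B' → Bd t B → Bd t B') →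
      GrowthStep T C Bd → (∀ t ∈ Icc (0 : ℝ) T, ∃ B, Bd t B) →
      (∀ B, IsClosed {t | t ∈ Icc (0 : ℝ) T ∧ Bd t B}) →
      ∀ B₀, 0 ≤ B₀ → Bd 0 B₀ → ∀ t ∈ Icc (0 : ℝ) T, Bd t (K * (B₀ + 1)) := by
  obtain ⟨K, hK, gron⟩ := exists_gronwall (C := C) T hC
  refine ⟨K, hK, fun Bd hmono hstep hpt hclosed B₀ hB₀ h0 t ht => ?_⟩
  obtain ⟨B, hB, hb⟩ := hstep.exists_uniform hmono hC hpt hclosed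
  have h0T : (0 : ℝ) ∈ Icc 0 T := ⟨le_rfl, ht.1.trans ht.2⟩
  exact gron Bd hmono hstep 0 h0T t ht
    ⟨B, hB, fun τ hτ => hb τ (uIcc_subset_horizon h0T ht hτ)⟩ B₀ hB₀ h0

end Propagation

/-! ### Regularity propagation for transport equations -/

section Transport

variable {d : ℕ} {l : ℝ}

lemma DiffBound.of_le {F : Type*} [NormedAddCommGroup F] [NormedSpace ℝ F] {g : E d → F}
    (hl : 0 < l) (hg : IsPeriodic l g) (hc : Continuous g) {R B : ℝ} {k : ℕ} (hR1 : 1 ≤ R)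
    (hR : ∀ v ∈ box d l, ‖v‖ ≤ R) (hB : 0 ≤ B) (h : DiffBound k B g) {j : ℕ} (hj : 1 ≤ j)
    (hjk : j ≤ k) : DiffBound j (B * R ^ k) g := by
  induction k generalizing B with
  | zero => omega
  | succ k ih =>
    rcases hjk.eq_or_lt with rfl | hlt
    · exact h.mono (le_mul_of_one_le_right hB (one_le_pow₀ hR1))
    · obtain ⟨m, rfl⟩ : ∃ m, k = m + 1 := ⟨k - 1, by omega⟩
      have := ih (by positivity) (h.lower hl hg hc hR hB) (by omega)
      rwa [mul_assoc, ← pow_succ'] at this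

/-- The Riesz isomorphism from the dual, as a real-linear map. -/
def gradMap (d : ℕ) : (E d →L[ℝ] ℝ) →L[ℝ] E d :=
  LinearMap.mkContinuous
    { toFun := fun A => (InnerProductSpace.toDual ℝ (E d)).symm A
      map_add' := fun A A' => map_add _ A A'
      map_smul' := fun r A => by simp } 1 (fun A => by simp)

lemma gradMap_apply (A : E d →L[ℝ] ℝ) :
    gradMap d A = (InnerProductSpace.toDual ℝ (E d)).symm A := rfl

lemma gradient_eq_gradMap (g : E d → ℝ) : gradient g = fun x => gradMap d (fderiv ℝ g x) := rfl

lemma gradient_apply (g : E d → ℝ) (x : E d) : gradient g x = gradMap d (fderiv ℝ g x) := rfl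

lemma inner_gradMap (v : E d) (A : E d →L[ℝ] ℝ) : inner ℝ v (gradMap d A) = A v := by
  rw [real_inner_comm, gradMap_apply, InnerProductSpace.toDual_symm_apply]

lemma norm_gradMap_le : ‖gradMap d‖ ≤ 1 := LinearMap.mkContinuous_norm_le _ zero_le_one _

lemma norm_gradMap (A : E d →L[ℝ] ℝ) : ‖gradMap d A‖ = ‖A‖ := by simp [gradMap_apply]

lemma DiffBound.gradient {k : ℕ} {B : ℝ} {g : E d → ℝ} (hg : DiffBound (k + 1) B g) (hB : 0 ≤ B)
    (hd : Differentiable ℝ g) : DiffBound k B (gradient g) :=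
  ((hg.fderiv hB hd).clm (gradMap d)).mono (mul_le_of_le_one_left hB norm_gradMap_le)

lemma IsPeriodic.gradient {g : E d → ℝ} (hg : IsPeriodic l g) : IsPeriodic l (gradient g) :=
  hg.fderiv.comp (gradMap d)

lemma _root_.ContDiff.gradient {g : E d → ℝ} (hg : ContDiff ℝ (⊤ : ℕ∞) g) :
    ContDiff ℝ (⊤ : ℕ∞) (gradient g) :=
  (gradMap d).contDiff.comp (hg.fderiv_right (by simp))

lemma hasDerivAt_iterDiff {u : ℝ → E d → ℝ} {u' : E d → ℝ} {t : ℝ}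
    (h : ∀ x, HasDerivAt (fun τ => u τ x) (u' x) t) (L : List (E d)) (x : E d) :
    HasDerivAt (fun τ => iterDiff L (u τ) x) (iterDiff L u' x) t := by
  induction L generalizing u u' with
  | nil => exact h x
  | cons v L ih => exact ih fun y => (h (y + v)).sub (h y)

lemma continuousOn_iterDiff {u : ℝ → E d → ℝ} {S : Set ℝ}
    (h : ContinuousOn (Function.uncurry u) (S ×ˢ univ)) (L : List (E d)) :
    ContinuousOn (Function.uncurry fun τ => iterDiff L (u τ)) (S ×ˢ univ) := by
  induction L generalizing u with
  | nil => exact h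
  | cons v L ih =>
    refine ih (u := fun τ => fwdDiff v (u τ)) (ContinuousOn.sub ?_ h)
    exact h.comp (f := fun q : ℝ × E d => (q.1, q.2 + v)) (by fun_prop)
      fun q hq => ⟨hq.1, mem_univ _⟩

/-- `u` is a spatially smooth periodic solution of `∂ₜu + b·∇u + c = 0`. -/
structure SolvesTransport (l : ℝ) (b : ℝ → E d → E d) (c u : ℝ → E d → ℝ) : Prop where
  smooth : ∀ t, ContDiff ℝ (⊤ : ℕ∞) (u t)
  periodic : ∀ t, IsPeriodic l (u t)
  hasDerivAt : ∀ t x, HasDerivAt (fun τ => u τ x)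
    (-(inner ℝ (b t x) (gradient (u t) x) + c t x)) t

lemma SolvesTransport.differentiable {b : ℝ → E d → E d} {c u : ℝ → E d → ℝ}
    (h : SolvesTransport l b c u) (t : ℝ) : Differentiable ℝ (u t) :=
  (h.smooth t).differentiable (by simp)

lemma SolvesTransport.continuousOn_of_lipschitz {b : ℝ → E d → E d} {c u : ℝ → E d → ℝ}
    (h : SolvesTransport l b c u) {S : Set ℝ} {B : ℝ} (hB : ∀ τ ∈ S, DiffBound 1 B (u τ)) :
    ContinuousOn (Function.uncurry u) (S ×ˢ univ) := by
  refine continuousOn_prod_of_continuousOn_lipschitzOnWith' _ B.toNNReal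
    (fun τ hτ => ?_) (fun x _ τ _ =>
    (h.hasDerivAt τ x).continuousAt.continuousWithinAt)
  refine LipschitzOnWith.of_dist_le_mul fun x _ y _ => ?_
  simp only [dist_eq_norm]
  exact ((hB τ hτ).lipschitz x y).trans
    (mul_le_mul_of_nonneg_right (Real.le_coe_toNNReal B) (norm_nonneg _))

lemma isClosed_diffBound {T B : ℝ} {k : ℕ} {b : ℝ → E d → E d} {c u : ℝ → E d → ℝ}
    (h : SolvesTransport l b c u) : IsClosed {t | t ∈ Icc (0 : ℝ) T ∧ DiffBound k B (u t)} := by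
  refine isClosed_Icc.inter ?_
  change IsClosed {t | DiffBound k B (u t)}
  simp only [DiffBound, ofPred_forall]
  refine isClosed_iInter fun L => isClosed_iInter fun _ => isClosed_iInter fun x => ?_
  exact isClosed_le (continuous_iff_continuousAt.2 fun t =>
    (hasDerivAt_iterDiff (h.hasDerivAt t) L x).continuousAt).norm continuous_const

lemma SolvesTransport.growthStep (hl : 0 < l) {R β γ T : ℝ} {k : ℕ} (hk : 1 ≤ k) (hR1 : 1 ≤ R)
    (hR : ∀ v ∈ box d l, ‖v‖ ≤ R) (hβ : 0 ≤ β) (hγ : 0 ≤ γ) {b : ℝ → E d → E d}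
    {c u : ℝ → E d → ℝ} (h : SolvesTransport l b c u)
    (hb : ∀ t ∈ Icc (0 : ℝ) T, ∀ j, 1 ≤ j → j ≤ k → DiffBound j β (b t))
    (hc : ∀ t ∈ Icc (0 : ℝ) T, DiffBound k γ (c t)) :
    GrowthStep T (2 ^ k * β * R ^ k + γ) (fun t B => DiffBound k B (u t)) := by
  intro s hs t ht B B₀ hB hB₀ hbd h0 L hL x
  have hlow : ∀ τ ∈ uIcc s t, ∀ j, 1 ≤ j → j ≤ k → DiffBound j (B * R ^ k) (u τ) :=
    fun τ hτ j hj hjk => (hbd τ hτ).of_le hl (h.periodic τ) (h.differentiable τ).continuous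
      hR1 hR hB hj hjk
  have hBR : 0 ≤ B * R ^ k := by positivity
  have hprod := prod_map_norm_nonneg L
  have key := abs_le_of_periodic_evolution hl (g := fun τ => iterDiff L (u τ))
    (κ := (2 ^ k * β * R ^ k + γ) * (B + 1) * (L.map norm).prod)
    (m := B₀ * (L.map norm).prod)
    (continuousOn_iterDiff (h.continuousOn_of_lipschitz fun τ hτ => hlow τ hτ 1 le_rfl hk) L)
    (fun τ _ => (h.periodic τ).iterDiff L)
    (fun τ _ y => hasDerivAt_iterDiff (h.hasDerivAt τ) L y)
    (fun τ hτ y hy => ?_) (h0 L hL) x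
  · refine key.trans (le_of_eq ?_)
    ring
  · have hτT := uIcc_subset_horizon hs ht hτ
    rw [iterDiff_neg, abs_neg, iterDiff_add]
    have hz : iterDiff L (gradient (u τ)) y = 0 := by
      rw [gradient_eq_gradMap, iterDiff_clm, ← fderiv_iterDiff L (h.differentiable τ)]
      simp only [hy, map_zero]
    have h1 := norm_iterDiff_inner_sub_le (L := L) hβ hBR
      (fun j hj hjk => hb τ hτT j hj (hL ▸ hjk))
      (fun j hj => (hlow τ hτ (j + 1) (by omega) (by omega)).gradient hBR (h.differentiable τ)) y
    rw [hz, inner_zero_right, sub_zero, hL] at h1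
    have h2 := hc τ hτT L hL y
    refine (norm_add_le_of_le h1 h2).trans ?_
    rw [← add_mul]
    refine mul_le_mul_of_nonneg_right ?_ hprod
    have : 0 ≤ 2 ^ k * β * R ^ k := by positivity
    nlinarith

/-- Smoothness bounds of order `k ≥ 1` are propagated by a transport equation whose coefficients
have bounded differences. -/
lemma SolvesTransport.exists_diffBound (d : ℕ) (hl : 0 < l) (T : ℝ) {β γ : ℝ} {k : ℕ} (hk : 1 ≤ k)
    (hβ : 0 ≤ β) (hγ : 0 ≤ γ) : ∃ K : ℝ, 0 < K ∧
      ∀ (b : ℝ → E d → E d) (c u : ℝ → E d → ℝ), SolvesTransport l b c u →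
        (∀ t ∈ Icc (0 : ℝ) T, ∀ j, 1 ≤ j → j ≤ k → DiffBound j β (b t)) →
        (∀ t ∈ Icc (0 : ℝ) T, DiffBound k γ (c t)) →
        ∀ B₀, 0 ≤ B₀ → DiffBound k B₀ (u 0) →
          ∀ t ∈ Icc (0 : ℝ) T, DiffBound k (K * (B₀ + 1)) (u t) := by
  obtain ⟨R, hR1, hR⟩ := exists_box_radius d l
  obtain ⟨K, hK, H⟩ := GrowthStep.exists_bound (C := 2 ^ k * β * R ^ k + γ) T (by positivity)
  refine ⟨K, hK, fun b c u h hb hc => H _ (fun t B B' hBB' hbd => hbd.mono hBB')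
    (h.growthStep hl hk hR1 hR hβ hγ hb hc) (fun t _ => ?_) (fun B => isClosed_diffBound h)⟩
  obtain ⟨B, -, hB⟩ := (h.periodic t).exists_diffBound hl (k := k)
    ((h.smooth t).of_le (by exact_mod_cast le_top))
  exact ⟨B, hB⟩

lemma SolvesTransport.abs_sub_le (hl : 0 < l) {T γ B : ℝ} {b : ℝ → E d → E d}
    {c u : ℝ → E d → ℝ} (h : SolvesTransport l b c u)
    (hB : ∀ τ ∈ Icc (0 : ℝ) T, DiffBound 1 B (u τ))
    (hc : ∀ t ∈ Icc (0 : ℝ) T, ∀ x, |c t x| ≤ γ) {a m : ℝ} (h0 : ∀ x, |u 0 x - a| ≤ m)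
    (hγ : 0 ≤ γ) : ∀ t ∈ Icc (0 : ℝ) T, ∀ x, |u t x - a| ≤ m + γ * T := by
  intro t ht x
  have hsub := uIcc_subset_horizon (T := T) ⟨le_rfl, ht.1.trans ht.2⟩ ht
  have hcont := h.continuousOn_of_lipschitz hB
  have key := abs_le_of_periodic_evolution hl (g := fun τ y => u τ y - a) (s := 0) (t := t)
    (κ := γ) (m := m) ((hcont.mono (prod_mono hsub subset_rfl)).sub continuousOn_const)
    (fun τ _ => (h.periodic τ).comp (· - a)) (fun τ _ y => (h.hasDerivAt τ y).sub_const a)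
    (fun τ hτ y hy => ?_) h0 x
  · refine key.trans ?_
    rw [sub_zero, abs_of_nonneg ht.1]
    have := ht.2
    nlinarith
  · rw [fderiv_sub_const] at hy
    rw [gradient_apply, hy, map_zero, inner_zero_right, zero_add, abs_neg]
    exact hc τ (hsub hτ) y

end Transport

/-! ### The log-densities solve transport equations -/

section LogDensity

variable {d : ℕ} {l : ℝ}

/-- The trace of an endomorphism of `ℝ^d`, as a continuous linear map. -/
def traceMap (d : ℕ) : (E d →L[ℝ] E d) →L[ℝ] ℝ :=
  ∑ i, (EuclideanSpace.proj i).comp (ContinuousLinearMap.apply ℝ (E d) (uvec d i))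

lemma diverg_eq_traceMap (F : E d → E d) (x : E d) : diverg F x = traceMap d (fderiv ℝ F x) := by
  simp [diverg, traceMap]

lemma diverg_eq (F : E d → E d) : diverg F = fun x => traceMap d (fderiv ℝ F x) :=
  funext (diverg_eq_traceMap F)

lemma sum_smul_uvec (v : E d) : ∑ i, v i • uvec d i = v := by
  ext j
  simp [uvec, Finset.sum_apply, Pi.single_apply]

lemma traceMap_smulRight (A : E d →L[ℝ] ℝ) (v : E d) : traceMap d (A.smulRight v) = A v := by
  conv_rhs => rw [← sum_smul_uvec v, map_sum]
  simp only [traceMap, sum_apply, ContinuousLinearMap.comp_apply,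
    ContinuousLinearMap.apply_apply, ContinuousLinearMap.smulRight_apply, map_smul, smul_eq_mul]
  exact Finset.sum_congr rfl fun i _ => by simp [mul_comm]

lemma diverg_smul {g : E d → ℝ} {F : E d → E d} {x : E d} (hg : DifferentiableAt ℝ g x)
    (hF : DifferentiableAt ℝ F x) :
    diverg (fun y => g y • F y) x = g x * diverg F x + inner ℝ (F x) (gradient g x) := by
  rw [diverg_eq_traceMap, fderiv_fun_smul hg hF, map_add, map_smul, traceMap_smulRight,
    gradient_apply, inner_gradMap, smul_eq_mul, diverg_eq_traceMap]

lemma _root_.ContDiff.diverg {F : E d → E d} (hF : ContDiff ℝ (⊤ : ℕ∞) F) :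
    ContDiff ℝ (⊤ : ℕ∞) (diverg F) := by
  rw [diverg_eq]
  exact (traceMap d).contDiff.comp (hF.fderiv_right (by simp))

lemma IsPeriodic.diverg {F : E d → E d} (hF : IsPeriodic l F) : IsPeriodic l (diverg F) := by
  rw [diverg_eq]
  exact hF.fderiv.comp _

lemma DiffBound.diverg {k : ℕ} {B : ℝ} {F : E d → E d} (hF : DiffBound (k + 1) B F) (hB : 0 ≤ B)
    (hd : Differentiable ℝ F) : DiffBound k (‖traceMap d‖ * B) (diverg F) := by
  rw [diverg_eq]
  exact (hF.fderiv hB hd).clm _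

lemma gradient_log {g : E d → ℝ} {x : E d} (hg : DifferentiableAt ℝ g x) (h0 : g x ≠ 0) :
    gradient (fun y => Real.log (g y)) x = (g x)⁻¹ • gradient g x := by
  rw [gradient_apply, fderiv.log hg h0, map_smul, gradient_apply]

lemma TransportedBy.solvesTransport {v : ℝ → E d → E d} {α₀ : E d → ℝ} {ρ : ℝ → E d → ℝ}
    (h : TransportedBy d l v α₀ ρ) (hv : ∀ t, Differentiable ℝ (v t)) :
    SolvesTransport l v (fun t => diverg (v t)) (fun t x => Real.log (ρ t x)) := by
  obtain ⟨hs, hpos, hper, -, hder⟩ := h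
  refine ⟨fun t => (hs t).log fun x => (hpos t x).ne', fun t => (hper t).comp Real.log,
    fun t x => ?_⟩
  have hd : Differentiable ℝ (ρ t) := (hs t).differentiable (by simp)
  have h0 := (hpos t x).ne'
  have := (hder t x).log h0
  rw [diverg_smul (hd x) (hv t x)] at this
  convert this using 1
  rw [gradient_log (hd x) h0, real_inner_smul_right]
  field_simp
  ring

/-- The potential `V + log ρ` whose negative gradient is the velocity `A`. -/
def potential (V ρ : ℝ → E d → ℝ) (t : ℝ) (x : E d) : ℝ := V t x + Real.log (ρ t x)

lemma Avf_eq {V ρ : ℝ → E d → ℝ} {t : ℝ} (hV : Differentiable ℝ (V t))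
    (hρ : Differentiable ℝ fun x => Real.log (ρ t x)) :
    Avf V ρ t = fun x => -gradient (potential V ρ t) x := by
  funext x
  have : fderiv ℝ (potential V ρ t) x =
      fderiv ℝ (V t) x + fderiv ℝ (fun x => Real.log (ρ t x)) x := fderiv_fun_add (hV x) (hρ x)
  rw [Avf, gradient_apply, gradient_apply, this, map_add, score, gradient_apply]
  abel

end LogDensity

/-! ### A priori bounds -/

section APriori

variable {d : ℕ} {l : ℝ}

/-- The uniform regularity of the velocity field, the potential and the two log-densities on which
the energy estimate relies. -/
structure UniformBounds (d : ℕ) (T S : ℝ) (f : ℝ → E d → E d) (V ρ1 ρ2 : ℝ → E d → ℝ) : Prop where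
  velocity : ∀ t ∈ Icc (0 : ℝ) T, ∀ j, 1 ≤ j → j ≤ 3 → DiffBound j S (f t)
  potential : ∀ t ∈ Icc (0 : ℝ) T, ∀ j, 1 ≤ j → j ≤ 3 → DiffBound j S (potential V ρ1 t)
  log_fst : ∀ t ∈ Icc (0 : ℝ) T, ∀ j, 1 ≤ j → j ≤ 3 → DiffBound j S fun x => Real.log (ρ1 t x)
  log_snd : ∀ t ∈ Icc (0 : ℝ) T, DiffBound 1 S fun x => Real.log (ρ2 t x)
  osc_fst : ∃ a, ∀ t ∈ Icc (0 : ℝ) T, ∀ x, |Real.log (ρ1 t x) - a| ≤ S ∧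
    |Real.log (ρ2 t x) - a| ≤ S

lemma exists_uniformBounds (d : ℕ) (l T L₀ Lf Lv : ℝ) (hl : 0 < l) (hT : 0 < T) :
    ∃ S : ℝ, 0 ≤ S ∧ ∀ (f : ℝ → E d → E d) (V : ℝ → E d → ℝ) (α₀ : E d → ℝ) (ρ1 ρ2 : ℝ → E d → ℝ),
        (∀ t, ContDiff ℝ (⊤ : ℕ∞) (f t)) → (∀ t, ContDiff ℝ (⊤ : ℕ∞) (V t)) →
        InitDensity d l α₀ → RegInit d l L₀ α₀ → RegVel d l T Lf f → RegPot d l T Lv V →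
        TransportedBy d l f α₀ ρ1 → TransportedBy d l (Avf V ρ1) α₀ ρ2 →
        UniformBounds d T S f V ρ1 ρ2 := by
  obtain ⟨R, hR1, hR⟩ := exists_box_radius d l
  obtain ⟨K₁, hK₁, H₁⟩ := SolvesTransport.exists_diffBound (l := l) d hl T (β := |Lf|) (γ := |Lf|)
    (k := 3) (by norm_num) (abs_nonneg _) (abs_nonneg _)
  set U := K₁ * (|L₀| + 1) * R ^ 3 with hU
  set Φ := |Lv| * R ^ 3 + U with hΦ
  have hR0 : 0 ≤ R := zero_le_one.trans hR1
  have hU0 : 0 ≤ U := by positivity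
  have hΦ0 : 0 ≤ Φ := by positivity
  set τr := ‖traceMap d‖ with hτr
  obtain ⟨K₂, hK₂, H₂⟩ := SolvesTransport.exists_diffBound (l := l) d hl T (β := Φ) (γ := τr * Φ)
    (k := 1) le_rfl hΦ0 (by positivity)
  set W := K₂ * (|L₀| + 1) with hW
  set N₁ := |L₀| * R + τr * |Lf| * T with hN₁
  set N₂ := |L₀| * R + τr * Φ * T with hN₂
  have hW0 : 0 ≤ W := by positivity
  have hN₁0 : 0 ≤ N₁ := by positivity
  have hN₂0 : 0 ≤ N₂ := by positivity
  refine ⟨|Lf| + Φ + W + N₁ + N₂, by positivity, ?_⟩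
  intro f V α₀ ρ1 ρ2 hf hV hα hα' hfr hVr h1 h2
  have hUΦ : U ≤ Φ := by
    have : 0 ≤ |Lv| * R ^ 3 := by positivity
    linarith
  have hfd : ∀ t, Differentiable ℝ (f t) := fun t => (hf t).differentiable (by simp)
  have hVd : ∀ t, Differentiable ℝ (V t) := fun t => (hV t).differentiable (by simp)
  have T1 := h1.solvesTransport hfd
  have hAeq : ∀ t, Avf V ρ1 t = fun x => -gradient (potential V ρ1 t) x := fun t =>
    Avf_eq (hVd t) (T1.differentiable t)
  have hφs : ∀ t, ContDiff ℝ (⊤ : ℕ∞) (potential V ρ1 t) := fun t => (hV t).add (T1.smooth t)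
  have hφd : ∀ t, Differentiable ℝ (potential V ρ1 t) := fun t =>
    (hφs t).differentiable (by simp)
  have hAs : ∀ t, ContDiff ℝ (⊤ : ℕ∞) (Avf V ρ1 t) := fun t => by
    rw [hAeq]; exact (hφs t).gradient.neg
  have hAd : ∀ t, Differentiable ℝ (Avf V ρ1 t) := fun t => (hAs t).differentiable (by simp)
  have T2 := h2.solvesTransport hAd
  have hfb : ∀ t ∈ Icc (0 : ℝ) T, ∀ j, 1 ≤ j → j ≤ 3 → DiffBound j |Lf| (f t) :=
    fun t ht j hj hj3 => ((hfr t ht).1.diffBound_of_box hl (contDiff_infty.1 (hf t) _)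
      fun x hx => ((hfr t ht).2 x hx j (by simp; omega)).1).mono (le_abs_self _)
  have hcb : ∀ t ∈ Icc (0 : ℝ) T, DiffBound 3 |Lf| (diverg (f t)) :=
    fun t ht => ((hfr t ht).1.diverg.diffBound_of_box hl
      (contDiff_infty.1 (hf t).diverg _)
      fun x hx => ((hfr t ht).2 x hx 3 (by simp)).2).mono (le_abs_self _)
  have hαs : ContDiff ℝ (⊤ : ℕ∞) fun x => Real.log (α₀ x) := hα.1.log fun x => (hα.2.1 x).ne'
  have hαp : IsPeriodic l fun x => Real.log (α₀ x) := hα.2.2.1.comp Real.log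
  have hαb : ∀ j, 1 ≤ j → j ≤ 3 → DiffBound j |L₀| fun x => Real.log (α₀ x) :=
    fun j hj hj3 => (hαp.diffBound_of_box hl (contDiff_infty.1 hαs _)
      fun x hx => (hα' x hx).1 j (by simp; omega)).mono (le_abs_self _)
  have hρ1 : ρ1 0 = α₀ := h1.2.2.2.1
  have hρ2 : ρ2 0 = α₀ := h2.2.2.2.1
  have hu1 : ∀ t ∈ Icc (0 : ℝ) T, ∀ j, 1 ≤ j → j ≤ 3 →
      DiffBound j U fun x => Real.log (ρ1 t x) := by
    intro t ht j hj hj3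
    exact (H₁ _ _ _ T1 hfb hcb |L₀| (abs_nonneg _) (by simpa [hρ1] using hαb 3 (by simp) le_rfl)
      t ht).of_le hl (T1.periodic t) (T1.smooth t).continuous hR1 hR (by positivity) hj hj3
  have hVb : ∀ t ∈ Icc (0 : ℝ) T, ∀ j, 1 ≤ j → j ≤ 3 → DiffBound j (|Lv| * R ^ 3) (V t) := by
    intro t ht j hj hj3
    refine DiffBound.of_le hl (hVr t ht).1 (hV t).continuous hR1 hR (abs_nonneg _) ?_ hj hj3
    exact ((hVr t ht).1.diffBound_of_box hl (contDiff_infty.1 (hV t) _)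
      fun x hx => ((hVr t ht).2 x hx).2.1).mono (le_abs_self _)
  have hφb : ∀ t ∈ Icc (0 : ℝ) T, ∀ j, 1 ≤ j → j ≤ 3 → DiffBound j Φ (potential V ρ1 t) :=
    fun t ht j hj hj3 => (hVb t ht j hj hj3).add (hu1 t ht j hj hj3)
  have hAb : ∀ t ∈ Icc (0 : ℝ) T, ∀ j, 1 ≤ j → j ≤ 2 → DiffBound j Φ (Avf V ρ1 t) := by
    intro t ht j hj hj2
    rw [hAeq]
    exact ((hφb t ht (j + 1) (by omega) (by omega)).gradient hΦ0 (hφd t)).neg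
  have hdA : ∀ t ∈ Icc (0 : ℝ) T, ∀ j ≤ 1, DiffBound j (τr * Φ) (diverg (Avf V ρ1 t)) :=
    fun t ht j hj => (hAb t ht (j + 1) (by omega) (by omega)).diverg hΦ0 (hAd t)
  have hu2 : ∀ t ∈ Icc (0 : ℝ) T, DiffBound 1 W fun x => Real.log (ρ2 t x) :=
    H₂ _ _ _ T2 (fun t ht j hj hj1 => hAb t ht j hj (by omega)) (fun t ht => hdA t ht 1 le_rfl) |L₀|
      (abs_nonneg _) (by simpa [hρ2] using hαb 1 le_rfl (by simp))
  have hosc : ∀ x, |Real.log (α₀ x) - Real.log (α₀ 0)| ≤ |L₀| * R := fun x =>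
    (hαb 1 le_rfl (by simp)).osc_le hl hαp hR (abs_nonneg _) x 0
  refine ⟨fun t ht j hj hj3 => (hfb t ht j hj hj3).mono (by linarith),
    fun t ht j hj hj3 => (hφb t ht j hj hj3).mono (by linarith [abs_nonneg Lf]),
    fun t ht j hj hj3 => (hu1 t ht j hj hj3).mono (by linarith [abs_nonneg Lf]),
    fun t ht => (hu2 t ht).mono (by linarith [abs_nonneg Lf]),
    Real.log (α₀ 0), fun t ht x => ⟨?_, ?_⟩⟩
  · refine (T1.abs_sub_le hl (fun τ hτ => hu1 τ hτ 1 le_rfl (by simp))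
      (γ := τr * |Lf|) (fun τ hτ y => ?_) (by simpa [hρ1] using hosc) (by positivity)
      t ht x).trans (by linarith [abs_nonneg Lf])
    exact diffBound_zero.1 ((hfb τ hτ 1 le_rfl (by simp)).diverg (abs_nonneg _) (hfd τ)) y
  · refine (T2.abs_sub_le hl hu2 (γ := τr * Φ) (fun τ hτ y => ?_) (by simpa [hρ2] using hosc)
      (by positivity) t ht x).trans (by linarith [abs_nonneg Lf])
    exact diffBound_zero.1 (hdA τ hτ 0 (by simp)) y

end APriori

/-! ### The divergence theorem for periodic fields -/

section Divergence

variable {d : ℕ} {l : ℝ}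

lemma Continuous.integrableOn_box {F : Type*} [NormedAddCommGroup F] {g : E d → F}
    (hg : Continuous g) : IntegrableOn g (box d l) :=
  hg.continuousOn.integrableOn_compact isCompact_box

lemma setIntegral_box_eq (g : E d → ℝ) :
    ∫ x in box d l, g x = ∫ y in Icc (fun _ : Fin d => -(l / 2)) (fun _ => l / 2),
      g (WithLp.toLp 2 y) := by
  have h := (PiLp.volume_preserving_toLp (Fin d)).setIntegral_preimage_emb
    (MeasurableEquiv.toLp 2 (Fin d → ℝ)).measurableEmbedding g (box d l)
  rw [← h]
  congr 2
  ext y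
  simp [box, Pi.le_def, forall_and]

lemma setIntegral_box_diverg (hl : 0 < l) {F : E d → E d} (hF : ContDiff ℝ 1 F)
    (hper : IsPeriodic l F) : ∫ x in box d l, diverg F x = 0 := by
  match d with
  | 0 => simp [diverg]
  | n + 1 =>
    rw [setIntegral_box_eq]
    set J : (Fin (n + 1) → ℝ) →L[ℝ] E (n + 1) :=
      ((EuclideanSpace.equiv (Fin (n + 1)) ℝ).symm : (Fin (n + 1) → ℝ) →L[ℝ] E (n + 1)) with hJ
    have hJa : ∀ y, J y = WithLp.toLp 2 y := fun y => rfl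
    have hJs : ∀ i, J (Pi.single i 1) = uvec (n + 1) i := fun i => rfl
    have hd : Differentiable ℝ F := hF.differentiable one_ne_zero
    have hder : ∀ (i : Fin (n + 1)) y, HasFDerivAt (fun y => F (J y) i)
        (((EuclideanSpace.proj i : E (n + 1) →L[ℝ] ℝ).comp (fderiv ℝ F (J y))).comp J) y :=
      fun i y => ((EuclideanSpace.proj i : E (n + 1) →L[ℝ] ℝ).hasFDerivAt.comp _
        (hd (J y)).hasFDerivAt).comp y J.hasFDerivAt
    have hc : Continuous (fderiv ℝ F) := hF.continuous_fderiv one_ne_zero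
    have key := integral_divergence_of_hasFDerivAt_off_countable'
      (fun _ : Fin (n + 1) => -(l / 2)) (fun _ => l / 2) (fun _ => by simp; linarith)
      (fun i y => F (J y) i) _ ∅ countable_empty
      (fun i => (continuous_iff_continuousAt.2 fun y => (hder i y).continuousAt).continuousOn)
      (fun y _ i => hder i y)
      (by
        refine Continuous.integrableOn_Icc ?_
        simp only [ContinuousLinearMap.comp_apply]
        fun_prop)
    have hlhs : ∀ y, ∑ i, (((EuclideanSpace.proj i : E (n + 1) →L[ℝ] ℝ).comp
        (fderiv ℝ F (J y))).comp J) (Pi.single i 1) = diverg F (WithLp.toLp 2 y) := by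
      intro y
      simp only [ContinuousLinearMap.comp_apply, hJs]
      rfl
    simp only [hlhs] at key
    rw [key]
    refine Finset.sum_eq_zero fun i _ => sub_eq_zero.2 ?_
    refine integral_congr_ae (Filter.Eventually.of_forall fun y => ?_)
    have : J (i.insertNth (l / 2) y) = J (i.insertNth (-(l / 2)) y) + l • uvec (n + 1) i := by
      rw [← hJs, ← map_smul, ← map_add]
      congr 1
      funext j
      refine i.succAboveCases ?_ (fun k => ?_) j
      · simp only [Fin.insertNth_apply_same, Pi.add_apply, Pi.smul_apply, Pi.single_eq_same,
          smul_eq_mul, mul_one]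
        ring
      · simp [Fin.succAbove_ne]
    simp only [this, hper _ i]

lemma setIntegral_box_inner_gradient (hl : 0 < l) {F : E d → E d} {g : E d → ℝ}
    (hF : ContDiff ℝ 1 F) (hg : ContDiff ℝ 1 g) (hFp : IsPeriodic l F) (hgp : IsPeriodic l g) :
    ∫ x in box d l, inner ℝ (F x) (gradient g x) = -∫ x in box d l, g x * diverg F x := by
  have h : ∫ x in box d l, diverg (fun y => g y • F y) x = 0 :=
    setIntegral_box_diverg hl (hg.smul hF) (hgp.map₂ hFp (· • ·))
  have hFd : Differentiable ℝ F := hF.differentiable one_ne_zero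
  have hgd : Differentiable ℝ g := hg.differentiable one_ne_zero
  have hc1 : Continuous fun x => inner ℝ (F x) (gradient g x) := by
    refine hF.continuous.inner ?_
    exact (gradMap d).continuous.comp (hg.continuous_fderiv one_ne_zero)
  have hc2 : Continuous fun x => g x * diverg F x := by
    rw [diverg_eq]
    exact hg.continuous.mul ((traceMap d).continuous.comp (hF.continuous_fderiv one_ne_zero))
  simp only [fun x => diverg_smul (hgd x) (hFd x)] at h
  rw [integral_add hc2.integrableOn_box hc1.integrableOn_box] at h
  linarith

end Divergence

/-! ### Evolution of integrals over the box -/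

section Energy

variable {d : ℕ} {l T : ℝ}

lemma integral_box_evolution {q q' : ℝ → E d → ℝ} {B : ℝ}
    (hq : ∀ t, Continuous (q t)) (hqq : ∀ t x, HasDerivAt (fun τ => q τ x) (q' t x) t)
    (hc : ∀ t ∈ Icc (0 : ℝ) T, Continuous (q' t))
    (hB : ∀ t ∈ Icc (0 : ℝ) T, ∀ x, |q' t x| ≤ B) {t : ℝ} (ht : t ∈ Icc (0 : ℝ) T) :
    IntervalIntegrable (fun s => ∫ x in box d l, q' s x) volume 0 t ∧
      ∫ x in box d l, q t x =
        (∫ x in box d l, q 0 x) + ∫ s in (0 : ℝ)..t, ∫ x in box d l, q' s x := by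
  have : IsFiniteMeasure (volume.restrict (box d l)) :=
    ⟨by rw [Measure.restrict_apply_univ]; exact isCompact_box.measure_lt_top⟩
  have hsub : Icc 0 t ⊆ Icc 0 T := Icc_subset_Icc_right ht.2
  have hder : ∀ s ∈ Ioo 0 t, HasDerivAt (fun r => ∫ x in box d l, q r x)
      (∫ x in box d l, q' s x) s := fun s hs =>
    (hasDerivAt_integral_of_dominated_loc_of_deriv_le (bound := fun _ => B) (Icc_mem_nhds hs.1 hs.2)
      (Filter.Eventually.of_forall fun r => (hq r).aestronglyMeasurable) (hq s).integrableOn_box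
      (hc s (hsub ⟨hs.1.le, hs.2.le⟩)).aestronglyMeasurable
      (Filter.Eventually.of_forall fun x r hr => hB r (hsub hr) x) (integrable_const _)
      (Filter.Eventually.of_forall fun x r _ => hqq r x)).2
  have hlip : ∀ s ∈ Icc 0 t, ∀ r ∈ Icc 0 t, ∀ x, |q r x - q s x| ≤ B * |r - s| :=
    fun s hs r hr x => (convex_Icc (0 : ℝ) t).norm_image_sub_le_of_norm_hasDerivWithin_le
      (fun y _ => (hqq y x).hasDerivWithinAt) (fun y hy => hB y (hsub hy) x) hs hr
  have hcont : ContinuousOn (fun r => ∫ x in box d l, q r x) (Icc 0 t) := by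
    refine continuousOn_of_dominated (bound := fun x => |q 0 x| + B * |t|)
      (fun r _ => (hq r).aestronglyMeasurable)
      (fun r hr => Filter.Eventually.of_forall fun x => ?_)
      (((hq 0).abs.integrableOn_box).add (integrable_const _))
      (Filter.Eventually.of_forall fun x r _ => (hqq r x).continuousAt.continuousWithinAt)
    have h1 := hlip 0 ⟨le_rfl, ht.1⟩ r hr x
    have hB0 : 0 ≤ B := (abs_nonneg _).trans (hB t ht x)
    have h2 : B * |r - 0| ≤ B * |t| := by
      refine mul_le_mul_of_nonneg_left ?_ hB0
      rw [sub_zero, abs_of_nonneg hr.1, abs_of_nonneg ht.1]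
      exact hr.2
    have h3 : |q r x| ≤ |q 0 x| + |q r x - q 0 x| := by
      simpa using abs_add_le (q 0 x) (q r x - q 0 x)
    rw [Real.norm_eq_abs]
    linarith
  have hint : IntervalIntegrable (fun s => ∫ x in box d l, q' s x) volume 0 t := by
    rw [intervalIntegrable_iff_integrableOn_Ioo_of_le ht.1]
    refine Integrable.of_bound ?_ (B * (volume.restrict (box d l)).real univ) ?_
    · have hm : AEStronglyMeasurable (deriv fun r => ∫ x in box d l, q r x)
          (volume.restrict (Ioo 0 t)) := (measurable_deriv _).aestronglyMeasurable
      refine hm.congr ?_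
      exact (ae_restrict_iff' measurableSet_Ioo).2
        (Filter.Eventually.of_forall fun s hs => (hder s hs).deriv)
    · refine (ae_restrict_iff' measurableSet_Ioo).2 (Filter.Eventually.of_forall fun s hs => ?_)
      exact norm_integral_le_of_norm_le_const
        (Filter.Eventually.of_forall fun x => hB s (hsub ⟨hs.1.le, hs.2.le⟩) x)
  refine ⟨hint, ?_⟩
  rw [intervalIntegral.integral_eq_sub_of_hasDerivAt_of_le ht.1 hcont hder hint]
  ring

/-- The energy identity for a solution of a transport equation, weighted by the transported
density. -/
lemma SolvesTransport.energy_identity {A : ℝ → E d → E d} {c z ρ : ℝ → E d → ℝ} {α₀ : E d → ℝ}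
    {M : ℝ} (hl : 0 < l) (hz : SolvesTransport l A c z) (hρ : TransportedBy d l A α₀ ρ)
    (hA : ∀ t ∈ Icc (0 : ℝ) T, ContDiff ℝ 1 (A t)) (hAp : ∀ t ∈ Icc (0 : ℝ) T, IsPeriodic l (A t))
    (hc : ∀ t ∈ Icc (0 : ℝ) T, Continuous (c t))
    (hbz : ∀ t ∈ Icc (0 : ℝ) T, ∀ x, |z t x| ≤ M)
    (hbz' : ∀ t ∈ Icc (0 : ℝ) T, ∀ x, |inner ℝ (A t x) (gradient (z t) x) + c t x| ≤ M)
    (hbρ : ∀ t ∈ Icc (0 : ℝ) T, ∀ x, |ρ t x| ≤ M)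
    (hbρ' : ∀ t ∈ Icc (0 : ℝ) T, ∀ x, |diverg (fun y => ρ t y • A t y) x| ≤ M)
    {t : ℝ} (ht : t ∈ Icc (0 : ℝ) T) :
    IntervalIntegrable (fun s => ∫ x in box d l, -2 * z s x * c s x * ρ s x) volume 0 t ∧
      ∫ x in box d l, z t x ^ 2 * ρ t x = (∫ x in box d l, z 0 x ^ 2 * ρ 0 x) +
        ∫ s in (0 : ℝ)..t, ∫ x in box d l, -2 * z s x * c s x * ρ s x := by
  obtain ⟨hρs, -, hρp, -, hρd⟩ := hρ
  have hρA : ∀ s ∈ Icc (0 : ℝ) T, ContDiff ℝ 1 fun y => ρ s y • A s y := fun s hs =>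
    (contDiff_infty.1 (hρs s) 1).smul (hA s hs)
  have hz1 : ∀ s, ContDiff ℝ 1 (z s) := fun s => contDiff_infty.1 (hz.smooth s) 1
  have hgc : ∀ s, Continuous (gradient (z s)) := fun s => by
    rw [gradient_eq_gradMap]
    exact (gradMap d).continuous.comp ((hz1 s).continuous_fderiv one_ne_zero)
  have hdc : ∀ s ∈ Icc (0 : ℝ) T, Continuous (diverg fun y => ρ s y • A s y) := fun s hs => by
    rw [diverg_eq]
    exact (traceMap d).continuous.comp ((hρA s hs).continuous_fderiv one_ne_zero)
  have key := integral_box_evolution (l := l) (T := T) (q := fun s x => z s x ^ 2 * ρ s x)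
    (q' := fun s x => 2 * z s x * (-(inner ℝ (A s x) (gradient (z s) x) + c s x)) * ρ s x +
      z s x ^ 2 * (-(diverg (fun y => ρ s y • A s y) x)))
    (B := 2 * M * M * M + M ^ 2 * M)
    (fun s => ((hz1 s).continuous.pow 2).mul (hρs s).continuous)
    (fun s x => by
      have h := ((hz.hasDerivAt s x).pow 2).mul (hρd s x)
      refine h.congr_deriv ?_
      push_cast
      simp)
    (fun s hs => by
      have h1 := (hz1 s).continuous
      have h2 := hgc s
      have h3 := hdc s hs
      have h4 := (hA s hs).continuous
      have h5 := hc s hs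
      have h6 := (hρs s).continuous
      fun_prop)
    (fun s hs x => by
      have h1 := hbz s hs x
      have h2 := hbz' s hs x
      have h3 := hbρ s hs x
      have h4 := hbρ' s hs x
      have hM : 0 ≤ M := (abs_nonneg _).trans h1
      refine (abs_add_le _ _).trans (add_le_add ?_ ?_)
      · rw [abs_mul, abs_mul, abs_mul, abs_neg, abs_two]
        gcongr
      · rw [abs_mul, abs_neg, abs_pow]
        gcongr) ht
  have heq : ∀ s ∈ Icc (0 : ℝ) T,
      (∫ x in box d l, (2 * z s x * (-(inner ℝ (A s x) (gradient (z s) x) + c s x)) * ρ s x +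
        z s x ^ 2 * (-(diverg (fun y => ρ s y • A s y) x)))) =
      ∫ x in box d l, -2 * z s x * c s x * ρ s x := by
    intro s hs
    have hz2 : ContDiff ℝ 1 fun x => z s x ^ 2 := (hz1 s).pow 2
    have h0 : ∫ x in box d l, diverg (fun y => z s y ^ 2 • ρ s y • A s y) x = 0 :=
      setIntegral_box_diverg hl (hz2.smul (hρA s hs))
      ((((hz.periodic s).comp (· ^ 2)).map₂ ((hρp s).map₂ (hAp s hs) (· • ·)) (· • ·)))
    have h1 : ∀ x, diverg (fun y => z s y ^ 2 • ρ s y • A s y) x =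
        z s x ^ 2 * diverg (fun y => ρ s y • A s y) x +
          2 * z s x * ρ s x * inner ℝ (A s x) (gradient (z s) x) := by
      intro x
      rw [diverg_smul (hz2.differentiable one_ne_zero x) ((hρA s hs).differentiable one_ne_zero x)]
      have hg : gradient (fun x => z s x ^ 2) x = (2 * z s x) • gradient (z s) x := by
        rw [gradient_apply, gradient_apply, ← map_smul]
        congr 1
        have := (((hz1 s).differentiable one_ne_zero x).hasFDerivAt.pow 2).fderiv
        rw [this]
        simp [mul_smul]
      rw [hg, real_inner_smul_left, real_inner_smul_right]
      ring
    have hci : Continuous fun x => inner ℝ (A s x) (gradient (z s) x) :=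
      (hA s hs).continuous.inner (hgc s)
    have hzc := (hz1 s).continuous
    have hρc := (hρs s).continuous
    have hcc := hc s hs
    have hdd := hdc s hs
    have h2 : (∫ x in box d l, (2 * z s x *
        (-(inner ℝ (A s x) (gradient (z s) x) + c s x)) * ρ s x +
        z s x ^ 2 * (-(diverg (fun y => ρ s y • A s y) x)))) =
        ∫ x in box d l, (-2 * z s x * c s x * ρ s x -
          diverg (fun y => z s y ^ 2 • ρ s y • A s y) x) := by
      refine integral_congr_ae (Filter.Eventually.of_forall fun x => ?_)
      simp only [h1]
      ring
    rw [h2, integral_sub, h0, sub_zero]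
    · exact Continuous.integrableOn_box (by fun_prop)
    · refine IntegrableOn.congr_fun ?_ (fun x _ => (h1 x).symm) measurableSet_box
      exact Continuous.integrableOn_box (by fun_prop)
  have hI : EqOn (fun s => ∫ x in box d l, (2 * z s x *
      (-(inner ℝ (A s x) (gradient (z s) x) + c s x)) * ρ s x +
        z s x ^ 2 * (-(diverg (fun y => ρ s y • A s y) x))))
      (fun s => ∫ x in box d l, -2 * z s x * c s x * ρ s x) (uIcc 0 t) := fun s hs => by
    rw [uIcc_of_le ht.1] at hs
    exact heq s ⟨hs.1, hs.2.trans ht.2⟩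
  refine ⟨(intervalIntegrable_congr fun s hs => ?_).1 key.1, ?_⟩
  · exact hI (uIoc_subset_uIcc hs)
  · rw [key.2, intervalIntegral.integral_congr hI]

end Energy

/-! ### Energy identity for the gradient of a transported quantity -/

section GradientEnergy

variable {d : ℕ} {l T : ℝ}

lemma gradient_const_smul {g : E d → ℝ} (hg : Differentiable ℝ g) (r : ℝ) (x : E d) :
    gradient (fun y => r * g y) x = r • gradient g x := by
  rw [gradient_apply, gradient_apply, ← map_smul]
  congr 1
  exact fderiv_const_mul (hg x) r

lemma gradient_fwdDiff {g : E d → ℝ} (hg : Differentiable ℝ g) (h x : E d) :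
    gradient (fwdDiff h g) x = gradient g (x + h) - gradient g x := by
  rw [gradient_apply, gradient_apply, gradient_apply, ← map_sub]
  congr 1
  have := fderiv_fun_sub (𝕜 := ℝ) (f := fun y => g (y + h)) (g := g) (x := x)
    ((differentiableAt_comp_add_right h).2 (hg _)) (hg x)
  rw [fderiv_comp_add_right] at this
  exact this

lemma SolvesTransport.fwdDiff_smul {A : ℝ → E d → E d} {c w : ℝ → E d → ℝ}
    (hw : SolvesTransport l A c w) (r : ℝ) (h : E d) :
    SolvesTransport l A
      (fun t x => r * (inner ℝ (fwdDiff h (A t) x) (gradient (w t) (x + h)) + fwdDiff h (c t) x))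
      (fun t x => r * fwdDiff h (w t) x) where
  smooth t := contDiff_const.mul (((hw.smooth t).comp (contDiff_id.add contDiff_const)).sub
    (hw.smooth t))
  periodic t := ((hw.periodic t).fwdDiff h).comp (r * ·)
  hasDerivAt t x := by
    have h1 := ((hw.hasDerivAt t (x + h)).sub (hw.hasDerivAt t x)).const_mul r
    refine h1.congr_deriv ?_
    have hd := hw.differentiable t
    have hd' : Differentiable ℝ (fwdDiff h (w t)) :=
      (hd.comp (differentiable_id.add_const h)).sub hd
    rw [gradient_const_smul hd', gradient_fwdDiff hd]
    simp only [fwdDiff, inner_sub_left, inner_sub_right, real_inner_smul_right]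
    ring

lemma tendsto_smul_fwdDiff {F : Type*} [NormedAddCommGroup F] [NormedSpace ℝ F] {g : E d → F}
    (hg : Differentiable ℝ g) (x v : E d) :
    Filter.Tendsto (fun n : ℕ => (n : ℝ) • fwdDiff ((n : ℝ)⁻¹ • v) g x) Filter.atTop
      (nhds (fderiv ℝ g x v)) :=
  ((hg x).hasFDerivAt.lim_real v).comp tendsto_natCast_atTop_atTop

lemma DiffBound.norm_smul_fwdDiff_le {F : Type*} [NormedAddCommGroup F] [NormedSpace ℝ F]
    {g : E d → F} {M : ℝ} (hg : DiffBound 1 M g) (hM : 0 ≤ M) (v x : E d) (n : ℕ) :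
    ‖(n : ℝ) • fwdDiff ((n : ℝ)⁻¹ • v) g x‖ ≤ M * ‖v‖ := by
  rcases Nat.eq_zero_or_pos n with rfl | hn
  · simpa using mul_nonneg hM (norm_nonneg v)
  · have hn' : (0 : ℝ) < n := by exact_mod_cast hn
    have h := diffBound_one.1 hg x ((n : ℝ)⁻¹ • v)
    rw [norm_smul, norm_inv, Real.norm_of_nonneg hn'.le] at h
    rw [norm_smul, Real.norm_of_nonneg hn'.le]
    calc (n : ℝ) * ‖fwdDiff ((n : ℝ)⁻¹ • v) g x‖ ≤ n * (M * ((n : ℝ)⁻¹ * ‖v‖)) := by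
          gcongr
          exact h
      _ = M * ‖v‖ := by field_simp

lemma DiffBound.norm_fderiv_apply_le {F : Type*} [NormedAddCommGroup F] [NormedSpace ℝ F]
    {g : E d → F} {M : ℝ} (hg : DiffBound 1 M g) (hM : 0 ≤ M) (hd : Differentiable ℝ g)
    (x v : E d) : ‖_root_.fderiv ℝ g x v‖ ≤ M * ‖v‖ :=
  (_root_.fderiv ℝ g x).le_of_opNorm_le (diffBound_zero.1 (hg.fderiv hM hd) x) v

lemma SolvesTransport.gradient_energy_identity {A : ℝ → E d → E d} {c w ρ : ℝ → E d → ℝ}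
    {α₀ : E d → ℝ} {M : ℝ} (hl : 0 < l) (hM : 0 ≤ M) (hw : SolvesTransport l A c w) (hw0 : w 0 = 0)
    (hρ : TransportedBy d l A α₀ ρ)
    (hA : ∀ t ∈ Icc (0 : ℝ) T, ContDiff ℝ 1 (A t)) (hAp : ∀ t ∈ Icc (0 : ℝ) T, IsPeriodic l (A t))
    (hc : ∀ t ∈ Icc (0 : ℝ) T, ContDiff ℝ 1 (c t))
    (hbA : ∀ t ∈ Icc (0 : ℝ) T, ∀ x, ‖A t x‖ ≤ M) (hbA' : ∀ t ∈ Icc (0 : ℝ) T, DiffBound 1 M (A t))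
    (hbw : ∀ t ∈ Icc (0 : ℝ) T, DiffBound 1 M (w t))
    (hbc : ∀ t ∈ Icc (0 : ℝ) T, DiffBound 1 M (c t))
    (hbρ : ∀ t ∈ Icc (0 : ℝ) T, ∀ x, |ρ t x| ≤ M)
    (hbρ' : ∀ t ∈ Icc (0 : ℝ) T, ∀ x, |diverg (fun y => ρ t y • A t y) x| ≤ M)
    (v : E d) {t : ℝ} (ht : t ∈ Icc (0 : ℝ) T) :
    IntervalIntegrable (fun s => ∫ x in box d l, -2 * fderiv ℝ (w s) x v *
      (inner ℝ (fderiv ℝ (A s) x v) (gradient (w s) x) + fderiv ℝ (c s) x v) * ρ s x) volume 0 t ∧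
    ∫ x in box d l, (fderiv ℝ (w t) x v) ^ 2 * ρ t x =
      ∫ s in (0 : ℝ)..t, ∫ x in box d l, -2 * fderiv ℝ (w s) x v *
        (inner ℝ (fderiv ℝ (A s) x v) (gradient (w s) x) + fderiv ℝ (c s) x v) * ρ s x := by
  have : IsFiniteMeasure (volume.restrict (box d l)) :=
    ⟨by rw [Measure.restrict_apply_univ]; exact isCompact_box.measure_lt_top⟩
  set h : ℕ → E d := fun n => (n : ℝ)⁻¹ • v with hh
  set z : ℕ → ℝ → E d → ℝ := fun n s x => (n : ℝ) * fwdDiff (h n) (w s) x with hz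
  set cz : ℕ → ℝ → E d → ℝ := fun n s x => (n : ℝ) *
    (inner ℝ (fwdDiff (h n) (A s) x) (gradient (w s) (x + h n)) + fwdDiff (h n) (c s) x) with hcz
  have hzs : ∀ n, SolvesTransport l A (cz n) (z n) := fun n => hw.fwdDiff_smul n (h n)
  have hwd := hw.differentiable
  have hgc : ∀ s, Continuous (gradient (w s)) := fun s => (hw.smooth s).gradient.continuous
  have hgb : ∀ s ∈ Icc (0 : ℝ) T, ∀ x, ‖gradient (w s) x‖ ≤ M := fun s hs =>
    diffBound_zero.1 ((hbw s hs).gradient hM (hwd s))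
  have hzb : ∀ n, ∀ s ∈ Icc (0 : ℝ) T, ∀ x, |z n s x| ≤ M * ‖v‖ := fun n s hs x =>
    (hbw s hs).norm_smul_fwdDiff_le hM v x n
  have hczb : ∀ n, ∀ s ∈ Icc (0 : ℝ) T, ∀ x, |cz n s x| ≤ M * ‖v‖ * M + M * ‖v‖ := by
    intro n s hs x
    have e : cz n s x = inner ℝ ((n : ℝ) • fwdDiff (h n) (A s) x) (gradient (w s) (x + h n)) +
        (n : ℝ) • fwdDiff (h n) (c s) x := by
      rw [real_inner_smul_left, smul_eq_mul, hcz]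
      ring
    rw [e]
    refine (abs_add_le _ _).trans (add_le_add ?_ ((hbc s hs).norm_smul_fwdDiff_le hM v x n))
    refine (abs_real_inner_le_norm _ _).trans ?_
    exact mul_le_mul ((hbA' s hs).norm_smul_fwdDiff_le hM v x n) (hgb s hs _) (norm_nonneg _)
      (by positivity)
  have hcc : ∀ s ∈ Icc (0 : ℝ) T, ∀ n, Continuous (cz n s) := by
    intro s hs n
    have h1 := (hc s hs).continuous
    have h2 := (hA s hs).continuous
    have h3 := hgc s
    simp only [hcz, fwdDiff]
    fun_prop
  have hzc : ∀ n s, Continuous (z n s) := fun n s => ((hzs n).smooth s).continuous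
  have hρc : ∀ s, Continuous (ρ s) := fun s => (hρ.1 s).continuous
  have en : ∀ n, IntervalIntegrable (fun s => ∫ x in box d l, -2 * z n s x * cz n s x * ρ s x)
      volume 0 t ∧ ∫ x in box d l, z n t x ^ 2 * ρ t x =
        ∫ s in (0 : ℝ)..t, ∫ x in box d l, -2 * z n s x * cz n s x * ρ s x := by
    intro n
    set M' := max (max (M * ‖v‖) M) (M * ((n : ℝ) * (M + M)) + (M * ‖v‖ * M + M * ‖v‖)) with hM'
    have := (hzs n).energy_identity (T := T) (M := M') hl hρ hA hAp (fun s hs => hcc s hs n)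
      (fun s hs x => (hzb n s hs x).trans ((le_max_left _ _).trans (le_max_left _ _)))
      (fun s hs x => by
        refine le_trans ?_ (le_max_right _ _)
        refine (abs_add_le _ _).trans (add_le_add ?_ (hczb n s hs x))
        refine (abs_real_inner_le_norm _ _).trans ?_
        have hd' : Differentiable ℝ (fwdDiff (h n) (w s)) :=
          ((hwd s).comp (differentiable_id.add_const (h n))).sub (hwd s)
        simp only [hz]
        rw [gradient_const_smul hd', gradient_fwdDiff (hwd s), norm_smul, Real.norm_natCast]
        gcongr
        · exact hbA s hs x
        · exact norm_sub_le_of_le (hgb s hs _) (hgb s hs _))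
      (fun s hs x => (hbρ s hs x).trans ((le_max_right _ _).trans (le_max_left _ _)))
      (fun s hs x => (hbρ' s hs x).trans ((le_max_right _ _).trans (le_max_left _ _))) ht
    refine ⟨this.1, this.2.trans ?_⟩
    simp [hz, hw0, fwdDiff]
  have hzl : ∀ s x, Filter.Tendsto (fun n => z n s x) Filter.atTop (nhds (fderiv ℝ (w s) x v)) :=
    fun s x => tendsto_smul_fwdDiff (hwd s) x v
  have hhl : Filter.Tendsto h Filter.atTop (nhds 0) := by
    simpa using (tendsto_inv_atTop_nhds_zero_nat (𝕜 := ℝ)).smul_const v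
  have hczl : ∀ s ∈ Icc (0 : ℝ) T, ∀ x, Filter.Tendsto (fun n => cz n s x) Filter.atTop
      (nhds (inner ℝ (fderiv ℝ (A s) x v) (gradient (w s) x) + fderiv ℝ (c s) x v)) := by
    intro s hs x
    have h1 := tendsto_smul_fwdDiff ((hA s hs).differentiable one_ne_zero) x v
    have h2 := tendsto_smul_fwdDiff ((hc s hs).differentiable one_ne_zero) x v
    have h3 : Filter.Tendsto (fun n => gradient (w s) (x + h n)) Filter.atTop
        (nhds (gradient (w s) x)) := by
      have := hhl.const_add x
      rw [add_zero] at this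
      exact ((hgc s).tendsto x).comp this
    refine ((h1.inner h3).add h2).congr fun n => ?_
    rw [real_inner_smul_left, smul_eq_mul, hcz]
    ring
  have hin : ∀ n, ∀ s ∈ Icc (0 : ℝ) T, ∀ x, ‖-2 * z n s x * cz n s x * ρ s x‖ ≤
      2 * (M * ‖v‖) * (M * ‖v‖ * M + M * ‖v‖) * M := by
    intro n s hs x
    have h1 := hzb n s hs x
    have h2 := hczb n s hs x
    have h3 := hbρ s hs x
    rw [Real.norm_eq_abs, abs_mul, abs_mul, abs_mul, abs_neg, abs_two]
    gcongr
  have hlim : ∀ s ∈ Icc (0 : ℝ) T, Filter.Tendsto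
      (fun n => ∫ x in box d l, -2 * z n s x * cz n s x * ρ s x) Filter.atTop
      (nhds (∫ x in box d l, -2 * fderiv ℝ (w s) x v *
        (inner ℝ (fderiv ℝ (A s) x v) (gradient (w s) x) + fderiv ℝ (c s) x v) * ρ s x)) := by
    intro s hs
    refine MeasureTheory.tendsto_integral_filter_of_dominated_convergence _
      (Filter.Eventually.of_forall fun n => Continuous.aestronglyMeasurable ?_)
      (Filter.Eventually.of_forall fun n => Filter.Eventually.of_forall fun x => hin n s hs x)
      (integrable_const _) (Filter.Eventually.of_forall fun x =>
        (((hzl s x).const_mul _).mul (hczl s hs x)).mul_const _)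
    have h1 := hzc n s
    have h2 := hcc s hs n
    have h3 := hρc s
    fun_prop
  have hIoc : ∀ s ∈ uIoc 0 t, s ∈ Icc (0 : ℝ) T := fun s hs => by
    rw [uIoc_of_le ht.1] at hs
    exact ⟨hs.1.le, hs.2.trans ht.2⟩
  have hon : ∀ n, ∀ s ∈ Icc (0 : ℝ) T, ‖∫ x in box d l, -2 * z n s x * cz n s x * ρ s x‖ ≤
      2 * (M * ‖v‖) * (M * ‖v‖ * M + M * ‖v‖) * M * (volume.restrict (box d l)).real univ :=
    fun n s hs => norm_integral_le_of_norm_le_const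
      (Filter.Eventually.of_forall fun x => hin n s hs x)
  have hae : ∀ᵐ s ∂volume.restrict (uIoc 0 t), s ∈ Icc (0 : ℝ) T :=
    (ae_restrict_iff' measurableSet_uIoc).2 (Filter.Eventually.of_forall hIoc)
  have : IsFiniteMeasure (volume.restrict (uIoc 0 t)) := by
    rw [uIoc_of_le ht.1]
    infer_instance
  constructor
  · rw [intervalIntegrable_iff]
    refine Integrable.of_bound (aestronglyMeasurable_of_tendsto_ae Filter.atTop
      (fun n => ((en n).1.def').aestronglyMeasurable) (hae.mono hlim)) _ (hae.mono fun s hs =>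
        le_of_tendsto' (hlim s hs).norm fun n => hon n s hs)
  · refine tendsto_nhds_unique (f := fun n => ∫ x in box d l, z n t x ^ 2 * ρ t x) ?_ ?_
      (l := Filter.atTop)
    · refine MeasureTheory.tendsto_integral_filter_of_dominated_convergence
        (fun _ => (M * ‖v‖) ^ 2 * M)
        (Filter.Eventually.of_forall fun n =>
          (((hzc n t).pow 2).mul (hρc t)).aestronglyMeasurable)
        (Filter.Eventually.of_forall fun n => Filter.Eventually.of_forall fun x => ?_)
        (integrable_const _) (Filter.Eventually.of_forall fun x =>
          ((hzl t x).pow 2).mul_const _)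
      have h1 := hzb n t ht x
      have h3 := hbρ t ht x
      rw [Real.norm_eq_abs, abs_mul, abs_pow]
      gcongr
    · simp only [fun n => (en n).2]
      exact intervalIntegral.tendsto_integral_filter_of_dominated_convergence
        (fun _ => 2 * (M * ‖v‖) * (M * ‖v‖ * M + M * ‖v‖) * M *
          (volume.restrict (box d l)).real univ)
        (Filter.Eventually.of_forall fun n => ((en n).1.def').aestronglyMeasurable)
        (Filter.Eventually.of_forall fun n => Filter.Eventually.of_forall fun s hs =>
          hon n s (hIoc s hs))
        intervalIntegrable_const
        (Filter.Eventually.of_forall fun s hs => hlim s (hIoc s hs))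

end GradientEnergy

/-! ### Integral Grönwall inequality -/

lemma integral_le_of_le_integral_add {T C R : ℝ} {ξ : ℝ → ℝ} (hC : 0 ≤ C)
    (hR : 0 ≤ R) (hξ : ContinuousOn ξ (Icc 0 T))
    (h : ∀ t ∈ Icc (0 : ℝ) T, ξ t ≤ C * (∫ s in (0 : ℝ)..t, ξ s) + C * R) {t : ℝ}
    (ht : t ∈ Icc (0 : ℝ) T) : ∫ s in (0 : ℝ)..t, ξ s ≤ C * T * Real.exp (C * T) * R := by
  set G : ℝ → ℝ := fun r => (∫ s in (0 : ℝ)..r, ξ s) * Real.exp (-C * r) - C * R * r with hG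
  have hii : IntervalIntegrable ξ volume 0 T :=
    (hξ.mono (uIcc_of_le (ht.1.trans ht.2)).subset).intervalIntegrable
  have hcF : ContinuousOn (fun r => ∫ s in (0 : ℝ)..r, ξ s) (Icc 0 T) := by
    have := intervalIntegral.continuousOn_primitive_interval' hii left_mem_uIcc
    rwa [uIcc_of_le (ht.1.trans ht.2)] at this
  have hcG : ContinuousOn G (Icc 0 T) := by fun_prop
  have hdF : ∀ r ∈ Ioo 0 T, HasDerivAt (fun r => ∫ s in (0 : ℝ)..r, ξ s) (ξ r) r := by
    intro r hr
    have hn : Icc 0 T ∈ nhds r := Icc_mem_nhds hr.1 hr.2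
    refine intervalIntegral.integral_hasDerivAt_right
      (hii.mono_set (uIcc_subset_uIcc left_mem_uIcc ?_)) ?_ (hξ.continuousAt hn)
    · rw [uIcc_of_le (ht.1.trans ht.2)]
      exact ⟨hr.1.le, hr.2.le⟩
    · exact (hξ.mono Ioo_subset_Icc_self).stronglyMeasurableAtFilter isOpen_Ioo r hr
  have hdG : ∀ r ∈ Ioo 0 T, HasDerivAt G
      (ξ r * Real.exp (-C * r) +
        (∫ s in (0 : ℝ)..r, ξ s) * (Real.exp (-C * r) * -C) - C * R) r := by
    intro r hr
    have he : HasDerivAt (fun r => Real.exp (-C * r)) (Real.exp (-C * r) * -C) r := by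
      simpa using ((hasDerivAt_id r).const_mul (-C)).exp
    have := ((hdF r hr).mul he).sub ((hasDerivAt_id r).const_mul (C * R))
    refine this.congr_deriv ?_
    simp
  have hanti : AntitoneOn G (Icc 0 T) := by
    refine antitoneOn_of_deriv_nonpos (convex_Icc 0 T) hcG (fun r hr => ?_) fun r hr => ?_
    · rw [interior_Icc] at hr
      exact (hdG r hr).differentiableAt.differentiableWithinAt
    · rw [interior_Icc] at hr
      rw [(hdG r hr).deriv]
      have h1 := h r ⟨hr.1.le, hr.2.le⟩
      have h2 : Real.exp (-C * r) ≤ 1 := Real.exp_le_one_iff.2 (by nlinarith [hr.1])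
      have h3 := Real.exp_pos (-C * r)
      have h4 : (ξ r - C * ∫ s in (0 : ℝ)..r, ξ s) * Real.exp (-C * r) ≤ C * R * 1 := by
        refine (mul_le_mul_of_nonneg_right (by linarith : _ ≤ C * R) h3.le).trans ?_
        exact mul_le_mul_of_nonneg_left h2 (mul_nonneg hC hR)
      linarith
  have h0 := hanti ⟨le_rfl, ht.1.trans ht.2⟩ ht ht.1
  simp only [hG, intervalIntegral.integral_same, zero_mul, mul_zero, sub_zero] at h0
  have h1 : (∫ s in (0 : ℝ)..t, ξ s) * Real.exp (-C * t) ≤ C * R * t := by linarith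
  have h2 : ∫ s in (0 : ℝ)..t, ξ s = (∫ s in (0 : ℝ)..t, ξ s) * Real.exp (-C * t) *
      Real.exp (C * t) := by
    rw [mul_assoc, ← Real.exp_add]
    simp
  rw [h2]
  calc (∫ s in (0 : ℝ)..t, ξ s) * Real.exp (-C * t) * Real.exp (C * t)
      ≤ C * R * t * Real.exp (C * t) := by gcongr
    _ ≤ C * R * T * Real.exp (C * T) := by
        have := ht.2
        have hT0 := ht.1.trans ht.2
        gcongr
    _ = C * T * Real.exp (C * T) * R := by ring

/-! ### The residual dynamics -/

section Residual

variable {d : ℕ} {l T S : ℝ} {f : ℝ → E d → E d} {V ρ1 ρ2 : ℝ → E d → ℝ} {α₀ : E d → ℝ}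

/-- The hypotheses on the two density trajectories used in the energy estimate. -/
structure ResidualDynamics (d : ℕ) (l T S : ℝ) (f : ℝ → E d → E d) (V : ℝ → E d → ℝ)
    (α₀ : E d → ℝ) (ρ1 ρ2 : ℝ → E d → ℝ) : Prop where
  side_pos : 0 < l
  nonneg : 0 ≤ S
  velocity_smooth : ∀ t, ContDiff ℝ (⊤ : ℕ∞) (f t)
  velocity_continuous : Continuous (Function.uncurry f)
  velocity_periodic : ∀ t ∈ Icc (0 : ℝ) T, IsPeriodic l (f t)
  drift_smooth : ∀ t, ContDiff ℝ (⊤ : ℕ∞) (V t)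
  drift_periodic : ∀ t ∈ Icc (0 : ℝ) T, IsPeriodic l (V t)
  fst : TransportedBy d l f α₀ ρ1
  snd : TransportedBy d l (Avf V ρ1) α₀ ρ2
  bounds : UniformBounds d T S f V ρ1 ρ2

namespace ResidualDynamics

lemma log_fst_smooth (D : ResidualDynamics d l T S f V α₀ ρ1 ρ2) (t : ℝ) :
    ContDiff ℝ (⊤ : ℕ∞) fun x => Real.log (ρ1 t x) :=
  (D.fst.1 t).log fun x => (D.fst.2.1 t x).ne'

lemma potential_smooth (D : ResidualDynamics d l T S f V α₀ ρ1 ρ2) (t : ℝ) :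
    ContDiff ℝ (⊤ : ℕ∞) (potential V ρ1 t) :=
  (D.drift_smooth t).add (D.log_fst_smooth t)

lemma potential_periodic (D : ResidualDynamics d l T S f V α₀ ρ1 ρ2) {t : ℝ}
    (ht : t ∈ Icc (0 : ℝ) T) : IsPeriodic l (potential V ρ1 t) :=
  (D.drift_periodic t ht).map₂ ((D.fst.2.2.1 t).comp Real.log) (· + ·)

lemma Avf_eq (D : ResidualDynamics d l T S f V α₀ ρ1 ρ2) (t : ℝ) :
    Avf V ρ1 t = fun x => -gradient (potential V ρ1 t) x :=
  _root_.Avf_eq ((D.drift_smooth t).differentiable (by simp))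
    ((D.log_fst_smooth t).differentiable (by simp))

lemma deltaF_eq (D : ResidualDynamics d l T S f V α₀ ρ1 ρ2) (t : ℝ) :
    deltaF f V ρ1 t = fun x => f t x + gradient (potential V ρ1 t) x := by
  funext x
  rw [deltaF, D.Avf_eq, sub_neg_eq_add]

lemma Avf_smooth (D : ResidualDynamics d l T S f V α₀ ρ1 ρ2) (t : ℝ) :
    ContDiff ℝ (⊤ : ℕ∞) (Avf V ρ1 t) := by
  rw [D.Avf_eq]
  exact (D.potential_smooth t).gradient.neg

lemma deltaF_smooth (D : ResidualDynamics d l T S f V α₀ ρ1 ρ2) (t : ℝ) :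
    ContDiff ℝ (⊤ : ℕ∞) (deltaF f V ρ1 t) :=
  (D.velocity_smooth t).sub (D.Avf_smooth t)

lemma Avf_periodic (D : ResidualDynamics d l T S f V α₀ ρ1 ρ2) {t : ℝ}
    (ht : t ∈ Icc (0 : ℝ) T) : IsPeriodic l (Avf V ρ1 t) := by
  rw [D.Avf_eq]
  exact (D.potential_periodic ht).gradient.comp (fun v => -v)

lemma diffBound_gradient_potential (D : ResidualDynamics d l T S f V α₀ ρ1 ρ2) {t : ℝ}
    (ht : t ∈ Icc (0 : ℝ) T) {j : ℕ} (hj : j ≤ 2) :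
    DiffBound j S (gradient (potential V ρ1 t)) :=
  (D.bounds.potential t ht (j + 1) (by omega) (by omega)).gradient D.nonneg
    ((D.potential_smooth t).differentiable (by simp))

lemma diffBound_Avf (D : ResidualDynamics d l T S f V α₀ ρ1 ρ2) {t : ℝ}
    (ht : t ∈ Icc (0 : ℝ) T) {j : ℕ} (hj : j ≤ 2) : DiffBound j S (Avf V ρ1 t) := by
  rw [D.Avf_eq]
  exact (D.diffBound_gradient_potential ht hj).neg

lemma diffBound_gradient_log (D : ResidualDynamics d l T S f V α₀ ρ1 ρ2) {t : ℝ}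
    (ht : t ∈ Icc (0 : ℝ) T) {j : ℕ} (hj : j ≤ 2) :
    DiffBound j S (gradient fun x => Real.log (ρ1 t x)) :=
  (D.bounds.log_fst t ht (j + 1) (by omega) (by omega)).gradient D.nonneg
    ((D.log_fst_smooth t).differentiable (by simp))

lemma diffBound_deltaF (D : ResidualDynamics d l T S f V α₀ ρ1 ρ2) {t : ℝ}
    (ht : t ∈ Icc (0 : ℝ) T) {j : ℕ} (h1 : 1 ≤ j) (hj : j ≤ 2) :
    DiffBound j (S + S) (deltaF f V ρ1 t) := by
  rw [D.deltaF_eq]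
  exact (D.bounds.velocity t ht j h1 (by omega)).add (D.diffBound_gradient_potential ht hj)

lemma exists_norm_deltaF_le (D : ResidualDynamics d l T S f V α₀ ρ1 ρ2) :
    ∃ M, 0 ≤ M ∧ ∀ t ∈ Icc (0 : ℝ) T, ∀ x, ‖deltaF f V ρ1 t x‖ ≤ M := by
  obtain ⟨M, hM⟩ :=
    (isCompact_Icc.prod (isCompact_box (d := d) (l := l))).exists_bound_of_continuousOn
    (f := Function.uncurry f) (s := Icc (0 : ℝ) T ×ˢ box d l) D.velocity_continuous.continuousOn
  refine ⟨max M 0 + S, add_nonneg (le_max_right _ _) D.nonneg, fun t ht x => ?_⟩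
  have hf : ‖f t x‖ ≤ max M 0 := (D.velocity_periodic t ht).forall_of_box D.side_pos
    (P := fun y => ‖y‖ ≤ max M 0) (fun y hy => (hM (t, y) ⟨ht, hy⟩).trans (le_max_left _ _)) x
  rw [D.deltaF_eq]
  exact norm_add_le_of_le hf (diffBound_zero.1 (D.diffBound_gradient_potential ht (by omega)) x)

lemma exists_density_le (D : ResidualDynamics d l T S f V α₀ ρ1 ρ2) :
    ∃ M, 0 ≤ M ∧ ∀ t ∈ Icc (0 : ℝ) T, ∀ x, ρ1 t x ≤ M ∧ ρ2 t x ≤ M := by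
  obtain ⟨a, ha⟩ := D.bounds.osc_fst
  refine ⟨Real.exp (a + S), (Real.exp_pos _).le, fun t ht x => ?_⟩
  obtain ⟨h1, h2⟩ := ha t ht x
  rw [abs_le] at h1 h2
  constructor
  · rw [← Real.exp_log (D.fst.2.1 t x)]
    exact Real.exp_le_exp.2 (by linarith)
  · rw [← Real.exp_log (D.snd.2.1 t x)]
    exact Real.exp_le_exp.2 (by linarith)

lemma exists_le_density (D : ResidualDynamics d l T S f V α₀ ρ1 ρ2) :
    ∃ m, 0 < m ∧ ∀ t ∈ Icc (0 : ℝ) T, ∀ x, m ≤ ρ2 t x := by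
  obtain ⟨a, ha⟩ := D.bounds.osc_fst
  refine ⟨Real.exp (a - S), Real.exp_pos _, fun t ht x => ?_⟩
  have h2 := (abs_le.1 (ha t ht x).2).1
  rw [← Real.exp_log (D.snd.2.1 t x)]
  exact Real.exp_le_exp.2 (by linarith)

lemma density_comparison (D : ResidualDynamics d l T S f V α₀ ρ1 ρ2) {t : ℝ}
    (ht : t ∈ Icc (0 : ℝ) T) (x : E d) : ρ2 t x ≤ Real.exp (2 * S) * ρ1 t x := by
  obtain ⟨a, ha⟩ := D.bounds.osc_fst
  obtain ⟨h1, h2⟩ := ha t ht x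
  rw [abs_le] at h1 h2
  rw [← Real.exp_log (D.snd.2.1 t x), ← Real.exp_log (D.fst.2.1 t x), ← Real.exp_add]
  exact Real.exp_le_exp.2 (by linarith)

lemma norm_gradient_log_snd_le (D : ResidualDynamics d l T S f V α₀ ρ1 ρ2) {t : ℝ}
    (ht : t ∈ Icc (0 : ℝ) T) (x : E d) : ‖gradient (fun x => Real.log (ρ2 t x)) x‖ ≤ S :=
  diffBound_zero.1 ((D.bounds.log_snd t ht).gradient D.nonneg
    (((D.snd.1 t).log fun x => (D.snd.2.1 t x).ne').differentiable (by simp))) x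

lemma exists_norm_diverg_le (D : ResidualDynamics d l T S f V α₀ ρ1 ρ2) :
    ∃ M, 0 ≤ M ∧ ∀ t ∈ Icc (0 : ℝ) T, ∀ x, |diverg (fun y => ρ2 t y • Avf V ρ1 t y) x| ≤ M := by
  obtain ⟨M, hM, h⟩ := D.exists_density_le
  have hS := D.nonneg
  refine ⟨M * (‖traceMap d‖ * S) + S * (M * S), by positivity, fun t ht x => ?_⟩
  have hρ : Differentiable ℝ (ρ2 t) := (D.snd.1 t).differentiable (by simp)
  have hA : Differentiable ℝ (Avf V ρ1 t) := (D.Avf_smooth t).differentiable (by simp)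
  have hpos := D.snd.2.1 t x
  have hg : gradient (ρ2 t) x = ρ2 t x • gradient (fun y => Real.log (ρ2 t y)) x := by
    rw [gradient_log (hρ x) hpos.ne', smul_smul, mul_inv_cancel₀ hpos.ne', one_smul]
  rw [diverg_smul (hρ x) (hA x), hg]
  refine (abs_add_le _ _).trans (add_le_add ?_ ?_)
  · rw [abs_mul, abs_of_pos hpos]
    gcongr
    · exact (h t ht x).2
    · exact diffBound_zero.1 ((D.diffBound_Avf ht (j := 1) (by omega)).diverg hS hA) x
  · refine (abs_real_inner_le_norm _ _).trans ?_
    rw [norm_smul, Real.norm_of_nonneg hpos.le]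
    gcongr
    · exact diffBound_zero.1 (D.diffBound_Avf ht (j := 0) (by omega)) x
    · exact (h t ht x).2
    · exact D.norm_gradient_log_snd_le ht x

end ResidualDynamics

end Residual

/-! ### Energy estimate for the score difference -/

section ScoreGap

variable {d : ℕ} {l T S : ℝ} {f : ℝ → E d → E d} {V ρ1 ρ2 : ℝ → E d → ℝ} {α₀ : E d → ℝ}

/-- The weighted `L²` distance between the scores of two densities. -/
def scoreGap (l : ℝ) (ρ1 ρ2 : ℝ → E d → ℝ) (t : ℝ) : ℝ :=
  ∫ x in box d l, ‖score (ρ1 t) x - score (ρ2 t) x‖ ^ 2 * ρ2 t x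

/-- The integrand in time of `Rloss`. -/
def residualEnergy (l : ℝ) (f : ℝ → E d → E d) (V ρ1 : ℝ → E d → ℝ) (t : ℝ) : ℝ :=
  ∫ x in box d l,
    (‖deltaF f V ρ1 t x‖ ^ 2 + ‖fderiv ℝ (deltaF f V ρ1 t) x‖ ^ 2
      + ‖fderiv ℝ (fun y => fderiv ℝ (deltaF f V ρ1 t) y) x‖ ^ 2) * ρ1 t x

/-- The source term in the transport equation for the difference of the log-densities. -/
def residualSource (f : ℝ → E d → E d) (V ρ1 : ℝ → E d → ℝ) (t : ℝ) (x : E d) : ℝ :=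
  inner ℝ (deltaF f V ρ1 t x) (gradient (fun y => Real.log (ρ1 t y)) x) +
    diverg (deltaF f V ρ1 t) x

/-- The difference of the log-densities. -/
def logRatio (ρ1 ρ2 : ℝ → E d → ℝ) (t : ℝ) (x : E d) : ℝ :=
  Real.log (ρ1 t x) - Real.log (ρ2 t x)

lemma sum_sq_fderiv_uvec (g : E d → ℝ) (x : E d) :
    ∑ i, (fderiv ℝ g x (uvec d i)) ^ 2 = ‖gradient g x‖ ^ 2 := by
  rw [EuclideanSpace.real_norm_sq_eq]
  refine Finset.sum_congr rfl fun i _ => ?_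
  rw [← inner_gradMap, ← gradient_apply, uvec, EuclideanSpace.inner_single_left]
  simp

lemma norm_uvec (i : Fin d) : ‖uvec d i‖ = 1 := by simp [uvec]

lemma gradient_sub {g g' : E d → ℝ} (hg : Differentiable ℝ g) (hg' : Differentiable ℝ g')
    (x : E d) :
    gradient (fun y => g y - g' y) x = gradient g x - gradient g' x := by
  rw [gradient_apply, gradient_apply, gradient_apply, ← map_sub]
  congr 1
  exact fderiv_fun_sub (hg x) (hg' x)

lemma diverg_sub {F F' : E d → E d} (hF : Differentiable ℝ F) (hF' : Differentiable ℝ F')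
    (x : E d) :
    diverg (fun y => F y - F' y) x = diverg F x - diverg F' x := by
  rw [diverg_eq_traceMap, diverg_eq_traceMap, diverg_eq_traceMap, ← map_sub]
  congr 1
  exact fderiv_fun_sub (hF x) (hF' x)

namespace ResidualDynamics

lemma residualSource_smooth (D : ResidualDynamics d l T S f V α₀ ρ1 ρ2) (t : ℝ) :
    ContDiff ℝ (⊤ : ℕ∞) (residualSource f V ρ1 t) :=
  ((D.deltaF_smooth t).inner ℝ (D.log_fst_smooth t).gradient).add (D.deltaF_smooth t).diverg

lemma logRatio_smooth (D : ResidualDynamics d l T S f V α₀ ρ1 ρ2) (t : ℝ) :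
    ContDiff ℝ (⊤ : ℕ∞) (logRatio ρ1 ρ2 t) :=
  (D.log_fst_smooth t).sub ((D.snd.1 t).log fun x => (D.snd.2.1 t x).ne')

lemma solvesTransport_logRatio (D : ResidualDynamics d l T S f V α₀ ρ1 ρ2) :
    SolvesTransport l (Avf V ρ1) (residualSource f V ρ1) (logRatio ρ1 ρ2) := by
  have hf : ∀ t, Differentiable ℝ (f t) := fun t => (D.velocity_smooth t).differentiable (by simp)
  have hA : ∀ t, Differentiable ℝ (Avf V ρ1 t) := fun t =>
    (D.Avf_smooth t).differentiable (by simp)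
  have h1 := D.fst.solvesTransport hf
  have h2 := D.snd.solvesTransport hA
  refine ⟨D.logRatio_smooth, fun t => (h1.periodic t).map₂ (h2.periodic t) (· - ·), fun t x => ?_⟩
  refine ((h1.hasDerivAt t x).sub (h2.hasDerivAt t x)).congr_deriv ?_
  have hg : gradient (logRatio ρ1 ρ2 t) x = gradient (fun x => Real.log (ρ1 t x)) x -
      gradient (fun x => Real.log (ρ2 t x)) x :=
    gradient_sub (h1.differentiable t) (h2.differentiable t) x
  have hd : diverg (deltaF f V ρ1 t) x = diverg (f t) x - diverg (Avf V ρ1 t) x :=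
    diverg_sub (hf t) (hA t) x
  rw [residualSource, hd, hg, deltaF, inner_sub_left, inner_sub_right]
  ring

lemma gradient_logRatio (D : ResidualDynamics d l T S f V α₀ ρ1 ρ2) (t : ℝ) (x : E d) :
    gradient (logRatio ρ1 ρ2 t) x = score (ρ1 t) x - score (ρ2 t) x :=
  gradient_sub ((D.log_fst_smooth t).differentiable (by simp))
    (((D.snd.1 t).log fun x => (D.snd.2.1 t x).ne').differentiable (by simp)) x

lemma logRatio_zero (D : ResidualDynamics d l T S f V α₀ ρ1 ρ2) : logRatio ρ1 ρ2 0 = 0 := by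
  funext x
  simp [logRatio, D.fst.2.2.2.1, D.snd.2.2.2.1]

lemma diffBound_logRatio (D : ResidualDynamics d l T S f V α₀ ρ1 ρ2) {t : ℝ}
    (ht : t ∈ Icc (0 : ℝ) T) : DiffBound 1 (S + S) (logRatio ρ1 ρ2 t) := by
  have := (D.bounds.log_fst t ht 1 (by omega) (by omega)).add (D.bounds.log_snd t ht).neg
  simp only [← sub_eq_add_neg] at this
  exact this

lemma exists_diffBound_residualSource (D : ResidualDynamics d l T S f V α₀ ρ1 ρ2) :
    ∃ M, 0 ≤ M ∧ ∀ t ∈ Icc (0 : ℝ) T, DiffBound 1 M (residualSource f V ρ1 t) := by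
  obtain ⟨M, hM, h⟩ := D.exists_norm_deltaF_le
  have hS := D.nonneg
  refine ⟨2 ^ 1 * (M + (S + S)) * S + ‖traceMap d‖ * (S + S), by positivity, fun t ht => ?_⟩
  refine (DiffBound.inner (fun j hj => ?_) fun j hj =>
    D.diffBound_gradient_log ht (by omega)).add ((D.diffBound_deltaF ht (j := 2) (by omega)
      (by omega)).diverg (by positivity) ((D.deltaF_smooth t).differentiable (by simp)))
  rcases Nat.eq_zero_or_pos j with rfl | hj0
  · exact diffBound_zero.2 fun x => (h t ht x).trans (by linarith)
  · exact (D.diffBound_deltaF ht hj0 (by omega)).mono (by linarith)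

lemma abs_fderiv_residualSource_le (D : ResidualDynamics d l T S f V α₀ ρ1 ρ2) {t : ℝ}
    (ht : t ∈ Icc (0 : ℝ) T) (x v : E d) (hv : ‖v‖ = 1) :
    |fderiv ℝ (residualSource f V ρ1 t) x v| ≤ (S + ‖traceMap d‖) *
      (‖deltaF f V ρ1 t x‖ + ‖fderiv ℝ (deltaF f V ρ1 t) x‖ +
        ‖fderiv ℝ (fun y => fderiv ℝ (deltaF f V ρ1 t) y) x‖) := by
  have hS := D.nonneg
  have hδ : ContDiff ℝ (⊤ : ℕ∞) (deltaF f V ρ1 t) := D.deltaF_smooth t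
  have hδd : Differentiable ℝ (deltaF f V ρ1 t) := hδ.differentiable (by simp)
  have hg := (D.log_fst_smooth t).gradient
  have hgd : Differentiable ℝ (gradient fun y => Real.log (ρ1 t y)) := hg.differentiable (by simp)
  have hδ' : Differentiable ℝ (fderiv ℝ (deltaF f V ρ1 t)) :=
    (hδ.fderiv_right (m := 1) (by norm_cast)).differentiable one_ne_zero
  have e : fderiv ℝ (residualSource f V ρ1 t) x v =
      inner ℝ (deltaF f V ρ1 t x) (fderiv ℝ (gradient fun y => Real.log (ρ1 t y)) x v) +
      inner ℝ (fderiv ℝ (deltaF f V ρ1 t) x v) (gradient (fun y => Real.log (ρ1 t y)) x) +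
      traceMap d (fderiv ℝ (fderiv ℝ (deltaF f V ρ1 t)) x v) := by
    have h1 : HasFDerivAt (fun y => traceMap d (fderiv ℝ (deltaF f V ρ1 t) y))
        ((traceMap d).comp (fderiv ℝ (fderiv ℝ (deltaF f V ρ1 t)) x)) x :=
      (traceMap d).hasFDerivAt.comp x (hδ' x).hasFDerivAt
    have h2 := ((hδd x).hasFDerivAt.inner ℝ (hgd x).hasFDerivAt).add h1
    have h3 : residualSource f V ρ1 t = (fun y => inner ℝ (deltaF f V ρ1 t y)
        (gradient (fun y => Real.log (ρ1 t y)) y)) +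
          fun y => traceMap d (fderiv ℝ (deltaF f V ρ1 t) y) := by
      funext y
      simp [residualSource, diverg_eq_traceMap]
    rw [h3, h2.fderiv]
    simp
  have hg0 := diffBound_zero.1 (D.diffBound_gradient_log ht (j := 0) (by omega)) x
  have hg1 := (D.diffBound_gradient_log ht (j := 1) (by omega)).norm_fderiv_apply_le hS hgd x v
  have hd1 := (fderiv ℝ (deltaF f V ρ1 t) x).le_opNorm v
  have hd2 := (fderiv ℝ (fderiv ℝ (deltaF f V ρ1 t)) x).le_opNorm v
  rw [hv, mul_one] at hg1 hd1 hd2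
  have b1 := (abs_real_inner_le_norm (deltaF f V ρ1 t x)
    (fderiv ℝ (gradient fun y => Real.log (ρ1 t y)) x v)).trans
      (mul_le_mul_of_nonneg_left hg1 (norm_nonneg _))
  have b2 := (abs_real_inner_le_norm (fderiv ℝ (deltaF f V ρ1 t) x v)
    (gradient (fun y => Real.log (ρ1 t y)) x)).trans
      (mul_le_mul hd1 hg0 (norm_nonneg _) (norm_nonneg _))
  have b3 := (traceMap d).le_opNorm_of_le hd2
  rw [Real.norm_eq_abs] at b3
  rw [e]
  refine (abs_add_three _ _ _).trans ?_
  have p1 := mul_nonneg (norm_nonneg (traceMap d)) (norm_nonneg (deltaF f V ρ1 t x))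
  have p2 := mul_nonneg (norm_nonneg (traceMap d)) (norm_nonneg (fderiv ℝ (deltaF f V ρ1 t) x))
  have p3 := mul_nonneg hS (norm_nonneg (fderiv ℝ (fderiv ℝ (deltaF f V ρ1 t)) x))
  linarith

end ResidualDynamics

end ScoreGap

section ScoreGapBound

variable {d : ℕ} {l T S : ℝ} {f : ℝ → E d → E d} {V ρ1 ρ2 : ℝ → E d → ℝ} {α₀ : E d → ℝ}

/-- The rate of change of the energy of the directional derivative of the log-ratio. -/
def energyRate (l : ℝ) (f : ℝ → E d → E d) (V ρ1 ρ2 : ℝ → E d → ℝ) (v : E d) (s : ℝ) : ℝ :=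
  ∫ x in box d l, -2 * fderiv ℝ (logRatio ρ1 ρ2 s) x v *
    (inner ℝ (fderiv ℝ (Avf V ρ1 s) x v) (gradient (logRatio ρ1 ρ2 s) x) +
      fderiv ℝ (residualSource f V ρ1 s) x v) * ρ2 s x

/-- The constant in the differential inequality for the score gap. -/
def gapConst (d : ℕ) (S : ℝ) : ℝ :=
  2 * S + 3 * (S + ‖traceMap d‖) + (S + ‖traceMap d‖) * Real.exp (2 * S)

lemma gapConst_nonneg (hS : 0 ≤ S) : 0 ≤ gapConst d S := by
  unfold gapConst
  positivity

lemma residualEnergy_nonneg (hρ : ∀ t x, 0 < ρ1 t x) (t : ℝ) : 0 ≤ residualEnergy l f V ρ1 t :=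
  integral_nonneg fun x => mul_nonneg (by positivity) (hρ t x).le

namespace ResidualDynamics

lemma energyRate_identity (D : ResidualDynamics d l T S f V α₀ ρ1 ρ2) (v : E d) {t : ℝ}
    (ht : t ∈ Icc (0 : ℝ) T) :
    IntervalIntegrable (energyRate l f V ρ1 ρ2 v) volume 0 t ∧
      ∫ x in box d l, (fderiv ℝ (logRatio ρ1 ρ2 t) x v) ^ 2 * ρ2 t x =
        ∫ s in (0 : ℝ)..t, energyRate l f V ρ1 ρ2 v s := by
  obtain ⟨M₁, h₁, H₁⟩ := D.exists_diffBound_residualSource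
  obtain ⟨M₂, h₂, H₂⟩ := D.exists_density_le
  obtain ⟨M₃, h₃, H₃⟩ := D.exists_norm_diverg_le
  have hS := D.nonneg
  refine D.solvesTransport_logRatio.gradient_energy_identity (T := T) (M := S + S + M₁ + M₂ + M₃)
    D.side_pos (by positivity) D.logRatio_zero D.snd
    (fun s _ => contDiff_infty.1 (D.Avf_smooth s) 1) (fun s hs => D.Avf_periodic hs)
    (fun s _ => contDiff_infty.1 (D.residualSource_smooth s) 1)
    (fun s hs x => (diffBound_zero.1 (D.diffBound_Avf hs (j := 0) (by omega)) x).trans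
      (by linarith))
    (fun s hs => (D.diffBound_Avf hs (j := 1) (by omega)).mono (by linarith))
    (fun s hs => (D.diffBound_logRatio hs).mono (by linarith))
    (fun s hs => (H₁ s hs).mono (by linarith)) (fun s hs x => ?_)
    (fun s hs x => (H₃ s hs x).trans (by linarith)) v ht
  rw [abs_of_pos (D.snd.2.1 s x)]
  exact (H₂ s hs x).2.trans (by linarith)

lemma scoreGap_eq (D : ResidualDynamics d l T S f V α₀ ρ1 ρ2) {t : ℝ} (ht : t ∈ Icc (0 : ℝ) T) :
    scoreGap l ρ1 ρ2 t = ∑ i, ∫ s in (0 : ℝ)..t, energyRate l f V ρ1 ρ2 (uvec d i) s := by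
  have h : scoreGap l ρ1 ρ2 t = ∫ x in box d l,
      ∑ i, (fderiv ℝ (logRatio ρ1 ρ2 t) x (uvec d i)) ^ 2 * ρ2 t x := by
    refine integral_congr_ae (Filter.Eventually.of_forall fun x => ?_)
    simp only [← Finset.sum_mul, sum_sq_fderiv_uvec, D.gradient_logRatio]
  have hc : Continuous (fderiv ℝ (logRatio ρ1 ρ2 t)) :=
    (D.logRatio_smooth t).continuous_fderiv (by simp)
  have hρ : Continuous (ρ2 t) := (D.snd.1 t).continuous
  rw [h, integral_finsetSum _ fun i _ => Continuous.integrableOn_box (by fun_prop)]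
  exact Finset.sum_congr rfl fun i _ => (D.energyRate_identity (uvec d i) ht).2

lemma continuousOn_scoreGap (D : ResidualDynamics d l T S f V α₀ ρ1 ρ2) :
    ContinuousOn (scoreGap l ρ1 ρ2) (Icc 0 T) := by
  rcases lt_or_ge T 0 with hT | hT
  · simp [Icc_eq_empty_of_lt hT]
  refine ContinuousOn.congr ?_ fun t ht => D.scoreGap_eq ht
  refine continuousOn_finsetSum _ fun i _ => ?_
  have := intervalIntegral.continuousOn_primitive_interval'
    (D.energyRate_identity (uvec d i) ⟨hT, le_rfl⟩).1 left_mem_uIcc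
  rwa [uIcc_of_le hT] at this

lemma energyRate_le (D : ResidualDynamics d l T S f V α₀ ρ1 ρ2) {t : ℝ} (ht : t ∈ Icc (0 : ℝ) T)
    {v : E d} (hv : ‖v‖ = 1) :
    energyRate l f V ρ1 ρ2 v t ≤
      gapConst d S * (scoreGap l ρ1 ρ2 t + residualEnergy l f V ρ1 t) := by
  have hS := D.nonneg
  set κ := S + ‖traceMap d‖ with hκ
  have hκ0 : 0 ≤ κ := by positivity
  have hw := D.logRatio_smooth t
  have hδ : ContDiff ℝ (⊤ : ℕ∞) (deltaF f V ρ1 t) := D.deltaF_smooth t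
  have hA : Differentiable ℝ (Avf V ρ1 t) := (D.Avf_smooth t).differentiable (by simp)
  have c1 : Continuous (fderiv ℝ (logRatio ρ1 ρ2 t)) := hw.continuous_fderiv (by simp)
  have c2 : Continuous (fderiv ℝ (Avf V ρ1 t)) := (D.Avf_smooth t).continuous_fderiv (by simp)
  have c3 : Continuous (fderiv ℝ (residualSource f V ρ1 t)) :=
    (D.residualSource_smooth t).continuous_fderiv (by simp)
  have c4 : Continuous (gradient (logRatio ρ1 ρ2 t)) := hw.gradient.continuous
  have c5 : Continuous (ρ2 t) := (D.snd.1 t).continuous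
  have c6 : Continuous (ρ1 t) := (D.fst.1 t).continuous
  have c7 : Continuous (deltaF f V ρ1 t) := hδ.continuous
  have c8 : Continuous (fderiv ℝ (deltaF f V ρ1 t)) := hδ.continuous_fderiv (by simp)
  have c9 : Continuous (fderiv ℝ fun y => fderiv ℝ (deltaF f V ρ1 t) y) :=
    (hδ.fderiv_right (m := 1) (by norm_cast)).continuous_fderiv one_ne_zero
  have c9' : Continuous fun x => ‖fderiv ℝ (fun y => fderiv ℝ (deltaF f V ρ1 t) y) x‖ :=
    (continuous_norm (E := E d →L[ℝ] E d →L[ℝ] E d)).comp c9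
  have c10 : Continuous fun x => score (ρ1 t) x - score (ρ2 t) x := by
    simpa only [← D.gradient_logRatio] using c4
  have key : ∀ x, -2 * fderiv ℝ (logRatio ρ1 ρ2 t) x v *
      (inner ℝ (fderiv ℝ (Avf V ρ1 t) x v) (gradient (logRatio ρ1 ρ2 t) x) +
        fderiv ℝ (residualSource f V ρ1 t) x v) * ρ2 t x ≤
      gapConst d S * (‖score (ρ1 t) x - score (ρ2 t) x‖ ^ 2 * ρ2 t x) + gapConst d S *
        ((‖deltaF f V ρ1 t x‖ ^ 2 + ‖fderiv ℝ (deltaF f V ρ1 t) x‖ ^ 2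
          + ‖fderiv ℝ (fun y => fderiv ℝ (deltaF f V ρ1 t) y) x‖ ^ 2) * ρ1 t x) := by
    intro x
    rw [← D.gradient_logRatio]
    set p := ‖gradient (logRatio ρ1 ρ2 t) x‖ with hp
    have h1 : |fderiv ℝ (logRatio ρ1 ρ2 t) x v| ≤ p := by
      have := (fderiv ℝ (logRatio ρ1 ρ2 t) x).le_opNorm v
      rwa [hv, mul_one, ← norm_gradMap, ← gradient_apply] at this
    have h2 : |inner ℝ (fderiv ℝ (Avf V ρ1 t) x v) (gradient (logRatio ρ1 ρ2 t) x)| ≤ S * p := by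
      refine (abs_real_inner_le_norm _ _).trans ?_
      have := (D.diffBound_Avf ht (j := 1) (by omega)).norm_fderiv_apply_le hS hA x v
      rw [hv, mul_one] at this
      exact mul_le_mul_of_nonneg_right this (norm_nonneg _)
    have h3 := D.abs_fderiv_residualSource_le ht x v hv
    have hcomp := D.density_comparison ht x
    have hpos := D.snd.2.1 t x
    have hpos1 := D.fst.2.1 t x
    rw [← hκ] at h3
    unfold gapConst
    rw [← hκ]
    set a := ‖deltaF f V ρ1 t x‖
    set b := ‖fderiv ℝ (deltaF f V ρ1 t) x‖
    set c := ‖fderiv ℝ (fun y => fderiv ℝ (deltaF f V ρ1 t) y) x‖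
    set W := fderiv ℝ (logRatio ρ1 ρ2 t) x v
    set α := inner ℝ (fderiv ℝ (Avf V ρ1 t) x v) (gradient (logRatio ρ1 ρ2 t) x)
    set β := fderiv ℝ (residualSource f V ρ1 t) x v
    have hp0 : 0 ≤ p := norm_nonneg _
    have h4 : -2 * W * (α + β) ≤ 2 * p * (S * p + κ * (a + b + c)) := by
      refine (le_abs_self _).trans ?_
      rw [abs_mul, abs_mul, abs_neg, abs_two]
      refine mul_le_mul (by linarith) ((abs_add_le _ _).trans (add_le_add h2 h3)) (abs_nonneg _)
        (by positivity)
    have h5 : 2 * p * (S * p + κ * (a + b + c)) ≤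
        (2 * S + 3 * κ) * p ^ 2 + κ * (a ^ 2 + b ^ 2 + c ^ 2) := by
      have := mul_nonneg hκ0 (add_nonneg (add_nonneg (sq_nonneg (p - a)) (sq_nonneg (p - b)))
        (sq_nonneg (p - c)))
      linarith
    have hq : 0 ≤ a ^ 2 + b ^ 2 + c ^ 2 := by positivity
    have he := Real.exp_pos (2 * S)
    calc -2 * W * (α + β) * ρ2 t x
        ≤ ((2 * S + 3 * κ) * p ^ 2 + κ * (a ^ 2 + b ^ 2 + c ^ 2)) * ρ2 t x :=
          mul_le_mul_of_nonneg_right (h4.trans h5) hpos.le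
      _ = (2 * S + 3 * κ) * (p ^ 2 * ρ2 t x) + κ * (a ^ 2 + b ^ 2 + c ^ 2) * ρ2 t x := by ring
      _ ≤ (2 * S + 3 * κ) * (p ^ 2 * ρ2 t x) +
          κ * (a ^ 2 + b ^ 2 + c ^ 2) * (Real.exp (2 * S) * ρ1 t x) := by gcongr
      _ = (2 * S + 3 * κ) * (p ^ 2 * ρ2 t x) +
          κ * Real.exp (2 * S) * ((a ^ 2 + b ^ 2 + c ^ 2) * ρ1 t x) := by ring
      _ ≤ _ := add_le_add
        (mul_le_mul_of_nonneg_right (le_add_of_nonneg_right (by positivity)) (by positivity))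
        (mul_le_mul_of_nonneg_right (le_add_of_nonneg_left (by positivity)) (by positivity))
  have i1 : IntegrableOn (fun x => ‖score (ρ1 t) x - score (ρ2 t) x‖ ^ 2 * ρ2 t x) (box d l) :=
    Continuous.integrableOn_box (by fun_prop)
  have i2 : IntegrableOn (fun x => (‖deltaF f V ρ1 t x‖ ^ 2 + ‖fderiv ℝ (deltaF f V ρ1 t) x‖ ^ 2
      + ‖fderiv ℝ (fun y => fderiv ℝ (deltaF f V ρ1 t) y) x‖ ^ 2) * ρ1 t x) (box d l) :=
    Continuous.integrableOn_box
      ((((c7.norm.pow 2).add (c8.norm.pow 2)).add (c9'.pow 2)).mul c6)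
  rw [mul_add, scoreGap, residualEnergy, ← integral_const_mul, ← integral_const_mul,
    ← integral_add (i1.const_mul _) (i2.const_mul _)]
  exact integral_mono (Continuous.integrableOn_box (by fun_prop))
    ((i1.const_mul _).add (i2.const_mul _)) key

lemma integral_scoreGap_le (D : ResidualDynamics d l T S f V α₀ ρ1 ρ2)
    (hI : IntervalIntegrable (residualEnergy l f V ρ1) volume 0 T) {t : ℝ}
    (ht : t ∈ Icc (0 : ℝ) T) :
    ∫ s in (0 : ℝ)..t, scoreGap l ρ1 ρ2 s ≤
      d * gapConst d S * T * Real.exp (d * gapConst d S * T) * Rloss d l T f V ρ1 := by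
  have hT : 0 ≤ T := ht.1.trans ht.2
  have hC : 0 ≤ gapConst d S := gapConst_nonneg D.nonneg
  have hR : Rloss d l T f V ρ1 = ∫ s in (0 : ℝ)..T, residualEnergy l f V ρ1 s := rfl
  have hn : ∀ s, 0 ≤ residualEnergy l f V ρ1 s := residualEnergy_nonneg D.fst.2.1
  refine integral_le_of_le_integral_add (mul_nonneg (Nat.cast_nonneg _) hC)
    (hR ▸ intervalIntegral.integral_nonneg hT fun s _ => hn s) D.continuousOn_scoreGap
    (fun r hr => ?_) ht
  have hrs : uIcc 0 r ⊆ uIcc 0 T := by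
    rw [uIcc_of_le hr.1, uIcc_of_le hT]
    exact Icc_subset_Icc_right hr.2
  have hIr := hI.mono_set hrs
  have hξr : IntervalIntegrable (scoreGap l ρ1 ρ2) volume 0 r :=
    (D.continuousOn_scoreGap.mono (by rwa [uIcc_of_le hT] at hrs)).intervalIntegrable
  have hmono : ∫ s in (0 : ℝ)..r, residualEnergy l f V ρ1 s ≤ Rloss d l T f V ρ1 :=
    intervalIntegral.integral_mono_interval le_rfl hr.1 hr.2
      (Filter.Eventually.of_forall hn) hI
  have hi : ∀ i : Fin d, ∫ s in (0 : ℝ)..r, energyRate l f V ρ1 ρ2 (uvec d i) s ≤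
      gapConst d S * ((∫ s in (0 : ℝ)..r, scoreGap l ρ1 ρ2 s) + Rloss d l T f V ρ1) := by
    intro i
    have h1 := intervalIntegral.integral_mono_on hr.1 (D.energyRate_identity (uvec d i) hr).1
      ((hξr.add hIr).const_mul (gapConst d S))
      fun s hs => D.energyRate_le ⟨hs.1, hs.2.trans hr.2⟩ (norm_uvec i)
    refine h1.trans ?_
    rw [intervalIntegral.integral_const_mul]
    refine mul_le_mul_of_nonneg_left ?_ hC
    refine (intervalIntegral.integral_add hξr hIr).trans_le ?_
    linarith
  rw [D.scoreGap_eq hr]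
  refine (Finset.sum_le_sum fun i _ => hi i).trans_eq ?_
  rw [Finset.sum_const, Finset.card_univ, Fintype.card_fin, nsmul_eq_mul]
  ring

end ResidualDynamics

end ScoreGapBound

/-! ### Measurability through a space of continuous functions -/

lemma measurable_dist_continuousMap {Ω K X : Type*} [MeasurableSpace Ω] [TopologicalSpace K]
    [CompactSpace K] [SecondCountableTopology K] [PseudoMetricSpace X] [MeasurableSpace X]
    [BorelSpace X] [SecondCountableTopology X] {G : Ω → C(K, X)}
    (hG : ∀ x, Measurable fun ω => G ω x) (g : C(K, X)) : Measurable fun ω => dist (G ω) g := by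
  obtain ⟨s, hsc, hs⟩ := TopologicalSpace.exists_countable_dense K
  refine measurable_of_Iic fun C => ?_
  rcases lt_or_ge C 0 with hC | hC
  · convert MeasurableSet.empty
    ext ω
    simpa using hC.trans_le dist_nonneg
  · have : (fun ω => dist (G ω) g) ⁻¹' Iic C = ⋂ x ∈ s, {ω | dist (G ω x) (g x) ≤ C} := by
      ext ω
      simp only [mem_preimage, mem_Iic, mem_iInter, mem_ofPred_eq]
      rw [ContinuousMap.dist_le hC]
      refine ⟨fun h x _ => h x, fun h x => ?_⟩
      have hcl : IsClosed {x | dist (G ω x) (g x) ≤ C} :=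
        isClosed_le ((G ω).continuous.dist g.continuous) continuous_const
      exact hcl.closure_subset_iff.2 h (hs x)
    rw [this]
    exact MeasurableSet.biInter hsc fun x _ =>
      measurableSet_le ((hG x).dist measurable_const) measurable_const

lemma measurable_of_continuousMap_stable {Ω K X Y : Type*} [MeasurableSpace Ω]
    [TopologicalSpace K] [CompactSpace K] [LocallyCompactSpace K] [SecondCountableTopology K]
    [PseudoMetricSpace X]
    [MeasurableSpace X] [BorelSpace X] [SecondCountableTopology X] [PseudoMetricSpace Y]
    [MeasurableSpace Y] [BorelSpace Y] {G : Ω → C(K, X)} (hG : ∀ x, Measurable fun ω => G ω x)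
    {g : Ω → Y} (hg : ∀ ω₀, ∀ ε > 0, ∃ r > 0, ∀ ω, dist (G ω) (G ω₀) < r →
      dist (g ω) (g ω₀) < ε) : Measurable g := by
  refine measurable_of_isOpen fun O hO => ?_
  have hloc : ∀ ω₀ : g ⁻¹' O, ∃ r > 0, ∀ ω, dist (G ω) (G ω₀) < r → g ω ∈ O := by
    rintro ⟨ω₀, h₀⟩
    obtain ⟨ε, hε, hb⟩ := Metric.isOpen_iff.1 hO _ h₀
    obtain ⟨r, hr, h⟩ := hg ω₀ ε hε
    exact ⟨r, hr, fun ω hω => hb (h ω hω)⟩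
  choose r hr h using hloc
  obtain ⟨s, hs, hU⟩ := TopologicalSpace.isOpen_iUnion_countable
    (fun ω₀ : g ⁻¹' O => Metric.ball (G ω₀) (r ω₀)) fun _ => Metric.isOpen_ball
  have : g ⁻¹' O = ⋃ ω₀ ∈ s, {ω | dist (G ω) (G ω₀) < r ω₀} := by
    ext ω
    have hmem : (G ω ∈ ⋃ ω₀ : g ⁻¹' O, Metric.ball (G ω₀) (r ω₀)) ↔ g ω ∈ O := by
      simp only [mem_iUnion, Metric.mem_ball]
      exact ⟨fun ⟨ω₀, h'⟩ => h ω₀ ω h', fun h' => ⟨⟨ω, h'⟩, by simpa using hr ⟨ω, h'⟩⟩⟩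
    rw [mem_preimage, ← hmem, ← hU]
    simp only [mem_iUnion, Metric.mem_ball, mem_ofPred_eq]
  rw [this]
  exact MeasurableSet.biUnion hs fun ω₀ _ =>
    measurableSet_lt (measurable_dist_continuousMap hG _) measurable_const

/-! ### Stability of the drift with respect to the density and its time derivative -/

section Stability

variable {d : ℕ} {l : ℝ}

lemma convex_box : Convex ℝ (box d l) := by
  rw [box_eq_preimage]
  exact (convex_Icc _ _).linear_preimage (EuclideanSpace.equiv (Fin d) ℝ).toLinearEquiv.toLinearMap

lemma measureReal_ball_inter_box_pos (hl : 0 < l) {x : E d} (hx : x ∈ box d l) {s : ℝ}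
    (hs : 0 < s) : 0 < volume.real (Metric.ball x s ∩ box d l) := by
  have h0 : (interior (box d l)).Nonempty := by
    refine ⟨0, mem_interior_iff_mem_nhds.2 (Filter.mem_of_superset
      (Metric.ball_mem_nhds (0 : E d) (half_pos hl)) fun y hy i => abs_le.1 ?_)⟩
    exact (PiLp.norm_apply_le y i).trans (mem_ball_zero_iff.1 hy).le
  have hcl : x ∈ closure (interior (box d l)) := by
    rw [convex_box.closure_interior_eq_closure_of_nonempty_interior h0]
    exact subset_closure hx
  have hne : (Metric.ball x s ∩ interior (box d l)).Nonempty :=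
    mem_closure_iff_nhds.1 hcl _ (Metric.ball_mem_nhds x hs)
  have hpos := (Metric.isOpen_ball.inter isOpen_interior).measure_pos volume hne
  refine ENNReal.toReal_pos (hpos.trans_le (measure_mono
    (inter_subset_inter_right _ interior_subset))).ne' ?_
  exact ((measure_mono inter_subset_right).trans_lt isCompact_box.measure_lt_top).ne

/-- A Lipschitz field whose `L²` norm is small is pointwise small. -/
lemma norm_lt_of_setIntegral_lt {F : E d → E d} {B ε : ℝ} (hB : 0 < B) (hε : 0 < ε)
    (hF : DiffBound 1 B F) (hc : Continuous F) {x : E d}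
    (h : ∫ y in box d l, ‖F y‖ ^ 2 <
      (ε / 2) ^ 2 * volume.real (Metric.ball x (ε / (2 * B)) ∩ box d l)) : ‖F x‖ < ε := by
  by_contra! hx
  refine h.not_ge ?_
  set s := Metric.ball x (ε / (2 * B)) ∩ box d l
  have hs : MeasurableSet s := measurableSet_ball.inter measurableSet_box
  have hfin : volume s ≠ ⊤ :=
    ((measure_mono inter_subset_right).trans_lt isCompact_box.measure_lt_top).ne
  have hint : IntegrableOn (fun y => ‖F y‖ ^ 2) (box d l) :=
    (hc.norm.pow 2).integrableOn_box
  calc (ε / 2) ^ 2 * volume.real s = ∫ _ in s, (ε / 2) ^ 2 := by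
        rw [setIntegral_const, smul_eq_mul, mul_comm]
    _ ≤ ∫ y in s, ‖F y‖ ^ 2 := by
        refine setIntegral_mono_on (integrableOn_const hfin) (hint.mono_set inter_subset_right) hs
          fun y hy => ?_
        have h1 := hF.lipschitz x y
        have h2 : ‖x - y‖ < ε / (2 * B) := by
          rw [← dist_eq_norm, dist_comm]
          exact hy.1
        have h3 : B * ‖x - y‖ ≤ ε / 2 := by
          calc B * ‖x - y‖ ≤ B * (ε / (2 * B)) := by gcongr
            _ = ε / 2 := by field_simp
        have h4 := norm_sub_norm_le (F x) (F y)
        exact pow_le_pow_left₀ (by positivity) (by linarith) 2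
    _ ≤ ∫ y in box d l, ‖F y‖ ^ 2 :=
        setIntegral_mono_set hint (Filter.Eventually.of_forall fun _ => by positivity)
          (Filter.Eventually.of_forall inter_subset_right)

lemma setIntegral_norm_gradient_sub_le (hl : 0 < l) {φ φ₀ ρ ρ₀ : E d → ℝ} {S R m r : ℝ}
    (hφ : ContDiff ℝ 2 φ) (hφ₀ : ContDiff ℝ 2 φ₀) (hρ : ContDiff ℝ 1 ρ) (hρ₀ : ContDiff ℝ 1 ρ₀)
    (pφ : IsPeriodic l φ) (pφ₀ : IsPeriodic l φ₀) (pρ : IsPeriodic l ρ) (pρ₀ : IsPeriodic l ρ₀)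
    (hS : 0 ≤ S) (bφ : DiffBound 1 S φ) (bφ₀ : DiffBound 1 S φ₀)
    (hR : ∀ v ∈ box d l, ‖v‖ ≤ R) (hR0 : 0 ≤ R) (hr : 0 ≤ r) (hm : ∀ x, m ≤ ρ x)
    (h1 : ∀ x ∈ box d l, |ρ x - ρ₀ x| ≤ r)
    (h2 : ∀ x ∈ box d l, |diverg (fun y => ρ y • gradient φ y) x
      - diverg (fun y => ρ₀ y • gradient φ₀ y) x| ≤ r) :
    m * ∫ x in box d l, ‖gradient φ x - gradient φ₀ x‖ ^ 2 ≤
      r * (2 * S * R + 2 * S ^ 2) * volume.real (box d l) := by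
  have dφ : Differentiable ℝ φ := hφ.differentiable two_ne_zero
  have dφ₀ : Differentiable ℝ φ₀ := hφ₀.differentiable two_ne_zero
  have gφ : ContDiff ℝ 1 (gradient φ) := (gradMap d).contDiff.comp (hφ.fderiv_right (by norm_num))
  have gφ₀ : ContDiff ℝ 1 (gradient φ₀) :=
    (gradMap d).contDiff.comp (hφ₀.fderiv_right (by norm_num))
  have nφ : ∀ x, ‖gradient φ x‖ ≤ S := diffBound_zero.1 (bφ.gradient hS dφ)
  have nφ₀ : ∀ x, ‖gradient φ₀ x‖ ≤ S := diffBound_zero.1 (bφ₀.gradient hS dφ₀)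
  set ψ : E d → ℝ := fun x => φ x - φ₀ x - (φ 0 - φ₀ 0) with hψ
  have cψ : ContDiff ℝ 1 ψ := ((hφ.sub hφ₀).sub contDiff_const).of_le one_le_two
  have gψ : ∀ x, gradient ψ x = gradient φ x - gradient φ₀ x := by
    intro x
    rw [gradient_apply, gradient_apply, gradient_apply, ← map_sub, hψ, fderiv_sub_const,
      fderiv_fun_sub (dφ x) (dφ₀ x)]
  have pψ : IsPeriodic l ψ := (pφ.map₂ pφ₀ (· - ·)).comp (· - (φ 0 - φ₀ 0))
  have bψ : ∀ x, |ψ x| ≤ 2 * S * R := by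
    intro x
    have ha := bφ.osc_le hl pφ hR hS x 0
    have hb := bφ₀.osc_le hl pφ₀ hR hS x 0
    rw [Real.norm_eq_abs, abs_le] at ha hb
    rw [abs_le, hψ]
    constructor <;> linarith [ha.1, ha.2, hb.1, hb.2]
  set W : E d → E d := fun x => ρ x • gradient φ x - ρ₀ x • gradient φ₀ x with hW
  have cW : ContDiff ℝ 1 W := (hρ.smul gφ).sub (hρ₀.smul gφ₀)
  have pW : IsPeriodic l W :=
    (pρ.map₂ pφ.gradient (· • ·)).map₂ (pρ₀.map₂ pφ₀.gradient (· • ·)) (· - ·)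
  have dW : ∀ x, diverg W x = diverg (fun y => ρ y • gradient φ y) x
      - diverg (fun y => ρ₀ y • gradient φ₀ y) x :=
    diverg_sub ((hρ.smul gφ).differentiable one_ne_zero) ((hρ₀.smul gφ₀).differentiable one_ne_zero)
  have hibp := setIntegral_box_inner_gradient hl cW cψ pW pψ
  have hfin : volume (box d l) < ⊤ := isCompact_box.measure_lt_top
  have e1 : ‖∫ x in box d l, ψ x * diverg W x‖ ≤ 2 * S * R * r * volume.real (box d l) := by
    refine norm_setIntegral_le_of_norm_le_const hfin fun x hx => ?_
    rw [norm_mul, dW]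
    exact mul_le_mul (bψ x) (h2 x hx) (norm_nonneg _) (by positivity)
  have e2 : ‖∫ x in box d l, (ρ x - ρ₀ x) * inner ℝ (gradient φ₀ x) (gradient ψ x)‖ ≤
      r * (S * (S + S)) * volume.real (box d l) := by
    refine norm_setIntegral_le_of_norm_le_const hfin fun x hx => ?_
    rw [norm_mul]
    refine mul_le_mul (h1 x hx) ?_ (norm_nonneg _) hr
    refine (norm_inner_le_norm _ _).trans (mul_le_mul (nφ₀ x) ?_ (norm_nonneg _) hS)
    rw [gψ]
    exact (norm_sub_le _ _).trans (add_le_add (nφ x) (nφ₀ x))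
  have cgψ : Continuous (gradient ψ) := by
    rw [funext gψ]
    exact gφ.continuous.sub gφ₀.continuous
  have key : m * ∫ x in box d l, ‖gradient ψ x‖ ^ 2 ≤
      (∫ x in box d l, inner ℝ (W x) (gradient ψ x)) -
        ∫ x in box d l, (ρ x - ρ₀ x) * inner ℝ (gradient φ₀ x) (gradient ψ x) := by
    have i1 : IntegrableOn (fun x => inner ℝ (W x) (gradient ψ x)) (box d l) :=
      (cW.continuous.inner cgψ).integrableOn_box
    have i2 : IntegrableOn
        (fun x => (ρ x - ρ₀ x) * inner ℝ (gradient φ₀ x) (gradient ψ x)) (box d l) :=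
      ((hρ.continuous.sub hρ₀.continuous).mul (gφ₀.continuous.inner cgψ)).integrableOn_box
    have i3 : IntegrableOn (fun x => m * ‖gradient ψ x‖ ^ 2) (box d l) :=
      (continuous_const.mul (cgψ.norm.pow 2)).integrableOn_box
    rw [← integral_const_mul, ← integral_sub i1 i2]
    refine setIntegral_mono_on i3 (i1.sub i2) measurableSet_box fun x _ => ?_
    have : inner ℝ (W x) (gradient ψ x) - (ρ x - ρ₀ x) * inner ℝ (gradient φ₀ x) (gradient ψ x) =
        ρ x * ‖gradient ψ x‖ ^ 2 := by
      rw [← real_inner_self_eq_norm_sq]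
      nth_rewrite 3 [gψ]
      simp only [hW, inner_sub_left, real_inner_smul_left]
      ring
    rw [this]
    exact mul_le_mul_of_nonneg_right (hm x) (by positivity)
  simp only [gψ] at key hibp e2
  rw [hibp] at key
  rw [Real.norm_eq_abs, abs_le] at e1 e2
  linarith [e1.1, e2.1]

end Stability

/-! ### Measurability in time of the residual -/

lemma stronglyMeasurable_fderiv {d : ℕ} {Ω F : Type*} [MeasurableSpace Ω] [NormedAddCommGroup F]
    [NormedSpace ℝ F] {u : Ω → E d → F} (hu : ∀ x, StronglyMeasurable fun ω => u ω x)
    (hd : ∀ ω, Differentiable ℝ (u ω)) (x : E d) :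
    StronglyMeasurable fun ω => fderiv ℝ (u ω) x := by
  have h1 : ∀ v, StronglyMeasurable fun ω => fderiv ℝ (u ω) x v := fun v =>
    stronglyMeasurable_of_tendsto (f := fun (n : ℕ) ω => (n : ℝ) • fwdDiff ((n : ℝ)⁻¹ • v) (u ω) x)
      Filter.atTop (fun n => ((hu _).sub (hu _)).const_smul (n : ℝ))
      (tendsto_pi_nhds.2 fun ω => tendsto_smul_fwdDiff (hd ω) x v)
  have h2 : ∀ ω, fderiv ℝ (u ω) x = ∑ i, ContinuousLinearMap.smulRightL ℝ (E d) F
      (EuclideanSpace.proj i) (fderiv ℝ (u ω) x (uvec d i)) := by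
    intro ω
    ext v
    conv_lhs => rw [← sum_smul_uvec v]
    simp
  rw [funext h2]
  exact Finset.stronglyMeasurable_fun_sum _ fun i _ =>
    (ContinuousLinearMap.continuous _).comp_stronglyMeasurable (h1 _)

section Measurability

variable {d : ℕ} {l T S : ℝ} {f : ℝ → E d → E d} {V ρ1 ρ2 : ℝ → E d → ℝ} {α₀ : E d → ℝ}

namespace ResidualDynamics

lemma diverg_snd (D : ResidualDynamics d l T S f V α₀ ρ1 ρ2) (t : ℝ) (x : E d) :
    -diverg (fun y => ρ2 t y • Avf V ρ1 t y) x =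
      diverg (fun y => ρ2 t y • gradient (potential V ρ1 t) y) x := by
  rw [D.Avf_eq, diverg_eq_traceMap, diverg_eq_traceMap, ← map_neg]
  simp only [smul_neg, fderiv_fun_neg, neg_neg]

lemma exists_stable_radius (D : ResidualDynamics d l T S f V α₀ ρ1 ρ2) {x : E d}
    (hx : x ∈ box d l) {ε : ℝ} (hε : 0 < ε) :
    ∃ r > 0, ∀ s ∈ Icc (0 : ℝ) T, ∀ t ∈ Icc (0 : ℝ) T,
      (∀ y ∈ box d l, |ρ2 t y - ρ2 s y| ≤ r) →
      (∀ y ∈ box d l, |diverg (fun z => ρ2 t z • gradient (potential V ρ1 t) z) y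
        - diverg (fun z => ρ2 s z • gradient (potential V ρ1 s) z) y| ≤ r) →
      ‖Avf V ρ1 t x - Avf V ρ1 s x‖ < ε := by
  obtain ⟨R, hR1, hR⟩ := exists_box_radius d l
  obtain ⟨m, hm, hm'⟩ := D.exists_le_density
  have hS := D.nonneg
  have hB : 0 < S + S + 1 := by linarith
  have hv := measureReal_ball_inter_box_pos D.side_pos hx (s := ε / (2 * (S + S + 1)))
    (by positivity)
  set v := volume.real (Metric.ball x (ε / (2 * (S + S + 1))) ∩ box d l)
  set c := (2 * S * R + 2 * S ^ 2) * volume.real (box d l) with hc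
  have hc0 : 0 ≤ c := by positivity
  refine ⟨m * ((ε / 2) ^ 2 * v) / (c + 1), by positivity, fun s hs t ht h1 h2 => ?_⟩
  have key := setIntegral_norm_gradient_sub_le D.side_pos
    (contDiff_infty.1 (D.potential_smooth t) 2) (contDiff_infty.1 (D.potential_smooth s) 2)
    (contDiff_infty.1 (D.snd.1 t) 1) (contDiff_infty.1 (D.snd.1 s) 1)
    (D.potential_periodic ht) (D.potential_periodic hs) (D.snd.2.2.1 t) (D.snd.2.2.1 s) hS
    (D.bounds.potential t ht 1 le_rfl (by omega)) (D.bounds.potential s hs 1 le_rfl (by omega))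
    hR (zero_le_one.trans hR1) (by positivity) (hm' t ht) h1 h2
  have hA : ∀ y, ‖gradient (potential V ρ1 t) y - gradient (potential V ρ1 s) y‖ =
      ‖Avf V ρ1 t y - Avf V ρ1 s y‖ := by
    intro y
    rw [D.Avf_eq, D.Avf_eq, neg_sub_neg, norm_sub_rev]
  simp only [hA] at key
  rw [mul_assoc, ← hc] at key
  refine norm_lt_of_setIntegral_lt (l := l) (F := fun y => Avf V ρ1 t y - Avf V ρ1 s y) hB hε ?_
    ((D.Avf_smooth t).continuous.sub (D.Avf_smooth s).continuous) ?_
  · simp only [sub_eq_add_neg]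
    exact ((D.diffBound_Avf ht one_le_two).add (D.diffBound_Avf hs one_le_two).neg).mono
      (by linarith)
  · refine lt_of_mul_lt_mul_left (key.trans_lt ?_) hm.le
    rw [div_mul_eq_mul_div, div_lt_iff₀ (by positivity)]
    have : 0 < m * ((ε / 2) ^ 2 * v) := by positivity
    nlinarith

lemma measurable_Avf (D : ResidualDynamics d l T S f V α₀ ρ1 ρ2) (x : E d) :
    Measurable fun t : Icc (0 : ℝ) T => Avf V ρ1 t x := by
  obtain ⟨k, hk⟩ := exists_add_latticeVec_mem_box D.side_pos x
  have hk' : (fun t : Icc (0 : ℝ) T => Avf V ρ1 t x) =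
      fun t : Icc (0 : ℝ) T => Avf V ρ1 t (x + latticeVec l k) :=
    funext fun t => ((D.Avf_periodic t.2).add_latticeVec k x).symm
  rw [hk']
  have : CompactSpace (box d l) := isCompact_iff_compactSpace.1 isCompact_box
  have hκ : ∀ t, Continuous fun y => diverg (fun z => ρ2 t z • gradient (potential V ρ1 t) z) y :=
    fun t => ((D.snd.1 t).smul (D.potential_smooth t).gradient).diverg.continuous
  let G : Icc (0 : ℝ) T → C(box d l, ℝ × ℝ) := fun t =>
    ⟨fun y => (ρ2 t y, diverg (fun z => ρ2 t z • gradient (potential V ρ1 t) z) y),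
      ((D.snd.1 t).continuous.prodMk (hκ t)).comp continuous_subtype_val⟩
  refine measurable_of_continuousMap_stable (G := G) (fun y => ?_) fun s ε hε => ?_
  · have hd : ∀ t, HasDerivAt (fun τ => ρ2 τ y)
        (diverg (fun z => ρ2 t z • gradient (potential V ρ1 t) z) y) t := fun t => by
      rw [← D.diverg_snd]
      exact D.snd.2.2.2.2 t y
    have h1 : Measurable fun t => ρ2 t y :=
      (continuous_iff_continuousAt.2 fun t => (hd t).continuousAt).measurable
    have h2 : Measurable fun t => diverg (fun z => ρ2 t z • gradient (potential V ρ1 t) z) y := by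
      rw [← funext fun t => (hd t).deriv]
      exact measurable_deriv _
    exact (h1.prodMk h2).comp measurable_subtype_coe
  · obtain ⟨r, hr, h⟩ := D.exists_stable_radius hk hε
    refine ⟨r, hr, fun t ht => ?_⟩
    have hle : ∀ y : box d l, dist (G t y) (G s y) ≤ r := fun y =>
      (ContinuousMap.dist_apply_le_dist y).trans ht.le
    rw [dist_eq_norm]
    refine h s s.2 t t.2 (fun y hy => ?_) fun y hy => ?_
    · exact (le_max_left _ _).trans (hle ⟨y, hy⟩)
    · exact (le_max_right _ _).trans (hle ⟨y, hy⟩)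

lemma stronglyMeasurable_residualEnergy (D : ResidualDynamics d l T S f V α₀ ρ1 ρ2) :
    StronglyMeasurable fun t : Icc (0 : ℝ) T => residualEnergy l f V ρ1 t := by
  have h0 : ∀ x, StronglyMeasurable fun t : Icc (0 : ℝ) T => deltaF f V ρ1 t x := fun x =>
    (D.velocity_continuous.comp
      (continuous_subtype_val.prodMk continuous_const)).stronglyMeasurable.sub
      (D.measurable_Avf x).stronglyMeasurable
  have h1 := stronglyMeasurable_fderiv h0 fun t =>
    (D.deltaF_smooth t).differentiable (by simp)
  have h2 := stronglyMeasurable_fderiv h1 fun t =>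
    ((D.deltaF_smooth t).fderiv_right (m := (⊤ : ℕ∞)) (by simp)).differentiable (by simp)
  have hρ : ∀ x, StronglyMeasurable fun t : Icc (0 : ℝ) T => ρ1 t x := fun x =>
    ((continuous_iff_continuousAt.2 fun t => (D.fst.2.2.2.2 t x).continuousAt).comp
      continuous_subtype_val).stronglyMeasurable
  have hm : StronglyMeasurable (Function.uncurry fun (x : E d) (t : Icc (0 : ℝ) T) =>
      (‖deltaF f V ρ1 t x‖ ^ 2 + ‖fderiv ℝ (deltaF f V ρ1 t) x‖ ^ 2
        + ‖fderiv ℝ (fun y => fderiv ℝ (deltaF f V ρ1 t) y) x‖ ^ 2) * ρ1 t x) := by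
    refine stronglyMeasurable_uncurry_of_continuous_of_stronglyMeasurable (fun t => ?_) fun x => ?_
    · have c1 : ContDiff ℝ 1 (fderiv ℝ (deltaF f V ρ1 t)) :=
        contDiff_infty.1 ((D.deltaF_smooth t).fderiv_right (by simp)) 1
      have c2 : Continuous fun x => ‖fderiv ℝ (fun y => fderiv ℝ (deltaF f V ρ1 t) y) x‖ :=
        (continuous_norm (E := E d →L[ℝ] E d →L[ℝ] E d)).comp (c1.continuous_fderiv one_ne_zero)
      exact ((((D.deltaF_smooth t).continuous.norm.pow 2).add (c1.continuous.norm.pow 2)).add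
        (c2.pow 2)).mul (D.fst.1 t).continuous
    · have n2 : StronglyMeasurable fun t : Icc (0 : ℝ) T =>
          ‖fderiv ℝ (fun y => fderiv ℝ (deltaF f V ρ1 t) y) x‖ :=
        (continuous_norm (E := E d →L[ℝ] E d →L[ℝ] E d)).comp_stronglyMeasurable (h2 x)
      exact ((((h0 x).norm.pow 2).add ((h1 x).norm.pow 2)).add (n2.pow 2)).mul (hρ x)
  exact (hm.comp_measurable measurable_swap).integral_prod_right'

lemma intervalIntegrable_residualEnergy (D : ResidualDynamics d l T S f V α₀ ρ1 ρ2)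
    (hT : 0 ≤ T) : IntervalIntegrable (residualEnergy l f V ρ1) volume 0 T := by
  obtain ⟨M, hM, hδ⟩ := D.exists_norm_deltaF_le
  obtain ⟨M', hM', hρ⟩ := D.exists_density_le
  have hS2 : 0 ≤ S + S := add_nonneg D.nonneg D.nonneg
  rw [intervalIntegrable_iff_integrableOn_Icc_of_le hT]
  refine Integrable.of_bound ?_ ((M ^ 2 + (S + S) ^ 2 + (S + S) ^ 2) * M' *
    volume.real (box d l)) ?_
  · rw [← map_comap_subtype_coe measurableSet_Icc]
    exact (MeasurableEmbedding.subtype_coe measurableSet_Icc).aestronglyMeasurable_map_iff.2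
      D.stronglyMeasurable_residualEnergy.aestronglyMeasurable
  · refine ae_restrict_of_forall_mem measurableSet_Icc fun t ht => ?_
    refine norm_setIntegral_le_of_norm_le_const isCompact_box.measure_lt_top fun x _ => ?_
    have d1 := (D.diffBound_deltaF ht le_rfl one_le_two).fderiv hS2
      ((D.deltaF_smooth t).differentiable (by simp))
    have d2 := ((D.diffBound_deltaF ht one_le_two le_rfl).fderiv hS2
      ((D.deltaF_smooth t).differentiable (by simp))).fderiv hS2
      (((D.deltaF_smooth t).fderiv_right (m := (⊤ : ℕ∞)) (by simp)).differentiable (by simp))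
    have b1 := diffBound_zero.1 d1 x
    have b2 := diffBound_zero.1 d2 x
    have b0 := hδ t ht x
    have hpos := (D.fst.2.1 t x).le
    rw [norm_mul, Real.norm_of_nonneg hpos, Real.norm_of_nonneg (by positivity)]
    have := (hρ t ht x).1
    gcongr

end ResidualDynamics

end Measurability

/-- under assumptions (A1)–(A3), with `ρ¹` transported by `f` and
`ρ²` transported by `A[f]`, and `ξ_t = ∫_𝒳 ‖∇log ρ¹_t - ∇log ρ²_t‖² ρ²_t dx`, there
is a constant `C₂ > 0` depending only on `T, L₀, L_f, L_v` such that
`∫₀ᵗ ξ_s ds ≤ C₂ R(f)` for every `t ∈ [0,T]`. -/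
theorem score_difference_integral_bound
    (d : ℕ) (hd : 0 < d) (l T L₀ Lf Lv : ℝ) (hl : 0 < l) (hT : 0 < T) :
    ∃ C₂ : ℝ, 0 < C₂ ∧
      ∀ (f : ℝ → E d → E d) (K : NNReal) (V : ℝ → E d → ℝ)
        (α₀ : E d → ℝ) (ρ1 ρ2 : ℝ → E d → ℝ),
        (∀ t, ContDiff ℝ (⊤ : ℕ∞) (f t)) → Continuous (Function.uncurry f) →
        (∀ t, LipschitzWith K (f t)) →
        (∀ t, ContDiff ℝ (⊤ : ℕ∞) (V t)) →
        InitDensity d l α₀ → RegInit d l L₀ α₀ →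
        RegVel d l T Lf f → RegPot d l T Lv V →
        TransportedBy d l f α₀ ρ1 →
        TransportedBy d l (Avf V ρ1) α₀ ρ2 →
        ∀ t ∈ Icc (0 : ℝ) T,
          (∫ s in (0 : ℝ)..t, ∫ x in box d l,
              ‖score (ρ1 s) x - score (ρ2 s) x‖ ^ 2 * ρ2 s x) ≤
            C₂ * Rloss d l T f V ρ1 := by
  obtain ⟨S, hS, hbd⟩ := exists_uniformBounds d l T L₀ Lf Lv hl hT
  set C := d * gapConst d S * T * Real.exp (d * gapConst d S * T) with hC
  have hg := gapConst_nonneg (d := d) hS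
  have hC0 : 0 ≤ C := by positivity
  refine ⟨C + 1, by positivity, ?_⟩
  intro f K V α₀ ρ1 ρ2 hf hfc _ hV hα hreg hvel hpot h1 h2 t ht
  have D : ResidualDynamics d l T S f V α₀ ρ1 ρ2 :=
    { side_pos := hl
      nonneg := hS
      velocity_smooth := hf
      velocity_continuous := hfc
      velocity_periodic := fun t ht => (hvel t ht).1
      drift_smooth := hV
      drift_periodic := fun t ht => (hpot t ht).1
      fst := h1
      snd := h2
      bounds := hbd f V α₀ ρ1 ρ2 hf hV hα hreg hvel hpot h1 h2 }
  have hR : 0 ≤ Rloss d l T f V ρ1 :=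
    intervalIntegral.integral_nonneg hT.le fun s _ =>
      residualEnergy_nonneg (l := l) (f := f) (V := V) h1.2.1 s
  calc ∫ s in (0 : ℝ)..t, scoreGap l ρ1 ρ2 s ≤ C * Rloss d l T f V ρ1 :=
        D.integral_scoreGap_le (D.intervalIntegrable_residualEnergy hT.le) ht
    _ ≤ (C + 1) * Rloss d l T f V ρ1 := mul_le_mul_of_nonneg_right (by linarith) hR
end
end

section
/- Consider the ODE-constrained loss ℓ(θ) = ∫₀ᵀ g(s(t), t, θ) dt, where s(t) solves ṡ(t) = ψ(s(t), t, θ) with s(0) = s₀ independent of θ, and ψ and g are continuously differentiable in (s, θ). Let a(t) be the solution of the adjoint final-value problem ȧ(t)ᵀ + a(t)ᵀ ∂ψ/∂s(s(t), t, θ) + ∂g/∂s(s(t), t, θ) = 0 with a(T) = 0. Then the gradient of the loss is dℓ/dθ = ∫₀ᵀ [a(t)ᵀ ∂ψ/∂θ(s(t), t, θ) + ∂g/∂θ(s(t), t, θ)] dt. -/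
open MeasureTheory Set

noncomputable section

theorem IsCompact.exists_norm_sub_sub_fderiv_le {X Y : Type*} [NormedAddCommGroup X]
    [NormedSpace ℝ X] [NormedAddCommGroup Y] [NormedSpace ℝ Y] {F : X → Y}
    (hF : ContDiff ℝ 1 F) {K : Set X} (hK : IsCompact K) {ε : ℝ} (hε : 0 < ε) :
    ∃ r > 0, ∀ x ∈ K, ∀ y, ‖y - x‖ < r →
      ‖F y - F x - fderiv ℝ F x (y - x)‖ ≤ ε * ‖y - x‖ := by
  have hcont : Continuous (fderiv ℝ F) := hF.continuous_fderiv one_ne_zero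
  have hunif := hK.uniformContinuousAt_of_continuousAt (fderiv ℝ F)
    (fun x _ => hcont.continuousAt) (Metric.dist_mem_uniformity hε)
  obtain ⟨r, hr, hball⟩ := Metric.mem_uniformity_dist.1 hunif
  refine ⟨r, hr, fun x hx y hy => ?_⟩
  refine (convex_ball x r).norm_image_sub_le_of_norm_hasFDerivWithin_le'
    (f' := fderiv ℝ F) (fun z _ => ?_) (fun z hz => ?_) (Metric.mem_ball_self hr)
    (by simpa [dist_eq_norm] using hy)
  · exact ((hF.differentiable one_ne_zero) z).hasFDerivAt.hasFDerivWithinAt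
  · have h := @hball x z (by rwa [dist_comm]) hx
    rw [← dist_eq_norm, dist_comm]
    exact le_of_lt h

/-- Solutions of an ODE with `C¹` right-hand side depend Lipschitz continuously on the parameter,
locally in the parameter and uniformly on compact time intervals. -/
theorem exists_norm_sub_le_of_hasDerivAt_param {X P : Type*} [NormedAddCommGroup X]
    [NormedSpace ℝ X] [NormedAddCommGroup P] [NormedSpace ℝ P] {ψ : X → ℝ → P → X}
    (hψ : ContDiff ℝ 1 (fun q : (X × ℝ) × P => ψ q.1.1 q.1.2 q.2)) {s : P → ℝ → X} {s₀ : X}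
    (hs0 : ∀ θ, s θ 0 = s₀) (hs : ∀ θ t, HasDerivAt (s θ) (ψ (s θ t) t θ) t)
    (θ : P) {T : ℝ} (hT : 0 ≤ T) :
    ∃ C ≥ 1, ∃ r > 0, ∀ θ', ‖θ' - θ‖ < r → ∀ t ∈ Icc 0 T,
      ‖s θ' t - s θ t‖ ≤ C * ‖θ' - θ‖ := by
  set Ψ := fun q : (X × ℝ) × P => ψ q.1.1 q.1.2 q.2
  have hscont (θ) : Continuous (s θ) :=
    continuous_iff_continuousAt.2 fun t => (hs θ t).continuousAt
  set c : ℝ → (X × ℝ) × P := fun t => ((s θ t, t), θ) with hc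
  have hccont : Continuous c := by have := hscont θ; fun_prop
  have hK : IsCompact (c '' Icc 0 T) := isCompact_Icc.image hccont
  obtain ⟨r, hr, hrem⟩ := hK.exists_norm_sub_sub_fderiv_le hψ one_pos
  obtain ⟨M, hM⟩ := hK.exists_bound_of_continuousOn (hψ.continuous_fderiv one_ne_zero).continuousOn
  have hM0 : 0 ≤ M := (norm_nonneg _).trans (hM _ ⟨0, ⟨le_rfl, hT⟩, rfl⟩)
  have hC0 : 0 < Real.exp ((M + 2) * T) := Real.exp_pos _
  refine ⟨Real.exp ((M + 2) * T), Real.one_le_exp (by positivity),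
    r / Real.exp ((M + 2) * T), by positivity, fun θ' hθ' => ?_⟩
  rw [lt_div_iff₀ hC0] at hθ'
  rcases eq_or_ne θ' θ with rfl | hne
  · simp
  have hh : 0 < ‖θ' - θ‖ := norm_pos_iff.2 (sub_ne_zero.2 hne)
  have hB (t : ℝ) : HasDerivAt (fun t => ‖θ' - θ‖ * Real.exp ((M + 2) * t))
      (‖θ' - θ‖ * (Real.exp ((M + 2) * t) * (M + 2))) t := by
    simpa using (((hasDerivAt_id t).const_mul (M + 2)).exp).const_mul ‖θ' - θ‖
  have hmono {t : ℝ} (ht : t ≤ T) : Real.exp ((M + 2) * t) ≤ Real.exp ((M + 2) * T) := by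
    gcongr
  have hfence := image_norm_le_of_norm_deriv_right_lt_deriv_boundary
    (f := fun t => s θ' t - s θ t) (f' := fun t => ψ (s θ' t) t θ' - ψ (s θ t) t θ)
    (a := 0) (b := T) ((hscont θ').sub (hscont θ)).continuousOn
    (fun t _ => ((hs θ' t).sub (hs θ t)).hasDerivWithinAt)
    (by simp [hs0]) hB
    (fun t ht heq => by
      have hexp : 1 ≤ Real.exp ((M + 2) * t) :=
        Real.one_le_exp (mul_nonneg (by positivity) ht.1)
      have hcmem : c t ∈ c '' Icc 0 T := ⟨t, ⟨ht.1, ht.2.le⟩, rfl⟩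
      have hnorm : ‖((s θ' t, t), θ') - c t‖ = ‖θ' - θ‖ * Real.exp ((M + 2) * t) := by
        simp only [hc, Prod.mk_sub_mk, sub_self, Prod.norm_mk, norm_zero, heq]
        rw [max_eq_left (by positivity : 0 ≤ ‖θ' - θ‖ * Real.exp ((M + 2) * t)),
          max_eq_left (by nlinarith)]
      have h1 := hrem _ hcmem ((s θ' t, t), θ') (by
        rw [hnorm]; nlinarith [hmono ht.2.le])
      have h2 := (fderiv ℝ Ψ (c t)).le_of_opNorm_le (hM _ hcmem) (((s θ' t, t), θ') - c t)
      have h3 := norm_le_norm_add_norm_sub' (Ψ ((s θ' t, t), θ') - Ψ (c t))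
        (fderiv ℝ Ψ (c t) (((s θ' t, t), θ') - c t))
      change ‖Ψ ((s θ' t, t), θ') - Ψ (c t)‖ < _
      rw [hnorm] at h1 h2
      have : 0 < ‖θ' - θ‖ * Real.exp ((M + 2) * t) := by positivity
      nlinarith)
  intro t ht
  refine (hfence ht).trans ?_
  rw [mul_comm]
  exact mul_le_mul_of_nonneg_right (hmono ht.2) hh.le

theorem fderiv_partial_state {X P Y : Type*} [NormedAddCommGroup X] [NormedSpace ℝ X]
    [NormedAddCommGroup P] [NormedSpace ℝ P] [NormedAddCommGroup Y] [NormedSpace ℝ Y]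
    {F : X → ℝ → P → Y} (hF : ContDiff ℝ 1 (fun q : (X × ℝ) × P => F q.1.1 q.1.2 q.2))
    (x : X) (t : ℝ) (θ : P) :
    fderiv ℝ (fun σ => F σ t θ) x =
      (fderiv ℝ (fun q : (X × ℝ) × P => F q.1.1 q.1.2 q.2) ((x, t), θ)).comp
        ((ContinuousLinearMap.inl ℝ (X × ℝ) P).comp (ContinuousLinearMap.inl ℝ X ℝ)) := by
  have h := ((hF.differentiable one_ne_zero) ((x, t), θ)).hasFDerivAt
  exact (h.comp x ((hasFDerivAt_prodMk_left (x, t) θ).comp x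
    (hasFDerivAt_prodMk_left (𝕜 := ℝ) x t))).fderiv

theorem fderiv_partial_param {X P Y : Type*} [NormedAddCommGroup X] [NormedSpace ℝ X]
    [NormedAddCommGroup P] [NormedSpace ℝ P] [NormedAddCommGroup Y] [NormedSpace ℝ Y]
    {F : X → ℝ → P → Y} (hF : ContDiff ℝ 1 (fun q : (X × ℝ) × P => F q.1.1 q.1.2 q.2))
    (x : X) (t : ℝ) (θ : P) :
    fderiv ℝ (fun θ' => F x t θ') θ =
      (fderiv ℝ (fun q : (X × ℝ) × P => F q.1.1 q.1.2 q.2) ((x, t), θ)).comp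
        (ContinuousLinearMap.inr ℝ (X × ℝ) P) := by
  have h := ((hF.differentiable one_ne_zero) ((x, t), θ)).hasFDerivAt
  exact (h.comp θ (hasFDerivAt_prodMk_right (𝕜 := ℝ) (x, t) θ)).fderiv

/-- adjoint method for ODE-constrained losses: let
`ℓ(θ) = ∫₀ᵀ g(s_θ(t), t, θ) dt` where `s_θ` solves `ṡ = ψ(s, t, θ)`, `s_θ(0) = s₀`
(independent of `θ`), with `ψ, g` continuously differentiable in `(s, θ)`.  If `a`
solves the adjoint final-value problem
`ȧ(t) = -(∂ψ/∂s)ᵀ a(t) - ∇_s g`, `a(T) = 0`, then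
`dℓ/dθ = ∫₀ᵀ [(∂ψ/∂θ)ᵀ a(t) + ∇_θ g] dt` (written in the paper as
`∫₀ᵀ [a(t)ᵀ ∂ψ/∂θ + ∂g/∂θ] dt`). -/
theorem adjoint_method_gradient
    (m p : ℕ) (T : ℝ) (hT : 0 < T)
    (ψ : E m → ℝ → E p → E m) (g : E m → ℝ → E p → ℝ)
    (hψ : ContDiff ℝ 1 (fun q : (E m × ℝ) × E p => ψ q.1.1 q.1.2 q.2))
    (hg : ContDiff ℝ 1 (fun q : (E m × ℝ) × E p => g q.1.1 q.1.2 q.2))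
    (s₀ : E m) (s : E p → ℝ → E m)
    (hs0 : ∀ θ, s θ 0 = s₀)
    (hsode : ∀ θ t, HasDerivAt (s θ) (ψ (s θ t) t θ) t)
    (θ : E p) (a : ℝ → E m)
    (haT : a T = 0)
    (haode : ∀ t, HasDerivAt a
      (-(ContinuousLinearMap.adjoint
            (fderiv ℝ (fun σ => ψ σ t θ) (s θ t))) (a t)
        - gradient (fun σ => g σ t θ) (s θ t)) t) :
    HasGradientAt (fun θ' => ∫ t in (0 : ℝ)..T, g (s θ' t) t θ')
      (∫ t in (0 : ℝ)..T,
        ((ContinuousLinearMap.adjoint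
            (fderiv ℝ (fun θ' => ψ (s θ t) t θ') θ)) (a t)
          + gradient (fun θ' => g (s θ t) t θ') θ)) θ := by
  set Ψ := fun q : (E m × ℝ) × E p => ψ q.1.1 q.1.2 q.2 with hΨ
  set Γ := fun q : (E m × ℝ) × E p => g q.1.1 q.1.2 q.2 with hΓ
  have hscont (θ) : Continuous (s θ) :=
    continuous_iff_continuousAt.2 fun t => (hsode θ t).continuousAt
  have hacont : Continuous a := continuous_iff_continuousAt.2 fun t => (haode t).continuousAt
  set c : ℝ → (E m × ℝ) × E p := fun t => ((s θ t, t), θ) with hc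
  have hccont : Continuous c := by have := hscont θ; fun_prop
  have hψs (t : ℝ) : fderiv ℝ (fun σ => ψ σ t θ) (s θ t) = _ := fderiv_partial_state hψ _ _ _
  have hψθ (t : ℝ) : fderiv ℝ (fun θ' => ψ (s θ t) t θ') θ = _ := fderiv_partial_param hψ _ _ _
  have hgs (t : ℝ) : fderiv ℝ (fun σ => g σ t θ) (s θ t) = _ := fderiv_partial_state hg _ _ _
  have hgθ (t : ℝ) : fderiv ℝ (fun θ' => g (s θ t) t θ') θ = _ := fderiv_partial_param hg _ _ _
  have hDψ : Continuous fun t => fderiv ℝ Ψ (c t) := (hψ.continuous_fderiv one_ne_zero).comp hccont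
  have hDg : Continuous fun t => fderiv ℝ Γ (c t) := (hg.continuous_fderiv one_ne_zero).comp hccont
  have hψcont (θ') : Continuous fun t => ψ (s θ' t) t θ' :=
    hψ.continuous.comp (((hscont θ').prodMk continuous_id).prodMk continuous_const)
  have hgcont (θ') : Continuous fun t => g (s θ' t) t θ' :=
    hg.continuous.comp (((hscont θ').prodMk continuous_id).prodMk continuous_const)
  have hgrad : Continuous fun t => (ContinuousLinearMap.adjoint
      (fderiv ℝ (fun θ' => ψ (s θ t) t θ') θ)) (a t) + gradient (fun θ' => g (s θ t) t θ') θ := by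
    simp only [gradient, hψθ, hgθ]
    refine Continuous.add (Continuous.clm_apply ?_ hacont) ?_
    · exact ContinuousLinearMap.adjoint.continuous.comp (hDψ.clm_comp continuous_const)
    · exact (InnerProductSpace.toDual ℝ (E p)).symm.continuous.comp
        (hDg.clm_comp continuous_const)
  have hda : Continuous fun t => -(ContinuousLinearMap.adjoint
      (fderiv ℝ (fun σ => ψ σ t θ) (s θ t))) (a t) - gradient (fun σ => g σ t θ) (s θ t) := by
    simp only [gradient, hψs, hgs]
    refine Continuous.sub (Continuous.neg (Continuous.clm_apply ?_ hacont)) ?_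
    · exact ContinuousLinearMap.adjoint.continuous.comp (hDψ.clm_comp continuous_const)
    · exact (InnerProductSpace.toDual ℝ (E m)).symm.continuous.comp
        (hDg.clm_comp continuous_const)
  have hK : IsCompact (c '' Icc 0 T) := isCompact_Icc.image hccont
  obtain ⟨C, hC1, r, hr, hlip⟩ := exists_norm_sub_le_of_hasDerivAt_param hψ hs0 hsode θ hT.le
  have hC0 : 0 < C := one_pos.trans_le hC1
  obtain ⟨N, hN⟩ := isCompact_Icc.exists_bound_of_continuousOn
    (s := Icc (0 : ℝ) T) hacont.continuousOn
  have hN0 : 0 ≤ N := (norm_nonneg _).trans (hN 0 ⟨le_rfl, hT.le⟩)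
  rw [hasGradientAt_iff_isLittleO, Asymptotics.isLittleO_iff]
  intro ε hε
  set ε' := ε / (T * ((1 + N) * C)) with hε'
  have hε'0 : 0 < ε' := by positivity
  obtain ⟨r₁, hr₁, hremψ⟩ := hK.exists_norm_sub_sub_fderiv_le hψ hε'0
  obtain ⟨r₂, hr₂, hremg⟩ := hK.exists_norm_sub_sub_fderiv_le hg hε'0
  have hρ : 0 < min r (min r₁ r₂ / C) := by positivity
  filter_upwards [Metric.ball_mem_nhds θ hρ] with θ' hθ'
  rw [mem_ball_iff_norm, lt_min_iff, lt_div_iff₀ hC0, lt_min_iff] at hθ'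
  obtain ⟨hθr, hθ₁, hθ₂⟩ := hθ'
  have hgdiff : Continuous fun t => g (s θ' t) t θ' - g (s θ t) t θ :=
    (hgcont θ').sub (hgcont θ)
  have hψdiff : Continuous fun t => ψ (s θ' t) t θ' - ψ (s θ t) t θ :=
    (hψcont θ').sub (hψcont θ)
  have hsdiff : Continuous fun t => s θ' t - s θ t := (hscont θ').sub (hscont θ)
  have hinner : inner ℝ (∫ t in (0 : ℝ)..T, ((ContinuousLinearMap.adjoint
      (fderiv ℝ (fun θ' => ψ (s θ t) t θ') θ)) (a t) + gradient (fun θ' => g (s θ t) t θ') θ))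
      (θ' - θ) = ∫ t in (0 : ℝ)..T, inner ℝ ((ContinuousLinearMap.adjoint
      (fderiv ℝ (fun θ' => ψ (s θ t) t θ') θ)) (a t) + gradient (fun θ' => g (s θ t) t θ') θ)
      (θ' - θ) :=
    (((innerSL ℝ).flip (θ' - θ)).intervalIntegral_comp_comm
      (hgrad.intervalIntegrable 0 T)).symm
  have hboundary : ∫ t in (0 : ℝ)..T, (inner ℝ (a t) (ψ (s θ' t) t θ' - ψ (s θ t) t θ) +
      inner ℝ (-(ContinuousLinearMap.adjoint
        (fderiv ℝ (fun σ => ψ σ t θ) (s θ t))) (a t) - gradient (fun σ => g σ t θ) (s θ t))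
        (s θ' t - s θ t)) = 0 := by
    rw [intervalIntegral.integral_eq_sub_of_hasDerivAt
      (fun t _ => (haode t).inner ℝ ((hsode θ' t).fun_sub (hsode θ t)))]
    · simp [haT, hs0]
    · exact ((hacont.inner hψdiff).add
        (hda.inner hsdiff)).intervalIntegrable _ _
  have hremainder : (∫ t in (0 : ℝ)..T, g (s θ' t) t θ') - (∫ t in (0 : ℝ)..T, g (s θ t) t θ) -
      inner ℝ (∫ t in (0 : ℝ)..T, ((ContinuousLinearMap.adjoint
        (fderiv ℝ (fun θ' => ψ (s θ t) t θ') θ)) (a t) +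
        gradient (fun θ' => g (s θ t) t θ') θ)) (θ' - θ) =
      ∫ t in (0 : ℝ)..T,
        ((Γ ((s θ' t, t), θ') - Γ (c t) - fderiv ℝ Γ (c t) (((s θ' t, t), θ') - c t)) +
        inner ℝ (a t)
          (Ψ ((s θ' t, t), θ') - Ψ (c t) - fderiv ℝ Ψ (c t) (((s θ' t, t), θ') - c t))) := by
    rw [hinner, ← intervalIntegral.integral_sub ((hgcont θ').intervalIntegrable _ _)
        ((hgcont θ).intervalIntegrable _ _),
      ← intervalIntegral.integral_sub
        (hgdiff.intervalIntegrable _ _)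
        ((hgrad.inner continuous_const).intervalIntegrable _ _)]
    have hadd := intervalIntegral.integral_add
      ((hgdiff.fun_sub (hgrad.inner (continuous_const (y := θ' - θ)))).intervalIntegrable 0 T)
      (((hacont.inner hψdiff).fun_add (hda.inner hsdiff)).intervalIntegrable 0 T)
      (μ := volume)
    rw [hboundary, add_zero] at hadd
    rw [← hadd]
    congr 1
    ext t
    have hsplit : ((s θ' t, t), θ') - c t =
        ((s θ' t - s θ t, 0), 0) + (0, θ' - θ) := by simp [hc]
    simp only [hsplit, inner_add_left, inner_sub_left, inner_neg_left, gradient,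
      ContinuousLinearMap.adjoint_inner_left, InnerProductSpace.toDual_symm_apply,
      hψs, hψθ, hgs, hgθ, ContinuousLinearMap.comp_apply, ContinuousLinearMap.inl_apply,
      ContinuousLinearMap.inr_apply]
    simp only [map_add, inner_sub_right, inner_add_right, hΨ, hΓ, hc]
    ring
  rw [hremainder]
  have hbound := intervalIntegral.norm_integral_le_of_norm_le_const (a := 0) (b := T)
    (C := ε / T * ‖θ' - θ‖) (f := fun t =>
      (Γ ((s θ' t, t), θ') - Γ (c t) - fderiv ℝ Γ (c t) (((s θ' t, t), θ') - c t)) +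
        inner ℝ (a t)
          (Ψ ((s θ' t, t), θ') - Ψ (c t) - fderiv ℝ Ψ (c t) (((s θ' t, t), θ') - c t))) ?_
  · refine hbound.trans_eq ?_
    rw [sub_zero, abs_of_pos hT]
    field_simp
  intro t ht
  rw [uIoc_of_le hT.le] at ht
  have ht' : t ∈ Icc 0 T := Ioc_subset_Icc_self ht
  have hnorm : ‖((s θ' t, t), θ') - c t‖ ≤ C * ‖θ' - θ‖ := by
    simp only [hc, Prod.mk_sub_mk, sub_self, Prod.norm_mk, norm_zero]
    exact max_le (max_le (hlip θ' hθr t ht') (by positivity))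
      (le_mul_of_one_le_left (norm_nonneg _) hC1)
  rw [mul_comm] at hθ₁ hθ₂
  have h1 := hremψ _ ⟨t, ht', rfl⟩ _ (hnorm.trans_lt hθ₁)
  have h2 := hremg _ ⟨t, ht', rfl⟩ _ (hnorm.trans_lt hθ₂)
  calc _ ≤ ε' * (C * ‖θ' - θ‖) + N * (ε' * (C * ‖θ' - θ‖)) := by
        refine (norm_add_le _ _).trans (add_le_add (h2.trans (by gcongr)) ?_)
        refine (norm_inner_le_norm _ _).trans ?_
        gcongr
        · exact hN t ht'
        · exact h1.trans (by gcongr)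
    _ = ε / T * ‖θ' - θ‖ := by rw [hε']; field_simp
end
end
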